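/- For n ≥ 3 let N = C(n,2) and let (e_1, …, e_N) be a uniformly random ordering of the N edges of the complete graph on {1,…,n}. For 0 ≤ m ≤ N let G_m be the graph on {1,…,n} with edge set {e_1, …, e_m}, and let T = min{m : the minimum degree of G_m is at least 2}. Then asymptotically almost surely (as n → ∞) the following holds: for every m with 0 ≤ m < N, the right-angled Coxeter group K(G_m) virtually algebraically fibers if and only if T ≤ m. -/

import Mathlib

/-- The defining relations of the right-angled Coxeter group of a graph `G`:
`x_v² = 1` for every vertex `v`, and `(x_u x_v)² = 1` for every edge `{u,v}`. -/
def racgRels {V : Type*} (G : SimpleGraph V) : Set (FreeGroup V) :=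
  {r | (∃ v : V, r = FreeGroup.of v * FreeGroup.of v) ∨
    (∃ u v : V, G.Adj u v ∧ r = (FreeGroup.of u * FreeGroup.of v) ^ 2)}

/-- The right-angled Coxeter group associated to the graph `G`. -/
abbrev RACG {V : Type*} (G : SimpleGraph V) : Type _ :=
  PresentedGroup (racgRels G)

/-- A group `K` virtually algebraically fibers if some finite-index subgroup admits a
surjective homomorphism onto `ℤ` with finitely generated kernel. -/
def VirtuallyAlgebraicallyFibers (K : Type*) [Group K] : Prop :=
  ∃ K' : Subgroup K, K'.index ≠ 0 ∧
    ∃ φ : K' →* Multiplicative ℤ, Function.Surjective φ ∧ φ.ker.FG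

open Filter

/-- The graph after `m` steps of the random graph process determined by the edge
ordering `σ`: its edges are the first `m` edges in the ordering. -/
def processGraph {n : ℕ} (σ : Fin (n.choose 2) ≃ {e : Sym2 (Fin n) // ¬ e.IsDiag})
    (m : ℕ) : SimpleGraph (Fin n) :=
  SimpleGraph.fromEdgeSet {e | ∃ i : Fin (n.choose 2), (i : ℕ) < m ∧ (σ i : Sym2 (Fin n)) = e}

/-- The hitting time for minimum degree 2 in the random graph process given by `σ`. -/
noncomputable def hittingTime {n : ℕ}
    (σ : Fin (n.choose 2) ≃ {e : Sym2 (Fin n) // ¬ e.IsDiag}) : ℕ :=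
  sInf {m : ℕ | ∀ v : Fin n, 2 ≤ ((processGraph σ m).neighborSet v).ncard}


namespace RacgFib

section basics
variable {V : Type*} {G : SimpleGraph V}

/-- generator -/
def gen (G : SimpleGraph V) (v : V) : RACG G := PresentedGroup.of v

/-- universal property -/
def lift {H : Type*} [Group H] (f : V → H) (h1 : ∀ v, f v * f v = 1)
    (h2 : ∀ u v, G.Adj u v → (f u * f v) ^ 2 = 1) : RACG G →* H :=
  PresentedGroup.toGroup (f := f) (rels := racgRels G) (by
    rintro r (⟨v, rfl⟩ | ⟨u, v, huv, rfl⟩)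
    · simpa using h1 v
    · simpa using h2 u v huv)

@[simp] lemma lift_gen {H : Type*} [Group H] (f : V → H) (h1 : ∀ v, f v * f v = 1)
    (h2 : ∀ u v, G.Adj u v → (f u * f v) ^ 2 = 1) (v : V) :
    lift f h1 h2 (gen G v) = f v := by
  simp [lift, gen]

lemma gen_sq (v : V) : gen G v * gen G v = 1 := by
  have : (QuotientGroup.mk' (Subgroup.normalClosure (racgRels G))) (FreeGroup.of v * FreeGroup.of v) = 1 := by
    rw [QuotientGroup.mk'_apply, QuotientGroup.eq_one_iff]
    exact Subgroup.subset_normalClosure (Or.inl ⟨v, rfl⟩)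
  exact this

lemma gen_inv (v : V) : (gen G v)⁻¹ = gen G v := inv_eq_of_mul_eq_one_left (gen_sq v)

lemma gen_adj_sq {u v : V} (h : G.Adj u v) : (gen G u * gen G v) ^ 2 = 1 := by
  have : (QuotientGroup.mk' (Subgroup.normalClosure (racgRels G)))
      ((FreeGroup.of u * FreeGroup.of v) ^ 2) = 1 := by
    rw [QuotientGroup.mk'_apply, QuotientGroup.eq_one_iff]
    exact Subgroup.subset_normalClosure (Or.inr ⟨u, v, h, rfl⟩)
  exact this

lemma gen_comm {u v : V} (h : G.Adj u v) : gen G u * gen G v = gen G v * gen G u := by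
  have h1 := gen_adj_sq h
  have : (gen G u * gen G v)⁻¹ = gen G u * gen G v := by
    apply inv_eq_of_mul_eq_one_left
    rw [← sq, h1]
  rw [← this, mul_inv_rev, gen_inv, gen_inv]

lemma closure_gen : Subgroup.closure (Set.range (gen G)) = ⊤ :=
  PresentedGroup.closure_range_of (racgRels G)

/-- two commuting involutions -/
lemma sq_of_comm {H : Type*} [Group H] {a b : H} (ha : a * a = 1) (hb : b * b = 1)
    (h : a * b = b * a) : (a * b) ^ 2 = 1 := by
  rw [sq]
  calc a * b * (a * b) = a * b * (b * a) := by rw [h]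
    _ = a * (b * b) * a := by group
    _ = 1 := by rw [hb, mul_one, ha]

/-- kill generators outside `L` -/
noncomputable def kill (G : SimpleGraph V) (L : Set V) : RACG G →* RACG G :=
  open Classical in
  lift (fun v => if v ∈ L then gen G v else 1)
    (by intro v; by_cases h : v ∈ L <;> simp [h, gen_sq])
    (by
      intro u v huv
      by_cases hu : u ∈ L <;> by_cases hv : v ∈ L <;> simp [hu, hv, gen_adj_sq huv, sq, gen_sq])

lemma kill_mem {L : Set V} {v : V} (h : v ∈ L) : kill G L (gen G v) = gen G v := by
  simp [kill, h]

lemma kill_not_mem {L : Set V} {v : V} (h : v ∉ L) : kill G L (gen G v) = 1 := by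
  simp [kill, h]

/-- the map to the infinite dihedral group given by a non-adjacent pair -/
noncomputable def dihedralMap (a b : V) (hab : a ≠ b) (hn : ¬ G.Adj a b) : RACG G →* DihedralGroup 0 :=
  open Classical in
  lift (fun v => if v = a then DihedralGroup.sr 0 else if v = b then DihedralGroup.sr 1 else 1)
    (by
      intro v
      by_cases h : v = a
      · simp [h]
      · by_cases h' : v = b
        · simp [h', hab.symm]
        · simp [h, h'])
    (by
      intro u v huv
      apply sq_of_comm
      · split_ifs <;> simp
      · split_ifs <;> simp
      · have hne := huv.ne
        split_ifs <;> simp_all [SimpleGraph.adj_comm])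

lemma dihedralMap_a (a b : V) (hab : a ≠ b) (hn : ¬ G.Adj a b) :
    dihedralMap a b hab hn (gen G a) = DihedralGroup.sr 0 := by simp [dihedralMap]

lemma dihedralMap_b (a b : V) (hab : a ≠ b) (hn : ¬ G.Adj a b) :
    dihedralMap a b hab hn (gen G b) = DihedralGroup.sr 1 := by simp [dihedralMap, hab.symm]

lemma dihedralMap_ab (a b : V) (hab : a ≠ b) (hn : ¬ G.Adj a b) :
    dihedralMap a b hab hn (gen G a * gen G b) = DihedralGroup.r 1 := by
  rw [map_mul, dihedralMap_a, dihedralMap_b]; simp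

lemma dihedralMap_ab_zpow (a b : V) (hab : a ≠ b) (hn : ¬ G.Adj a b) (k : ℤ) :
    dihedralMap a b hab hn ((gen G a * gen G b) ^ k) = DihedralGroup.r k := by
  rw [map_zpow, dihedralMap_ab]
  have h := DihedralGroup.r_one_zpow (n := 0) k
  rw [h]; rfl

lemma ab_zpow_ne {a b : V} (hab : a ≠ b) (hn : ¬ G.Adj a b) {k : ℤ} (hk : k ≠ 0) :
    (gen G a * gen G b) ^ k ≠ 1 := by
  intro h
  have := dihedralMap_ab_zpow a b hab hn k
  rw [h, map_one] at this
  have h2 : DihedralGroup.r (0 : ZMod 0) = DihedralGroup.r (k : ZMod 0) := this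
  injection h2 with h3
  exact hk h3.symm

lemma gen_ne_one (v : V) : gen G v ≠ 1 := by
  intro h
  have := congrArg (lift (G := G) (fun _ : V => (Multiplicative.ofAdd (1 : ZMod 2)))
    (by intro _; decide) (by intro _ _ _; decide)) h
  have h2 := (lift_gen (G := G) _ _ _ v).symm.trans (this.trans (map_one _))
  exact absurd h2 (by decide)

end basics
end RacgFib

namespace RacgFib

lemma one_end {Γ : Type*} [Group Γ] (φ : Γ →* Multiplicative ℤ) (hs : Function.Surjective φ)
    (hfg : φ.ker.FG) (hinf : (φ.ker : Set Γ).Infinite) (e : Γ → ZMod 2)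
    (he : ∀ g, {x | e (g * x) ≠ e x}.Finite) : ∃ z, {x | e x ≠ z}.Finite := by
  classical
  obtain ⟨S, hS⟩ := hfg
  obtain ⟨t, ht⟩ := hs (Multiplicative.ofAdd 1)
  set h : Γ → ℤ := fun x => (φ x).toAdd with hh
  have hmul : ∀ x y, h (x * y) = h x + h y := by intro x y; simp [hh]
  have hker : ∀ n, n ∈ φ.ker ↔ h n = 0 := by
    intro n; rw [MonoidHom.mem_ker]; simp only [hh]
    exact ⟨fun H => by rw [H]; rfl, fun H => Multiplicative.toAdd.injective H⟩
  have ht1 : h t = 1 := by simp [hh, ht]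
  have hti : h t⁻¹ = -1 := by
    have := hmul t t⁻¹
    have h0 : h 1 = 0 := by simp [hh]
    rw [mul_inv_cancel, h0, ht1] at this; omega
  have htp : ∀ j : ℕ, h (t ^ j) = j := by
    intro j; simp [hh, ht]
  have htn : ∀ j : ℕ, h (t⁻¹ ^ j) = -j := by
    intro j; induction j with
    | zero => simp [hh]
    | succ k ih => rw [pow_succ, hmul, ih, hti]; push_cast; ring
  set B : Set Γ := ⋃ s ∈ insert t (insert t⁻¹ S), {x | e (s * x) ≠ e x} with hB
  have hBf : B.Finite := by
    rw [hB]
    exact Set.Finite.biUnion (Finset.finite_toSet (insert t (insert t⁻¹ S))) (fun s _ => he s)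
  obtain ⟨k0, hk0⟩ : ∃ k0 : ℕ, ∀ x ∈ B, (h x).natAbs < k0 := by
    obtain ⟨M, hM⟩ := (hBf.image (fun x => (h x).natAbs)).bddAbove
    exact ⟨M + 1, fun x hx => Nat.lt_succ_of_le (hM ⟨x, hx, rfl⟩)⟩
  have hB' : ∀ x, x ∉ B → ∀ s ∈ insert t (insert t⁻¹ S), e (s * x) = e x := by
    intro x hx s hs
    by_contra hc
    exact hx (Set.mem_biUnion (by exact_mod_cast hs) hc)
  have c1 : ∀ n ∈ φ.ker, ∀ x, k0 ≤ (h x).natAbs → e (n * x) = e x := by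
    intro n hn
    rw [← hS] at hn
    induction hn using Subgroup.closure_induction with
    | mem s hs =>
      intro x hx
      exact hB' x (fun hb => by have := hk0 x hb; omega) s (by simp; right; right; exact_mod_cast hs)
    | one => simp
    | mul a b ha hb iha ihb =>
      intro x hx
      rw [mul_assoc, iha, ihb x hx]
      rw [hS] at hb
      rw [hmul, (hker b).1 hb, zero_add]; exact hx
    | inv a ha iha =>
      intro x hx
      rw [hS] at ha
      have := iha (a⁻¹ * x) (by
        rw [hmul, (hker a⁻¹).1 (inv_mem ha), zero_add]; exact hx)
      rw [mul_inv_cancel_left] at this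
      exact this.symm
  have c2 : ∀ (j : ℕ) x, (k0 : ℤ) ≤ h x → e (t ^ j * x) = e x := by
    intro j; induction j with
    | zero => simp
    | succ j ih =>
      intro x hx
      rw [pow_succ, mul_assoc, ih]
      · exact hB' x (fun hb => by have := hk0 x hb; omega) t (by simp)
      · rw [hmul, ht1]; omega
  have c2' : ∀ (j : ℕ) x, h x ≤ -(k0 : ℤ) → e (t⁻¹ ^ j * x) = e x := by
    intro j; induction j with
    | zero => simp
    | succ j ih =>
      intro x hx
      rw [pow_succ, mul_assoc, ih]
      · exact hB' x (fun hb => by have := hk0 x hb; omega) t⁻¹ (by simp)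
      · rw [hmul, hti]; omega
  have cp : ∀ y, (k0 : ℤ) ≤ h y → e y = e (t ^ k0) := by
    intro y hy
    obtain ⟨j, hj⟩ := Int.le.dest hy
    have e1 := c2 j (t ^ k0) (by rw [htp])
    have e2 := c1 (y * (t ^ j * t ^ k0)⁻¹) (by
      rw [hker, hmul]
      have := hmul (t ^ j * t ^ k0) (t ^ j * t ^ k0)⁻¹
      rw [mul_inv_cancel, hmul, htp, htp] at this
      have h0 : h 1 = 0 := by simp [hh]
      omega) (t ^ j * t ^ k0) (by rw [hmul, htp, htp]; omega)
    rw [inv_mul_cancel_right] at e2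
    rw [e2, e1]
  have cn : ∀ y, h y ≤ -(k0 : ℤ) → e y = e (t⁻¹ ^ k0) := by
    intro y hy
    obtain ⟨j, hj⟩ := Int.le.dest hy
    have e1 := c2' j (t⁻¹ ^ k0) (by rw [htn])
    have e2 := c1 (y * (t⁻¹ ^ j * t⁻¹ ^ k0)⁻¹) (by
      rw [hker, hmul]
      have := hmul (t⁻¹ ^ j * t⁻¹ ^ k0) (t⁻¹ ^ j * t⁻¹ ^ k0)⁻¹
      rw [mul_inv_cancel, hmul, htn, htn] at this
      have h0 : h 1 = 0 := by simp [hh]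
      omega) (t⁻¹ ^ j * t⁻¹ ^ k0) (by rw [hmul, htn, htn]; omega)
    rw [inv_mul_cancel_right] at e2
    rw [e2, e1]
  -- lines avoiding B
  have line : ∀ (m : ℕ) x, (∀ j < m, t ^ j * x ∉ B) → e (t ^ m * x) = e x := by
    intro m; induction m with
    | zero => simp
    | succ m ih =>
      intro x hx
      rw [pow_succ', mul_assoc, hB' _ (hx m (by omega)) t (by simp)]
      exact ih x (fun j hj => hx j (by omega))
  have fin : ∀ m : ℕ, (⋃ j ∈ Finset.range m, {x | t ^ j * x ∈ B}).Finite := by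
    intro m
    refine Set.Finite.biUnion (Finset.finite_toSet (Finset.range m)) (fun j _ => ?_)
    exact hBf.preimage (fun a _ b _ hab => mul_left_cancel hab)
  have cpn : e (t ^ k0) = e (t⁻¹ ^ k0) := by
    have f2 : ((fun x => t⁻¹ ^ k0 * x) ⁻¹' (⋃ j ∈ Finset.range (2 * k0), {x | t ^ j * x ∈ B})).Finite :=
      (fin (2 * k0)).preimage (fun a _ b _ hab => mul_left_cancel hab)
    obtain ⟨x, hx, hxn⟩ := hinf.exists_notMem_finite f2
    have h0 : h x = 0 := (hker x).1 hx
    have l := line (2 * k0) (t⁻¹ ^ k0 * x) (by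
      intro j hj hb
      exact hxn (Set.mem_biUnion (by simpa using hj) hb))
    rw [cn (t⁻¹ ^ k0 * x) (by rw [hmul, htn, h0]; omega),
      cp _ (by rw [hmul, hmul, htn, htp, h0]; push_cast; omega)] at l
    exact l
  refine ⟨e (t ^ k0), (fin (2 * k0)).subset ?_⟩
  intro x hx
  by_contra hc
  apply hx
  have h1 : (h x) < k0 := by
    by_contra h1; exact hx (cp x (by omega))
  have h2 : -(k0 : ℤ) < h x := by
    by_contra h1; exact hx ((cn x (by omega)).trans cpn.symm)
  rw [← line (2 * k0) x (fun j hj hb => hc (Set.mem_biUnion (by simpa using hj) hb))]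
  exact cp _ (by rw [hmul, htp]; push_cast; omega)

end RacgFib

namespace RacgFib

section nonfib
variable {V : Type*} {G : SimpleGraph V}

/-- group algebra -/
abbrev MA (G : SimpleGraph V) := MonoidAlgebra (ZMod 2) (RACG G)

/-- group element in the group algebra -/
noncomputable def emb (g : RACG G) : MA G := MonoidAlgebra.of (ZMod 2) (RACG G) g

lemma emb_mul (g h : RACG G) : emb (g * h) = emb g * emb h := map_mul _ g h
lemma emb_one : emb (1 : RACG G) = 1 := map_one _
lemma ma_add_self (x : MA G) : x + x = 0 := by
  have : (2 : ZMod 2) • x = x + x := two_smul _ x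
  rw [← this]
  have h2 : (2 : ZMod 2) = 0 := rfl
  rw [h2, zero_smul]

lemma emb_mul_apply (g : RACG G) (x : MA G) (y : RACG G) : (emb g * x).coeff (g * y) = x.coeff y := by
  simp only [emb, MonoidAlgebra.of_apply]
  rw [MonoidAlgebra.coeff_single_mul_eq_mul_coeff (m₂ := y)]
  · simp
  · simp

/-- the basic derivation values -/
noncomputable def dv (G : SimpleGraph V) (v w u : V) : MA G :=
  open Classical in
  if u = v then (1 + emb (gen G v)) * (1 + emb (gen G w)) else 0

/-- affine involution -/
noncomputable def aff (a b : MA G) (h : a * a = 1) (h2 : a * b = b) : Equiv.Perm (MA G) where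
  toFun x := a * x + b
  invFun x := a * x + b
  left_inv x := by
    show a * (a * x + b) + b = x
    rw [mul_add, ← mul_assoc, h, one_mul, h2, add_assoc, ma_add_self, add_zero]
  right_inv x := by
    show a * (a * x + b) + b = x
    rw [mul_add, ← mul_assoc, h, one_mul, h2, add_assoc, ma_add_self, add_zero]

lemma emb_gen_sq (u : V) : emb (gen G u) * emb (gen G u) = 1 := by
  rw [← emb_mul, gen_sq, emb_one]

lemma gen_dv (v w u : V) : emb (gen G u) * dv G v w u = dv G v w u := by
  unfold dv
  split_ifs with h
  · subst h
    rw [← mul_assoc, mul_add (emb (gen G u)) 1, mul_one, emb_gen_sq, add_comm (emb (gen G u))]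
  · simp

/-- the affine action -/
noncomputable def Th (v w : V) (hN : ∀ u, G.Adj v u → u = w) : RACG G →* Equiv.Perm (MA G) :=
  lift (fun u => aff (emb (gen G u)) (dv G v w u) (emb_gen_sq u) (gen_dv v w u))
    (by
      intro u; ext1 x
      exact (aff (emb (gen G u)) (dv G v w u) (emb_gen_sq u) (gen_dv v w u)).left_inv x)
    (by
      intro u u' h
      have key : ∀ u u', G.Adj u u' → emb (gen G u) * dv G v w u' = dv G v w u' := by
        intro u u' h
        unfold dv
        split_ifs with h1
        · subst h1
          have := hN u h.symm
          subst this
          have hc : emb (gen G u) * emb (gen G u') = emb (gen G u') * emb (gen G u) := by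
            rw [← emb_mul, ← emb_mul, gen_comm h]
          calc emb (gen G u) * ((1 + emb (gen G u')) * (1 + emb (gen G u)))
              = (emb (gen G u) + emb (gen G u) * emb (gen G u')) * (1 + emb (gen G u)) := by
                noncomm_ring
            _ = (1 + emb (gen G u')) * (emb (gen G u) + emb (gen G u) * emb (gen G u)) := by
                rw [hc]; noncomm_ring
            _ = _ := by rw [emb_gen_sq, add_comm (emb (gen G u)) 1]
        · simp
      apply sq_of_comm
      · ext1 x
        exact (aff (emb (gen G u)) (dv G v w u) (emb_gen_sq u) (gen_dv v w u)).left_inv x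
      · ext1 x
        exact (aff (emb (gen G u')) (dv G v w u') (emb_gen_sq u') (gen_dv v w u')).left_inv x
      · ext1 x
        show emb (gen G u) * (emb (gen G u') * x + dv G v w u') + dv G v w u =
          emb (gen G u') * (emb (gen G u) * x + dv G v w u) + dv G v w u'
        rw [mul_add, mul_add, key u u' h, key u' u h.symm, ← mul_assoc, ← mul_assoc, ← emb_mul,
          ← emb_mul, gen_comm h]
        abel)

/-- derivation -/
noncomputable def del (v w : V) (hN : ∀ u, G.Adj v u → u = w) (g : RACG G) : MA G :=
  Th v w hN g 0

variable {v w : V} (hN : ∀ u, G.Adj v u → u = w)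

lemma Th_apply (g : RACG G) : ∀ x, Th v w hN g x = emb g * x + del v w hN g := by
  have hg : g ∈ Subgroup.closure (Set.range (gen G)) := by rw [closure_gen]; trivial
  induction hg using Subgroup.closure_induction with
  | mem y hy =>
    obtain ⟨u, rfl⟩ := hy
    intro x
    simp only [del, Th, lift_gen]
    show emb (gen G u) * x + dv G v w u = emb (gen G u) * x + (emb (gen G u) * 0 + dv G v w u)
    simp
  | one => intro x; simp [del, emb_one]
  | mul a b _ _ iha ihb =>
    intro x
    unfold del
    rw [map_mul, Equiv.Perm.mul_apply, Equiv.Perm.mul_apply, ihb x, ihb 0, iha, iha, emb_mul]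
    noncomm_ring
  | inv a _ iha =>
    intro x
    unfold del
    have h1 := iha (Th v w hN a⁻¹ x)
    have h2 := iha (Th v w hN a⁻¹ 0)
    have h0 : ∀ z, Th v w hN a ((Th v w hN a)⁻¹ z) = z := fun z => Equiv.apply_symm_apply _ z
    rw [map_inv, h0] at h1 h2
    rw [map_inv]
    generalize (Th v w hN a)⁻¹ x = p at h1 ⊢
    generalize (Th v w hN a)⁻¹ 0 = q at h2 ⊢
    generalize del v w hN a = d at h1 h2
    have h3 : x = emb a * (p - q) := by
      rw [h1, eq_neg_of_add_eq_zero_right h2.symm, mul_sub, sub_eq_add_neg]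
    rw [h3, ← mul_assoc, ← emb_mul, inv_mul_cancel, emb_one, one_mul, sub_add_cancel]

lemma del_mul (g h : RACG G) : del v w hN (g * h) = emb g * del v w hN h + del v w hN g := by
  conv_lhs => rw [del, map_mul, Equiv.Perm.mul_apply, Th_apply]
  rfl

lemma del_gen (u : V) : del v w hN (gen G u) = dv G v w u := by
  simp only [del, Th, lift_gen]
  show emb (gen G u) * 0 + dv G v w u = _
  simp

/-- the end function -/
noncomputable def ee (x : RACG G) : ZMod 2 := (del v w hN x).coeff x

lemma ee_mul (g x : RACG G) : ee hN (g * x) = ee hN x + (del v w hN g).coeff (g * x) := by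
  unfold ee
  rw [del_mul]
  rw [MonoidAlgebra.coeff_add, Finsupp.add_apply, emb_mul_apply]

lemma ee_fin (g : RACG G) : {x | ee hN (g * x) ≠ ee hN x}.Finite := by
  have : {x | ee hN (g * x) ≠ ee hN x} ⊆ (fun x => g * x) ⁻¹' {y | (del v w hN g).coeff y ≠ 0} := by
    intro x hx hx'
    apply hx
    rw [ee_mul, hx', add_zero]
  refine Set.Finite.subset (Set.Finite.preimage (mul_right_injective g).injOn ?_) this
  exact (Finset.finite_toSet (del v w hN g).coeff.support).subset (fun y hy => by simpa using hy)

end nonfib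
end RacgFib

namespace RacgFib

section nonfib2
variable {V : Type*} {G : SimpleGraph V} {v w : V} (hN : ∀ u, G.Adj v u → u = w)

lemma dih_other {a b x : V} (hab : a ≠ b) (hn : ¬ G.Adj a b) (hx : x ≠ a) (hx' : x ≠ b) :
    dihedralMap a b hab hn (gen G x) = 1 := by simp [dihedralMap, hx, hx']

lemma ee_step {u : V} (huv : u ≠ v) (huw : u ≠ w) (hvw : v ≠ w) (hn : ¬ G.Adj u v) (i : ℤ) :
    ee hN ((gen G u * gen G v) ^ (i + 1)) =
      ee hN ((gen G u * gen G v) ^ i) + (if i = 0 then 1 else 0) := by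
  have hD := dihedralMap_ab_zpow (G := G) u v huv hn
  have hw := dih_other huv hn huw.symm hvw.symm
  have hr1 : ∀ k : ℤ, DihedralGroup.sr (0 : ZMod 0) ≠ DihedralGroup.r (k : ZMod 0) := by
    intro k h; cases h
  have hc : del v w hN (gen G u * gen G v) = emb (gen G u) + emb (gen G u * gen G v) +
      emb (gen G u * gen G w) + emb (gen G u * gen G v * gen G w) := by
    rw [del_mul, del_gen, del_gen, dv, dv, if_pos rfl, if_neg huv]
    simp only [emb_mul]
    noncomm_ring
  rw [add_comm i 1, zpow_add, zpow_one, ee_mul, hc]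
  congr 1
  have e1 : gen G u * gen G v * (gen G u * gen G v) ^ i = (gen G u * gen G v) ^ (i + 1) := by
    rw [add_comm i 1, zpow_add, zpow_one]
  rw [e1]
  have n1 : gen G u ≠ (gen G u * gen G v) ^ (i + 1) := by
    intro h
    have := congrArg (dihedralMap u v huv hn) h
    rw [hD, dihedralMap_a] at this
    exact hr1 _ this
  have n2 : gen G u * gen G w ≠ (gen G u * gen G v) ^ (i + 1) := by
    intro h
    have := congrArg (dihedralMap u v huv hn) h
    rw [hD, map_mul, dihedralMap_a, hw, mul_one] at this
    exact hr1 _ this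
  have n3 : gen G u * gen G v * gen G w ≠ (gen G u * gen G v) ^ (i + 1) := by
    intro h
    have h' := congrArg (dihedralMap u v huv hn) h
    rw [hD, map_mul, dihedralMap_ab, hw, mul_one] at h'
    have h2 : DihedralGroup.r (1 : ZMod 0) = DihedralGroup.r ((i + 1 : ℤ) : ZMod 0) := h'
    injection h2 with h3
    have h4 : (1 : ℤ) = i + 1 := h3
    have : i = 0 := by omega
    subst this
    simp at h
    exact gen_ne_one w h
  have n4 : gen G u * gen G v = (gen G u * gen G v) ^ (i + 1) ↔ i = 0 := by
    constructor
    · intro h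
      have h' := congrArg (dihedralMap u v huv hn) h
      rw [hD, dihedralMap_ab] at h'
      have h2 : DihedralGroup.r (1 : ZMod 0) = DihedralGroup.r ((i + 1 : ℤ) : ZMod 0) := h'
      injection h2 with h3
      have h4 : (1 : ℤ) = i + 1 := h3
      omega
    · rintro rfl; simp
  simp only [emb, MonoidAlgebra.of_apply, MonoidAlgebra.coeff_add, Finsupp.add_apply,
    MonoidAlgebra.coeff_single]
  classical
  rw [Finsupp.single_apply, Finsupp.single_apply, Finsupp.single_apply, Finsupp.single_apply,
    if_neg n1, if_neg n2, if_neg n3]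
  by_cases h0 : i = 0
  · rw [if_pos (n4.2 h0), if_pos h0]; simp
  · rw [if_neg (fun h => h0 (n4.1 h)), if_neg h0]; simp

lemma ee_pos {u : V} (huv : u ≠ v) (huw : u ≠ w) (hvw : v ≠ w) (hn : ¬ G.Adj u v) (i : ℕ) :
    ee hN ((gen G u * gen G v) ^ ((i : ℤ) + 1)) = 1 ∧
    ee hN ((gen G u * gen G v) ^ (-(i : ℤ))) = 0 := by
  have h0 : ee hN (1 : RACG G) = 0 := by simp [ee, del]
  induction i with
  | zero =>
    have := ee_step hN huv huw hvw hn 0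
    simp [h0] at this ⊢
    exact this
  | succ k ih =>
    constructor
    · have := ee_step hN huv huw hvw hn (k + 1)
      rw [if_neg (by omega), ih.1] at this
      simpa using this
    · have := ee_step hN huv huw hvw hn (-(k + 1))
      rw [if_neg (by omega)] at this
      push_cast
      rw [add_zero] at this
      rw [← this, ← ih.2]; congr 2; ring

theorem not_fib (hN : ∀ u, G.Adj v u → u = w) {u1 u2 : V} (hvw : v ≠ w) (h1v : u1 ≠ v) (h1w : u1 ≠ w) (h2v : u2 ≠ v)
    (h2w : u2 ≠ w) (h12 : u1 ≠ u2) : ¬ VirtuallyAlgebraicallyFibers (RACG G) := by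
  rintro ⟨K', hidx, φ, hs, hfg⟩
  have hn1 : ¬ G.Adj u1 v := fun h => h1w (hN _ h.symm)
  have hn2 : ¬ G.Adj u2 v := fun h => h2w (hN _ h.symm)
  set c1 := gen G u1 * gen G v with hc1
  set c2 := gen G u2 * gen G v with hc2
  obtain ⟨M, hM0, _, hM⟩ := K'.exists_pow_mem_of_index_ne_zero hidx c1
  obtain ⟨M', hM'0, _, hM'⟩ := K'.exists_pow_mem_of_index_ne_zero hidx c2
  have inj1 : ∀ k : ℤ, c1 ^ k = 1 → k = 0 := fun k h => by
    by_contra hk; exact ab_zpow_ne h1v hn1 hk h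
  have inj2 : ∀ k : ℤ, c2 ^ k = 1 → k = 0 := fun k h => by
    by_contra hk; exact ab_zpow_ne h2v hn2 hk h
  by_cases hfin : (φ.ker : Set K').Infinite
  · obtain ⟨z, hz⟩ := one_end φ hs hfg hfin (fun x => ee hN (x : RACG G)) (by
      intro g
      exact Set.Finite.preimage (f := fun x : K' => (x : RACG G)) Subtype.val_injective.injOn
        (ee_fin hN (g : RACG G)))
    set X : K' := ⟨c1 ^ M, hM⟩ with hX
    have hXz : ∀ k : ℤ, ((X ^ k : K') : RACG G) = c1 ^ (M * k) := by
      intro k; rw [Subgroup.coe_zpow, hX, zpow_mul, zpow_natCast]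
    have hinj : Function.Injective (fun k : ℤ => X ^ k) := by
      intro a b hab
      have h := congrArg (Subtype.val) (show X ^ a = X ^ b from hab)
      rw [hXz, hXz] at h
      have := inj1 (M * a - M * b) (by rw [zpow_sub, h, mul_inv_cancel])
      have h3 : (M : ℤ) * (a - b) = 0 := by linarith
      rcases mul_eq_zero.1 h3 with h4 | h4 <;> omega
    have hval : ∀ k : ℕ, ee hN ((X ^ ((k : ℤ) + 1) : K') : RACG G) = 1 ∧
        ee hN ((X ^ (-(k : ℤ)) : K') : RACG G) = 0 := by
      intro k
      rw [hXz, hXz]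
      obtain ⟨M1, rfl⟩ : ∃ M1, M = M1 + 1 := ⟨M - 1, by omega⟩
      constructor
      · have := (ee_pos hN h1v h1w hvw hn1 (M1 * (k + 1) + k)).1
        rw [← this]; congr 2; push_cast; ring
      · have := (ee_pos hN h1v h1w hvw hn1 ((M1 + 1) * k)).2
        rw [← this]; congr 2; push_cast; ring
    have hz2 : z = 0 ∨ z = 1 := by clear hz; revert z; decide
    rcases hz2 with rfl | rfl
    · refine Set.infinite_univ (α := ℕ) (Set.Finite.subset (Set.Finite.preimage
        (f := fun k : ℕ => X ^ ((k : ℤ) + 1)) ?_ hz) ?_)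
      · intro a _ b _ hab; have := hinj hab; omega
      · intro k _; show ee hN _ ≠ 0; rw [(hval k).1]; decide
    · refine Set.infinite_univ (α := ℕ) (Set.Finite.subset (Set.Finite.preimage
        (f := fun k : ℕ => X ^ (-(k : ℤ))) ?_ hz) ?_)
      · intro a _ b _ hab; have := hinj hab; omega
      · intro k _; show ee hN _ ≠ 1; rw [(hval k).2]; decide
  · rw [Set.not_infinite] at hfin
    set X : K' := ⟨c1 ^ M, hM⟩ with hX
    set Y : K' := ⟨c2 ^ M', hM'⟩ with hY
    have hXz : ∀ k : ℤ, ((X ^ k : K') : RACG G) = c1 ^ (M * k) := by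
      intro k; rw [Subgroup.coe_zpow, hX, zpow_mul, zpow_natCast]
    have hYz : ∀ k : ℤ, ((Y ^ k : K') : RACG G) = c2 ^ (M' * k) := by
      intro k; rw [Subgroup.coe_zpow, hY, zpow_mul, zpow_natCast]
    set a : ℤ := (φ X).toAdd with ha
    set b : ℤ := (φ Y).toAdd with hb
    have hphX : ∀ k : ℤ, (φ (X ^ k)).toAdd = k * a := by intro k; simp [ha]
    have hphY : ∀ k : ℤ, (φ (Y ^ k)).toAdd = k * b := by intro k; simp [hb]
    have pig : ∀ f : ℕ → K', (∀ k, f k ∈ φ.ker) → ∃ i j, i < j ∧ f i = f j := by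
      intro f hf
      have : ¬ Function.Injective f := by
        intro hi
        exact Set.infinite_univ (α := ℕ) (Set.Finite.subset (hfin.preimage hi.injOn)
          (fun k _ => hf k))
      rw [Function.Injective] at this
      push Not at this
      obtain ⟨i, j, h, hij⟩ := this
      rcases lt_or_gt_of_ne hij with h' | h'
      · exact ⟨i, j, h', h⟩
      · exact ⟨j, i, h', h.symm⟩
    obtain ⟨i, j, hij, h⟩ := pig (fun k => X ^ ((k : ℤ) * b) * Y ^ (-((k : ℤ) * a))) (by
      intro k
      rw [MonoidHom.mem_ker]
      apply Multiplicative.toAdd.injective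
      rw [map_mul, toAdd_mul, hphX, hphY]; simp; ring)
    have hb0 : b ≠ 0 := by
      intro hb0
      obtain ⟨i, j, hij, h⟩ := pig (fun k => Y ^ (k : ℤ)) (by
        intro k
        rw [MonoidHom.mem_ker]
        apply Multiplicative.toAdd.injective
        rw [hphY, hb0]; simp)
      have h := congrArg Subtype.val h
      rw [hYz, hYz] at h
      have := inj2 (M' * i - M' * j) (by rw [zpow_sub, h, mul_inv_cancel])
      have h3 : (M' : ℤ) * ((i : ℤ) - j) = 0 := by linarith
      rcases mul_eq_zero.1 h3 with h4 | h4 <;> omega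
    have h := congrArg (fun x : K' => dihedralMap u1 v h1v hn1 (x : RACG G)) h
    simp only [Subgroup.coe_mul, hXz, hYz, map_mul] at h
    have hsr : ∀ k : ℤ, dihedralMap u1 v h1v hn1 (c2 ^ (2 * k)) = 1 := by
      intro k
      rw [map_zpow, hc2, map_mul, dih_other h1v hn1 h12.symm h2v, dihedralMap_b, one_mul,
        zpow_mul]
      have : (DihedralGroup.sr (1 : ZMod 0)) ^ (2 : ℤ) = 1 := by
        rw [show (2 : ℤ) = ((2 : ℕ) : ℤ) by rfl, zpow_natCast, sq]; simp
      rw [this, one_zpow]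
    -- move to one side
    have h5 : dihedralMap u1 v h1v hn1 (c1 ^ (M * (((j : ℤ) - i) * b))) =
        dihedralMap u1 v h1v hn1 (c2 ^ (M' * (((j : ℤ) - i) * a))) := by
      have e1 : c1 ^ (M * (((j : ℤ) - i) * b)) = (c1 ^ (M * ((i : ℤ) * b)))⁻¹ * c1 ^ (M * ((j : ℤ) * b)) := by
        rw [← zpow_neg, ← zpow_add]; congr 1; ring
      have e2 : c2 ^ (M' * (((j : ℤ) - i) * a)) =
          c2 ^ (M' * -((i : ℤ) * a)) * (c2 ^ (M' * -((j : ℤ) * a)))⁻¹ := by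
        rw [← zpow_neg, ← zpow_add]; congr 1; ring
      rw [e1, e2, map_mul, map_mul, map_inv, map_inv, inv_mul_eq_iff_eq_mul, ← mul_assoc (dihedralMap u1 v h1v hn1 _), h,
        mul_inv_cancel_right]
    have h6 := congrArg (fun z => z ^ (2 : ℤ)) h5
    simp only [← map_zpow, ← zpow_mul] at h6
    rw [mul_comm (_ * _ : ℤ) 2, mul_comm (_ * _ : ℤ) 2, hsr, dihedralMap_ab_zpow] at h6
    have h7 : DihedralGroup.r ((2 * (M * (((j : ℤ) - i) * b)) : ℤ) : ZMod 0) = DihedralGroup.r (0 : ZMod 0) := h6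
    injection h7 with h8
    have h9 : (2 * (M * (((j : ℤ) - i) * b)) : ℤ) = 0 := h8
    have hM0' : (M : ℤ) ≠ 0 := by omega
    have hji : ((j : ℤ) - i) ≠ 0 := by omega
    simp [hji, hb0] at h9
    omega

end nonfib2
end RacgFib

namespace RacgFib

lemma slab_fg {Γ : Type*} [Group Γ] (Λ : Subgroup Γ) (S : Set Γ) (hS : S.Finite) {I : Type*}
    (τ : Γ → I) (slab : Set Γ) (hτ : ∀ x ∈ slab, ∀ y ∈ slab, τ x = τ y → x * y⁻¹ ∈ Λ)
    (hf : (τ '' slab).Finite) (h1 : (1 : Γ) ∈ slab)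
    (hc : ∀ g ∈ Λ, Relation.ReflTransGen (fun x y => x ∈ slab ∧ y ∈ slab ∧ ∃ s ∈ S, y = x * s) 1 g) :
    Λ.FG := by
  classical
  have hr : ∀ i : I, ∃ r : Γ, i ∈ τ '' slab → r ∈ slab ∧ τ r = i := by
    intro i
    by_cases h : i ∈ τ '' slab
    · obtain ⟨r, h1, h2⟩ := h; exact ⟨r, fun _ => ⟨h1, h2⟩⟩
    · exact ⟨1, fun h' => absurd h' h⟩
  choose r hr using hr
  set J := τ '' slab
  set T : Set Γ := ((fun p : I × I × Γ => r p.1 * p.2.2 * (r p.2.1)⁻¹) '' (J ×ˢ J ×ˢ S)) ∪ (r '' J)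
    with hT
  have hTf : T.Finite := ((hf.prod (hf.prod hS)).image _).union (hf.image _)
  have hrs : ∀ x ∈ slab, r (τ x) ∈ slab ∧ τ (r (τ x)) = τ x := fun x hx => hr _ ⟨x, hx, rfl⟩
  have hxr : ∀ x ∈ slab, x * (r (τ x))⁻¹ ∈ Λ := fun x hx =>
    hτ _ hx _ (hrs x hx).1 (hrs x hx).2.symm
  have hrel : Λ = Subgroup.closure (T ∩ Λ) := by
    apply le_antisymm
    · intro g hg
      have key : ∀ y, Relation.ReflTransGen (fun x y => x ∈ slab ∧ y ∈ slab ∧ ∃ s ∈ S, y = x * s) 1 y →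
          y ∈ slab ∧ y * (r (τ y))⁻¹ ∈ Subgroup.closure (T ∩ Λ) := by
        intro y hy
        induction hy with
        | refl =>
          refine ⟨h1, ?_⟩
          have hm := hxr 1 h1
          rw [one_mul] at hm ⊢
          rw [inv_mem_iff] at hm ⊢
          exact Subgroup.subset_closure ⟨Or.inr ⟨_, ⟨1, h1, rfl⟩, rfl⟩, hm⟩
        | tail _ hbc ih =>
          rename_i b c _
          obtain ⟨hb, hcs, s, hs, rfl⟩ := hbc
          refine ⟨hcs, ?_⟩
          have e : b * s * (r (τ (b * s)))⁻¹ =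
              (b * (r (τ b))⁻¹) * (r (τ b) * s * (r (τ (b * s)))⁻¹) := by group
          rw [e]
          refine mul_mem ih.2 (Subgroup.subset_closure ⟨Or.inl ⟨(τ b, τ (b * s), s),
            ⟨⟨b, hb, rfl⟩, ⟨_, hcs, rfl⟩, hs⟩, rfl⟩, ?_⟩)
          have := mul_mem (inv_mem (hxr b hb)) (hxr _ hcs)
          have e2 : (b * (r (τ b))⁻¹)⁻¹ * (b * s * (r (τ (b * s)))⁻¹) =
            r (τ b) * s * (r (τ (b * s)))⁻¹ := by group
          rwa [e2] at this
      obtain ⟨hgs, hk⟩ := key g (hc g hg)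
      have hm : r (τ g) ∈ Λ := by
        have := mul_mem (inv_mem (hxr g hgs)) hg
        simpa using this
      have h3 : r (τ g) ∈ Subgroup.closure (T ∩ Λ) :=
        Subgroup.subset_closure ⟨Or.inr ⟨_, ⟨g, hgs, rfl⟩, rfl⟩, hm⟩
      have := mul_mem hk h3
      simpa using this
    · rw [Subgroup.closure_le]; exact Set.inter_subset_right
  rw [Subgroup.fg_iff]
  exact ⟨T ∩ Λ, hrel.symm, hTf.subset Set.inter_subset_left⟩

section morse
variable {X V : Type*} (m : V → X → X)

/-- descending to height one -/
inductive Desc (f : X → ℤ) : X → X → Prop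
  | base (x : X) : f x = 1 → Desc f x x
  | step (x y : X) (v : V) : f (m v x) = f x - 1 → Desc f (m v x) y → Desc f x y

/-- slab adjacency -/
def SA (f : X → ℤ) (x y : X) : Prop := (0 ≤ f x ∧ f x ≤ 1) ∧ (0 ≤ f y ∧ f y ≤ 1) ∧ ∃ v, y = m v x

/-- connectivity hypothesis -/
def DC (f : X → ℤ) : Prop := ∀ x, (∃ v, f (m v x) = f x - 1) ∧
  ∀ v v', f (m v x) = f x - 1 → f (m v' x) = f x - 1 →
  Relation.ReflTransGen (fun b c => f (m b x) = f x - 1 ∧ f (m c x) = f x - 1 ∧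
    m c (m b x) = m b (m c x) ∧ f (m c (m b x)) = f x - 2) v v'

variable {m} {f : X → ℤ}

lemma Desc.ge {x y : X} (h : Desc m f x y) : 1 ≤ f x := by
  induction h with
  | base x h => omega
  | step x y v h1 h2 ih => omega

lemma Desc.eq {x y : X} (h : Desc m f x y) (hx : f x = 1) : y = x := by
  cases h with
  | base => rfl
  | step _ _ v h1 h2 => have := Desc.ge h2; omega

lemma desc_ex (hD : DC m f) (n : ℕ) : ∀ x, f x = n + 1 → ∃ y, Desc m f x y := by
  induction n with
  | zero => intro x hx; exact ⟨x, Desc.base x (by simpa using hx)⟩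
  | succ n ih =>
    intro x hx
    obtain ⟨v, hv⟩ := (hD x).1
    obtain ⟨y, hy⟩ := ih (m v x) (by rw [hv, hx]; push_cast; ring)
    exact ⟨y, Desc.step x y v hv hy⟩

lemma desc_unique (hm : ∀ v x, m v (m v x) = x) (hD : DC m f) (n : ℕ) : ∀ x, f x = n + 1 → ∀ y y', Desc m f x y → Desc m f x y' →
    Relation.ReflTransGen (SA m f) y y' := by
  have hsl : ∀ x, f x = 1 → (0 ≤ f x ∧ f x ≤ 1) := fun x h => by omega
  induction n with
  | zero =>
    intro x hx y y' h h'
    have hx1 : f x = 1 := by simpa using hx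
    rw [h.eq hx1, h'.eq hx1]
  | succ n ih =>
    intro x hx y y' h h'
    push_cast at hx
    cases h with
    | base => omega
    | step _ _ v hv h =>
    cases h' with
    | base => omega
    | step _ _ v' hv' h' =>
      have hcon := (hD x).2 v v' hv hv'
      revert y'
      clear hv'
      induction hcon with
      | refl => intro y' h'; exact ih (m v x) (by omega) y y' h h'
      | tail _ hbc ih2 =>
        rename_i b c _
        intro y' h'
        obtain ⟨h1, h2, h3, h4⟩ := hbc
        obtain ⟨z, hz⟩ := desc_ex hD n (m b x) (by omega)
        refine (ih2 z hz).trans ?_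
        rcases Nat.eq_zero_or_pos n with hn | hn
        · subst hn
          rw [hz.eq (by simp at hx; omega), h'.eq (by simp at hx; omega)]
          simp at hx
          refine (Relation.ReflTransGen.single (b := m c (m b x)) ?_).trans (Relation.ReflTransGen.single ?_)
          · exact ⟨by omega, by omega, c, rfl⟩
          · refine ⟨by omega, by omega, b, ?_⟩
            rw [h3, hm]
        · obtain ⟨u, hu⟩ := desc_ex hD (n - 1) (m c (m b x)) (by rw [h4, hx]; push_cast [hn]; ring)
          refine (ih (m b x) (by omega) z u hz (Desc.step _ _ c (by omega) hu)).trans ?_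
          refine ih (m c x) (by omega) u y' (Desc.step _ _ b (by rw [← h3]; omega) (by rwa [← h3])) h'

lemma SA.symm (hm : ∀ v x, m v (m v x) = x) : Std.Symm (SA m f) := ⟨by
  rintro x y ⟨h1, h2, v, rfl⟩
  exact ⟨h2, h1, v, (hm v x).symm⟩⟩

lemma SA_neg : SA m (fun x => 1 - f x) = SA m f := by
  ext x y
  simp only [SA]
  constructor
  · rintro ⟨h1, h2, h3⟩; exact ⟨by omega, by omega, h3⟩
  · rintro ⟨h1, h2, h3⟩; exact ⟨by omega, by omega, h3⟩

/-- if the up links and the down links are connected, slab points connected by a path are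
connected in the slab -/
lemma morse (hm : ∀ v x, m v (m v x) = x) (hf : ∀ v x, f (m v x) = f x + 1 ∨ f (m v x) = f x - 1)
    (hD : DC m f) (hU : DC m (fun x => 1 - f x)) (x y : X) (hx : 0 ≤ f x ∧ f x ≤ 1)
    (hy : 0 ≤ f y ∧ f y ≤ 1) (hxy : Relation.ReflTransGen (fun a b => ∃ v, b = m v a) x y) :
    Relation.ReflTransGen (SA m f) x y := by
  set R : X → X → Prop := fun a b => (1 ≤ f a ∧ Desc m f a b) ∨
    (f a ≤ 0 ∧ Desc m (fun x => 1 - f x) a b) with hR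
  have hRs : ∀ a, 0 ≤ f a ∧ f a ≤ 1 → R a a := by
    intro a ha
    rcases lt_or_ge (f a) 1 with h | h
    · exact Or.inr ⟨by omega, Desc.base a (by omega)⟩
    · exact Or.inl ⟨h, Desc.base a (by omega)⟩
  have hRex : ∀ a, ∃ b, R a b := by
    intro a
    rcases lt_or_ge (f a) 1 with h | h
    · obtain ⟨b, hb⟩ := desc_ex hU (f a).natAbs a (by omega)
      exact ⟨b, Or.inr ⟨by omega, hb⟩⟩
    · obtain ⟨b, hb⟩ := desc_ex hD (f a - 1).natAbs a (by omega)
      exact ⟨b, Or.inl ⟨by omega, hb⟩⟩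
  have h1 : ∀ a b b', 1 ≤ f a → Desc m f a b → Desc m f a b' →
      Relation.ReflTransGen (SA m f) b b' := fun a b b' ha =>
    desc_unique hm hD (f a - 1).natAbs a (by omega) b b'
  have h0 : ∀ a b b', f a ≤ 0 → Desc m (fun x => 1 - f x) a b → Desc m (fun x => 1 - f x) a b' →
      Relation.ReflTransGen (SA m f) b b' := fun a b b' ha hb hb' => by
    have := desc_unique hm hU (f a).natAbs a (by omega) b b' hb hb'
    rwa [SA_neg] at this
  have hstep : ∀ a v b b', R a b → R (m v a) b' → Relation.ReflTransGen (SA m f) b b' := by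
    intro a v b b' hb hb'
    rcases hb with ⟨ha, hb⟩ | ⟨ha, hb⟩ <;> rcases hb' with ⟨ha', hb'⟩ | ⟨ha', hb'⟩
    · rcases hf v a with h | h
      · exact h1 (m v a) b b' ha' (Desc.step _ _ v (by rw [hm]; omega) (by rwa [hm])) hb'
      · exact h1 a b b' ha hb (Desc.step _ _ v h hb')
    · have e1 : f a = 1 := by rcases hf v a with h | h <;> omega
      have e2 : f (m v a) = 0 := by rcases hf v a with h | h <;> omega
      rw [hb.eq e1, hb'.eq (by omega)]
      exact Relation.ReflTransGen.single ⟨by omega, by omega, v, rfl⟩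
    · have e1 : f a = 0 := by rcases hf v a with h | h <;> omega
      have e2 : f (m v a) = 1 := by rcases hf v a with h | h <;> omega
      rw [hb.eq (by omega), hb'.eq e2]
      exact Relation.ReflTransGen.single ⟨by omega, by omega, v, rfl⟩
    · rcases hf v a with h | h
      · exact h0 a b b' ha hb (Desc.step _ _ v (by omega) hb')
      · exact h0 (m v a) b b' ha' (Desc.step _ _ v (by rw [hm]; omega) (by rwa [hm])) hb'
  have main : ∀ y, Relation.ReflTransGen (fun a b => ∃ v, b = m v a) x y →
      ∀ b, R y b → Relation.ReflTransGen (SA m f) x b := by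
    intro y hxy
    induction hxy with
    | refl =>
      intro b hb
      rcases hb with ⟨h, hb⟩ | ⟨h, hb⟩
      · rw [hb.eq (by omega)]
      · rw [hb.eq (by omega)]
    | tail _ hbc ih =>
      rename_i p q _
      obtain ⟨v, rfl⟩ := hbc
      intro b hb
      obtain ⟨z, hz⟩ := hRex p
      exact (ih z hz).trans (hstep p v z b hz hb)
  exact main y hxy y (hRs y hy)

end morse
end RacgFib

namespace RacgFib
section fb
variable {K : Type*} [Group K]

/-- additive on a subgroup -/
def AddOn (K1 : Subgroup K) (f : K → ℤ) : Prop := ∀ x ∈ K1, ∀ y ∈ K1, f (x * y) = f x + f y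

namespace AddOn
variable {K1 : Subgroup K} {f : K → ℤ}
lemma one (h : AddOn K1 f) : f 1 = 0 := by
  have := h 1 K1.one_mem 1 K1.one_mem
  rw [mul_one] at this; omega
lemma inv (h : AddOn K1 f) {x : K} (hx : x ∈ K1) : f x⁻¹ = - f x := by
  have := h x hx x⁻¹ (inv_mem hx)
  rw [mul_inv_cancel, h.one] at this; omega
lemma zpow (h : AddOn K1 f) {x : K} (hx : x ∈ K1) (k : ℤ) : f (x ^ k) = k * f x := by
  induction k using Int.induction_on with
  | zero => simp [h.one]
  | succ k ih =>
    rw [zpow_add, zpow_one, h _ (zpow_mem hx _) _ hx, ih]; ring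
  | pred k ih =>
    rw [zpow_sub, zpow_one, h _ (zpow_mem hx _) _ (inv_mem hx), ih, h.inv hx]; ring
lemma mono (h : AddOn K1 f) {K2 : Subgroup K} (h2 : K2 ≤ K1) : AddOn K2 f := fun x hx y hy => h x (h2 hx) y (h2 hy)
end AddOn

/-- kernel of an additive function -/
def kerOn (K1 : Subgroup K) (f : K → ℤ) (h : AddOn K1 f) : Subgroup K where
  carrier := {x | x ∈ K1 ∧ f x = 0}
  mul_mem' := by
    rintro a b ⟨ha, ha'⟩ ⟨hb, hb'⟩
    exact ⟨mul_mem ha hb, by rw [h a ha b hb, ha', hb']; rfl⟩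
  one_mem' := ⟨K1.one_mem, h.one⟩
  inv_mem' := by
    rintro a ⟨ha, ha'⟩
    exact ⟨inv_mem ha, by rw [h.inv ha, ha']; rfl⟩

lemma mem_kerOn {K1 : Subgroup K} {f : K → ℤ} {h : AddOn K1 f} {x : K} :
    x ∈ kerOn K1 f h ↔ x ∈ K1 ∧ f x = 0 := Iff.rfl

/-- virtual fibering of a subgroup, internally -/
def Fb (Q : Subgroup K) : Prop := ∃ K1 ≤ Q, K1.relIndex Q ≠ 0 ∧ ∃ (f : K → ℤ) (h : AddOn K1 f),
  (∃ x ∈ K1, f x ≠ 0) ∧ (kerOn K1 f h).FG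

/-- rescaling -/
lemma rescale {K1 : Subgroup K} {f : K → ℤ} (h : AddOn K1 f) (hx : ∃ x ∈ K1, f x ≠ 0) :
    ∃ (g : K → ℤ) (hg : AddOn K1 g), (∃ t ∈ K1, g t = 1) ∧ kerOn K1 g hg = kerOn K1 f h := by
  classical
  have hex : ∃ d : ℕ, 0 < d ∧ ∃ x ∈ K1, f x = d := by
    obtain ⟨x, hx, hfx⟩ := hx
    rcases lt_or_gt_of_ne hfx with h1 | h1
    · exact ⟨(f x).natAbs, by omega, x⁻¹, inv_mem hx, by rw [h.inv hx]; omega⟩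
    · exact ⟨(f x).natAbs, by omega, x, hx, by omega⟩
  obtain ⟨hd0, t, ht, htd⟩ := Nat.find_spec hex
  set d := Nat.find hex with hd
  have hdvd : ∀ x ∈ K1, (d : ℤ) ∣ f x := by
    intro x hx
    by_contra hnd
    have hlt := Int.emod_lt_of_pos (f x) (show (0 : ℤ) < d by omega)
    have hge := Int.emod_nonneg (f x) (show (d : ℤ) ≠ 0 by omega)
    have hne : f x % d ≠ 0 := fun h0 => hnd (Int.dvd_of_emod_eq_zero h0)
    refine Nat.find_min hex (m := (f x % d).natAbs) (by omega) ⟨by omega, x * t ^ (-(f x / d)),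
      mul_mem hx (zpow_mem ht _), ?_⟩
    rw [h _ hx _ (zpow_mem ht _), h.zpow ht, htd]
    have := Int.emod_add_mul_ediv (f x) d
    have e : -(f x / (d : ℤ)) * d = - (d * (f x / d)) := by ring
    omega
  refine ⟨fun x => f x / d, ?_, ⟨t, ht, ?_⟩, ?_⟩
  · intro x hx y hy
    simp only []
    rw [h x hx y hy, Int.add_ediv_of_dvd_left (hdvd x hx)]
  · simp only []
    rw [htd, Int.ediv_self (by omega)]
  · ext x
    simp only [mem_kerOn]
    refine and_congr_right (fun hx => ?_)
    obtain ⟨c, hc⟩ := hdvd x hx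
    have hd' : (d : ℤ) ≠ 0 := by omega
    show f x / d = 0 ↔ f x = 0
    rw [hc, Int.mul_ediv_cancel_left _ hd', mul_eq_zero, or_iff_right hd']

lemma vf_of_Fb (h : Fb (⊤ : Subgroup K)) : VirtuallyAlgebraicallyFibers K := by
  obtain ⟨K1, _, hi, f, hf, hx, hfg⟩ := h
  obtain ⟨g, hg, ⟨t, ht, hgt⟩, hk⟩ := rescale hf hx
  rw [← hk] at hfg
  rw [Subgroup.relIndex_top_right] at hi
  set φ : K1 →* Multiplicative ℤ := MonoidHom.mk' (fun x => Multiplicative.ofAdd (g x)) (by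
    intro a b
    show Multiplicative.ofAdd (g (a * b)) = _
    rw [hg _ a.2 _ b.2]; rfl) with hφ
  refine ⟨K1, hi, φ, ?_, ?_⟩
  · intro k
    refine ⟨⟨t, ht⟩ ^ (k.toAdd), ?_⟩
    show Multiplicative.ofAdd (g (((⟨t, ht⟩ : K1) ^ (k.toAdd) : K1) : K)) = k
    rw [Subgroup.coe_zpow, hg.zpow ht, hgt, mul_one]; rfl
  · have e : φ.ker.map K1.subtype = kerOn K1 g hg := by
      ext x
      simp only [Subgroup.mem_map, mem_kerOn, MonoidHom.mem_ker]
      constructor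
      · rintro ⟨y, hy, rfl⟩
        exact ⟨y.2, Multiplicative.ofAdd.injective hy⟩
      · rintro ⟨h1, h2⟩
        exact ⟨⟨x, h1⟩, congrArg Multiplicative.ofAdd h2, rfl⟩
    rw [← e, ← Group.fg_iff_subgroup_fg] at hfg
    rw [← Group.fg_iff_subgroup_fg]
    exact Group.fg_of_surjective (f := (φ.ker.equivMapOfInjective K1.subtype K1.subtype_injective).symm.toMonoidHom)
      (MulEquiv.surjective _)

/-- finite relative index subgroups of f.g. subgroups -/
lemma fg_inf {H E : Subgroup K} (hH : H.FG) (hE : E.index ≠ 0) : (H ⊓ E).FG := by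
  rw [← Group.fg_iff_subgroup_fg] at hH
  have : E.FiniteIndex := ⟨hE⟩
  have h2 : Group.FG (E.subgroupOf H) := inferInstance
  have e : (E.subgroupOf H).map H.subtype = H ⊓ E := by
    ext x
    simp [and_comm]
  rw [Group.fg_iff_subgroup_fg] at h2
  rw [← e]
  rw [← Group.fg_iff_subgroup_fg] at h2 ⊢
  exact Group.fg_of_surjective
    (f := ((E.subgroupOf H).equivMapOfInjective H.subtype H.subtype_injective).toMonoidHom)
    (MulEquiv.surjective _)

/-- openness of the set of characters with f.g. kernel -/
lemma openness {K1 : Subgroup K} {f p : K → ℤ} (hf : AddOn K1 f) (hp : AddOn K1 p)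
    (ht : ∃ t ∈ K1, f t = 1) (hfg : (kerOn K1 f hf).FG) :
    ∃ N0 : ℕ, ∀ N : ℕ, N0 ≤ N → ∃ h : AddOn K1 (fun x => N * f x + p x),
      (kerOn K1 (fun x => N * f x + p x) h).FG := by
  classical
  obtain ⟨t, ht, hft⟩ := ht
  obtain ⟨S0, hS0⟩ := hfg
  -- symmetric generating set
  set S : Finset K := S0 ∪ S0.image (·⁻¹) with hS
  have hSsym : ∀ s ∈ S, s⁻¹ ∈ S := by
    intro s hs
    simp only [hS, Finset.mem_union, Finset.mem_image] at hs ⊢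
    rcases hs with h | ⟨a, ha, rfl⟩
    · exact Or.inr ⟨s, h, rfl⟩
    · left; simpa using ha
  have hSk : ∀ s ∈ S, s ∈ K1 ∧ f s = 0 := by
    have h0 : ∀ s ∈ S0, s ∈ kerOn K1 f hf := fun s hs => by
      rw [← hS0]; exact Subgroup.subset_closure hs
    intro s hs
    simp only [hS, Finset.mem_union, Finset.mem_image] at hs
    rcases hs with h | ⟨a, ha, rfl⟩
    · exact h0 s h
    · exact inv_mem (h0 a ha)
  have hlist : ∀ x ∈ kerOn K1 f hf, ∃ l : List K, (∀ s ∈ l, s ∈ S) ∧ l.prod = x := by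
    intro x hx
    rw [← hS0] at hx
    rw [← Subgroup.mem_toSubmonoid, Subgroup.closure_toSubmonoid] at hx
    obtain ⟨l, hl, rfl⟩ := Submonoid.exists_list_of_mem_closure hx
    refine ⟨l, fun s hs => ?_, rfl⟩
    simp only [hS, Finset.mem_union, Finset.mem_image]
    rcases hl s hs with h | h
    · exact Or.inl h
    · exact Or.inr ⟨s⁻¹, h, by simp⟩
  have hcj : ∀ s ∈ S, t * s * t⁻¹ ∈ kerOn K1 f hf ∧ t⁻¹ * s * t ∈ kerOn K1 f hf := by
    intro s hs
    have h1 := (hSk s hs).1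
    have h2 := (hSk s hs).2
    refine ⟨⟨mul_mem (mul_mem ht h1) (inv_mem ht), ?_⟩,
      ⟨mul_mem (mul_mem (inv_mem ht) h1) ht, ?_⟩⟩
    · rw [hf _ (mul_mem ht h1) _ (inv_mem ht), hf _ ht _ h1, hf.inv ht]; omega
    · rw [hf _ (mul_mem (inv_mem ht) h1) _ ht, hf _ (inv_mem ht) _ h1, hf.inv ht]; omega
  choose! l hlS hlp using hlist
  obtain ⟨B, hB⟩ : ∃ B : ℕ, ∀ s ∈ S, (p s).natAbs ≤ B ∧
      (∀ q, q <+: l (t * s * t⁻¹) → (p q.prod).natAbs ≤ B) ∧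
      (∀ q, q <+: l (t⁻¹ * s * t) → (p q.prod).natAbs ≤ B) := by
    refine ⟨(S.biUnion (fun s => ([s] :: ((l (t * s * t⁻¹)).inits ++
      (l (t⁻¹ * s * t)).inits)).toFinset)).sup (fun q => (p q.prod).natAbs), fun s hs => ?_⟩
    have key : ∀ q ∈ ([s] :: ((l (t * s * t⁻¹)).inits ++ (l (t⁻¹ * s * t)).inits)),
        (p q.prod).natAbs ≤ (S.biUnion (fun s => ([s] :: ((l (t * s * t⁻¹)).inits ++
        (l (t⁻¹ * s * t)).inits)).toFinset)).sup (fun q => (p q.prod).natAbs) := by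
      intro q hq
      exact Finset.le_sup (f := fun q : List K => (p q.prod).natAbs)
        (Finset.mem_biUnion.2 ⟨s, hs, List.mem_toFinset.2 hq⟩)
    refine ⟨?_, fun q hq => key q ?_, fun q hq => key q ?_⟩
    · simpa using key [s] (by simp)
    · simp [hq]
    · simp [hq]
  refine ⟨B + 2 + (p t).natAbs, fun N hN => ?_⟩
  have hχ : AddOn K1 (fun x => N * f x + p x) := by
    intro x hx y hy
    simp only []
    rw [hf x hx y hy, hp x hx y hy]; ring
  refine ⟨hχ, ?_⟩
  set χ : K → ℤ := fun x => N * f x + p x with hχd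
  have hχS : ∀ x ∈ kerOn K1 f hf, χ x = p x := by
    intro x hx; simp [hχd, hx.2]
  set T : ℤ := χ t with hT
  have hTB : B < T := by simp only [hT, hχd, hft]; omega
  set slab : Set K := {x | x ∈ K1 ∧ -4 * T ≤ χ x ∧ χ x ≤ 4 * T} with hslab
  set SS : Finset K := insert t (insert t⁻¹ S) with hSS
  set Step : K → K → Prop := fun x y => x ∈ slab ∧ y ∈ slab ∧ ∃ s ∈ (SS : Set K), y = x * s with hStep
  have hsymm : Std.Symm Step := ⟨by
    rintro x y ⟨hx, hy, s, hs, rfl⟩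
    refine ⟨hy, hx, s⁻¹, ?_, by group⟩
    simp only [hSS, Finset.coe_insert, Set.mem_insert_iff, Finset.mem_coe] at hs ⊢
    rcases hs with rfl | rfl | hs
    · simp
    · simp
    · exact Or.inr (Or.inr (hSsym _ hs))⟩
  have hcs : ∀ x y, Relation.ReflTransGen Step x y → Relation.ReflTransGen Step y x :=
    fun x y h => (@Relation.ReflTransGen.stdSymm _ _ hsymm).symm _ _ h
  have L1 : ∀ (k : ℕ) x, x ∈ slab → x * t ^ k ∈ slab → Relation.ReflTransGen Step x (x * t ^ k) := by
    intro k
    induction k with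
    | zero => intro x _ _; simp; exact Relation.ReflTransGen.refl
    | succ k ih =>
      intro x hx hx'
      have e : x * t ^ (k + 1) = x * t * t ^ k := by rw [pow_succ']; group
      have h1 : χ (x * t) = χ x + T := hχ x hx.1 t ht
      have h2 : χ (x * t ^ (k + 1)) = χ x + (k + 1) * T := by
        have := hχ x hx.1 _ (pow_mem ht (k + 1))
        rw [this, ← zpow_natCast, hχ.zpow ht]; push_cast; ring
      have hmem : x * t ∈ slab := by
        refine ⟨mul_mem hx.1 ht, ?_, ?_⟩
        · rw [h1]; have := hx.2.1; omega
        · have h3 := hx'.2.2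
          rw [h2] at h3
          have : 0 ≤ (k : ℤ) * T := mul_nonneg (by omega) (by omega)
          rw [h1]; linarith
      rw [e] at hx' ⊢
      exact Relation.ReflTransGen.head ⟨hx, hmem, t, by simp [hSS], rfl⟩ (ih _ hmem hx')
  set π : K → K := fun x => x * t ^ (-(χ x / T)) with hπ
  have hπK : ∀ x ∈ K1, π x ∈ K1 := fun x hx => mul_mem hx (zpow_mem ht _)
  have hπχ : ∀ x ∈ K1, 0 ≤ χ (π x) ∧ χ (π x) < T := by
    intro x hx
    have : χ (π x) = χ x % T := by
      have e := hχ x hx _ (zpow_mem ht (-(χ x / T)))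
      have e2 := hχ.zpow ht (-(χ x / T))
      have := Int.emod_add_mul_ediv (χ x) T
      have e3 : χ (t ^ (-(χ x / T))) = -(χ x / T) * T := e2
      have e4 : χ (π x) = χ x + χ (t ^ (-(χ x / T))) := e
      rw [e4, e3]; linarith
    rw [this]
    exact ⟨Int.emod_nonneg _ (by omega), Int.emod_lt_of_pos _ (by omega)⟩
  have hπs : ∀ x ∈ K1, π x ∈ slab := fun x hx => ⟨hπK x hx, by have := hπχ x hx; omega,
    by have := hπχ x hx; omega⟩
  have L2 : ∀ x ∈ slab, Relation.ReflTransGen Step x (π x) := by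
    intro x hx
    have hs := hπs x hx.1
    rcases le_total (χ x / T) 0 with h | h
    · obtain ⟨k, hk⟩ := Int.eq_ofNat_of_zero_le (show 0 ≤ -(χ x / T) by omega)
      have e : π x = x * t ^ k := by simp only [hπ]; rw [hk, zpow_natCast]
      rw [e] at hs ⊢
      exact L1 k x hx hs
    · obtain ⟨k, hk⟩ := Int.eq_ofNat_of_zero_le h
      have e : x = π x * t ^ k := by
        simp only [hπ]; rw [← zpow_natCast, ← hk]; group
      apply hcs
      have := L1 k (π x) hs (by rwa [← e])
      rwa [← e] at this
  have hπt : ∀ x ∈ K1, π (x * t) = π x := by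
    intro x hx
    have h1 : χ (x * t) = χ x + T := hχ x hx t ht
    simp only [hπ]
    rw [h1, Int.add_ediv_of_dvd_right (dvd_refl T), Int.ediv_self (by omega), mul_assoc]
    congr 1
    rw [← zpow_one_add]; congr 1; ring
  have hlem : ∀ (l : List K) h, h ∈ K1 → (∀ s ∈ l, s ∈ S) → (∀ q, q <+: l → ∀ s ∈ S,
      Relation.ReflTransGen Step (π (h * q.prod)) (π (h * q.prod * s))) →
      Relation.ReflTransGen Step (π h) (π (h * l.prod)) := by
    intro l
    induction l with
    | nil => intro h _ _ _; simp; exact Relation.ReflTransGen.refl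
    | cons a l ih =>
      intro h hh hl hq
      have h1 := hq [] (by simp) a (hl a (by simp))
      simp only [List.prod_nil, mul_one] at h1
      refine h1.trans ?_
      have := ih (h * a) (mul_mem hh (hSk a (hl a (by simp))).1) (fun s hs => hl s (by simp [hs])) (by
        intro q hq' s hs
        have := hq (a :: q) (by simpa using hq') s hs
        simpa [mul_assoc] using this)
      simpa [mul_assoc] using this
  have hmain : ∀ (n : ℕ) g, g ∈ K1 → (2 * χ g - T).natAbs = n → ∀ s ∈ S,
      Relation.ReflTransGen Step (π g) (π (g * s)) := by
    intro n
    induction n using Nat.strong_induction_on with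
    | _ n ih =>
      intro g hg hn s hs
      have hB1 := hB s hs
      have hχs : χ s = p s := hχS s (hSk s hs)
      have hgs : χ (g * s) = χ g + χ s := hχ g hg s (hSk s hs).1
      by_cases hlow : χ g < -B
      · have h1 : π g = π (g * t) := (hπt g hg).symm
        have hw := (hcj s hs).2
        have h2 : g * s = g * t * (l (t⁻¹ * s * t)).prod * t⁻¹ := by rw [hlp _ hw]; group
        have hgt := mul_mem hg ht
        have hgw : g * t * (l (t⁻¹ * s * t)).prod * t⁻¹ ∈ K1 := by
          rw [← h2]; exact mul_mem hg (hSk s hs).1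
        have h3 : π (g * s) = π (g * t * (l (t⁻¹ * s * t)).prod) := by
          rw [h2, ← hπt _ hgw]; simp
        rw [h1, h3]
        apply hlem _ _ hgt (hlS _ hw)
        intro q hq s' hs'
        have hqk : q.prod ∈ kerOn K1 f hf := Subgroup.list_prod_mem _
          (fun x hx => hSk x (hlS _ hw x (hq.subset hx)))
        have e1 : χ (g * t * q.prod) = χ g + T + χ q.prod := by
          have := hχ _ hgt _ hqk.1
          have h' := hχ _ hg _ ht
          exact this.trans (by rw [h'])
        have e2 := hχS _ hqk
        have e3 := hB1.2.2 q hq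
        exact ih _ (by omega) _ (mul_mem hgt hqk.1) rfl s' hs'
      · by_cases hhigh : T + B < χ g
        · have hgt := mul_mem hg (inv_mem ht)
          have h1 : π g = π (g * t⁻¹) := by rw [← hπt _ hgt]; simp
          have hw := (hcj s hs).1
          have h2 : g * s = g * t⁻¹ * (l (t * s * t⁻¹)).prod * t := by rw [hlp _ hw]; group
          have h3 : π (g * s) = π (g * t⁻¹ * (l (t * s * t⁻¹)).prod) := by
            rw [h2, hπt]
            exact mul_mem hgt (by rw [hlp _ hw]; exact hw.1)
          rw [h1, h3]
          apply hlem _ _ hgt (hlS _ hw)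
          intro q hq s' hs'
          have hqk : q.prod ∈ kerOn K1 f hf := Subgroup.list_prod_mem _
            (fun x hx => hSk x (hlS _ hw x (hq.subset hx)))
          have e1 : χ (g * t⁻¹ * q.prod) = χ g - T + χ q.prod := by
            have := hχ _ hgt _ hqk.1
            have h' := hχ _ hg _ (inv_mem ht)
            have h'' := hχ.inv ht
            exact this.trans (by rw [h', h'']; rfl)
          have e2 := hχS _ hqk
          have e3 := hB1.2.1 q hq
          exact ih _ (by omega) _ (mul_mem hgt hqk.1) rfl s' hs'
        · have hg1 : g ∈ slab := ⟨hg, by omega, by omega⟩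
          have hg2 : g * s ∈ slab := ⟨mul_mem hg (hSk s hs).1, by omega, by omega⟩
          exact ((hcs _ _ (L2 g hg1)).tail ⟨hg1, hg2, s, by simp [hSS, hs], rfl⟩).trans (L2 _ hg2)
  have h10 : χ 1 = 0 := hχ.one
  have h1s : (1 : K) ∈ slab := ⟨K1.one_mem, by omega, by omega⟩
  have hpt : ∀ (k : ℤ) x, x ∈ K1 → π (x * t ^ k) = π x := by
    intro k
    induction k using Int.induction_on with
    | zero => intro x _; simp
    | succ k ih =>
      intro x hx
      rw [zpow_add, zpow_one, ← mul_assoc, hπt _ (mul_mem hx (zpow_mem ht _)), ih x hx]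
    | pred k ih =>
      intro x hx
      rw [← hπt _ (mul_mem hx (zpow_mem ht _)), mul_assoc, ← zpow_add_one]
      simpa using ih x hx
  refine slab_fg _ (SS : Set K) SS.finite_toSet χ slab ?_ ?_ h1s ?_
  · intro x hx y hy hxy
    refine ⟨mul_mem hx.1 (inv_mem hy.1), ?_⟩
    have h' := hχ _ hx.1 _ (inv_mem hy.1)
    have h'' := hχ.inv hy.1
    refine h'.trans ?_
    rw [h'']
    have : χ x = χ y := hxy
    show χ x + - χ y = 0
    omega
  · refine (Set.finite_Icc (-4 * T) (4 * T)).subset ?_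
    rintro _ ⟨x, hx, rfl⟩
    exact ⟨hx.2.1, hx.2.2⟩
  · intro g hg
    have hgχ : χ g = 0 := hg.2
    have hgn : g * t ^ (-(f g)) ∈ kerOn K1 f hf :=
      ⟨mul_mem hg.1 (zpow_mem ht _), by
        rw [hf _ hg.1 _ (zpow_mem ht _), hf.zpow ht, hft]; ring⟩
    have := hlem (l (g * t ^ (-(f g)))) 1 K1.one_mem (hlS _ hgn) (by
      intro q hq s' hs'
      have hqk : q.prod ∈ kerOn K1 f hf := Subgroup.list_prod_mem _
          (fun x hx => hSk x (hlS _ hgn x (hq.subset hx)))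
      exact hmain _ _ (mul_mem K1.one_mem hqk.1) rfl s' hs')
    rw [hlp _ hgn, one_mul, hpt _ _ hg.1] at this
    have e1 : π 1 = 1 := by simp only [hπ]; rw [h10]; simp
    have e2 : π g = g := by simp only [hπ]; rw [hgχ]; simp
    rwa [e1, e2] at this
end fb
end RacgFib

namespace RacgFib
section seed
variable {V : Type*} {G : SimpleGraph V}

/-- position on the line -/
def dP : DihedralGroup 0 → ℤ
  | .r k => 2 * (show ℤ from k)
  | .sr k => 1 - 2 * (show ℤ from k)

/-- sign of an element of the dihedral group -/
def dS : DihedralGroup 0 →* ℤˣ where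
  toFun
    | .r _ => 1
    | .sr _ => -1
  map_one' := rfl
  map_mul' := by rintro (a | a) (b | b) <;> simp

lemma dP_mul {x : DihedralGroup 0} (hx : dS x = 1) (y : DihedralGroup 0) : dP (x * y) = dP x + dP y := by
  rcases x with a | a
  · rcases y with b | b
    · show 2 * ((show ℤ from a) + (show ℤ from b)) = 2 * (show ℤ from a) + 2 * (show ℤ from b)
      ring
    · show 1 - 2 * ((show ℤ from b) - (show ℤ from a)) = 2 * (show ℤ from a) + (1 - 2 * (show ℤ from b))
      ring
  · exact absurd hx (by show ¬ (-1 : ℤˣ) = 1; decide)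

lemma dP_step (x : DihedralGroup 0) (l : Bool) :
    dP (x * DihedralGroup.sr (if l then 0 else 1)) = dP x + (if (decide (dS x = 1) = l) then 1 else -1) := by
  rcases x with a | a
  · have : dS (DihedralGroup.r a) = 1 := rfl
    cases l
    · simp only [this]
      have key : ∀ b : ℤ, 1 - 2 * ((1 : ℤ) - b) = 2 * b + -1 := fun b => by ring
      exact key a
    · simp only [this]
      have key : ∀ b : ℤ, 1 - 2 * ((0 : ℤ) - b) = 2 * b + 1 := fun b => by ring
      exact key a
  · have : ¬ dS (DihedralGroup.sr a) = 1 := by show ¬ (-1 : ℤˣ) = 1; decide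
    cases l
    · simp only [this]
      have key : ∀ b : ℤ, 2 * ((1 : ℤ) - b) = 1 - 2 * b + 1 := fun b => by ring
      exact key a
    · simp only [this]
      have key : ∀ b : ℤ, 2 * ((0 : ℤ) - b) = 1 - 2 * b + -1 := fun b => by ring
      exact key a

/-- special subgroup -/
def KL (G : SimpleGraph V) (L : Set V) : Subgroup (RACG G) := Subgroup.closure (gen G '' L)

lemma gen_mem_KL {L : Set V} {v : V} (h : v ∈ L) : gen G v ∈ KL G L := Subgroup.subset_closure ⟨v, h, rfl⟩

lemma sr_sq (a : ZMod 0) : (DihedralGroup.sr a) * (DihedralGroup.sr a) = 1 := by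
  rw [DihedralGroup.sr_mul_sr, sub_self]; rfl

/-- map to product of dihedral groups -/
noncomputable def seedMap {ι : Type*} [DecidableEq ι] (L : Set V) (c : V → ι) (ℓ : V → Bool)
    (hadj : ∀ u ∈ L, ∀ v ∈ L, G.Adj u v → c u = c v → ℓ u = ℓ v) : RACG G →* (ι → DihedralGroup 0) :=
  open Classical in
  lift (fun v => if v ∈ L then Pi.mulSingle (c v) (DihedralGroup.sr (if ℓ v then 0 else 1)) else 1)
    (by
      intro v
      split_ifs
      · rw [← Pi.mulSingle_mul, sr_sq, Pi.mulSingle_one]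
      · rw [← Pi.mulSingle_mul, sr_sq, Pi.mulSingle_one]
      · simp)
    (by
      intro u v huv
      apply sq_of_comm
      · split_ifs <;> simp [← Pi.mulSingle_mul]
      · split_ifs <;> simp [← Pi.mulSingle_mul]
      · by_cases hu : u ∈ L
        · by_cases hv : v ∈ L
          · simp only [hu, hv, if_true]
            by_cases h : c u = c v
            · rw [hadj u hu v hv huv h, h]
            · exact Pi.mulSingle_commute h _ _
          · simp [hv]
        · simp [hu])

lemma seedMap_gen {ι : Type*} [DecidableEq ι] (L : Set V) (c : V → ι) (ℓ : V → Bool)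
    (hadj : ∀ u ∈ L, ∀ v ∈ L, G.Adj u v → c u = c v → ℓ u = ℓ v) {v : V} (hv : v ∈ L) :
    seedMap L c ℓ hadj (gen G v) = Pi.mulSingle (c v) (DihedralGroup.sr (if ℓ v then 0 else 1)) := by
  simp [seedMap, hv]

theorem seed {ι : Type*} [Fintype ι] [DecidableEq ι] (L : Set V) (hL : L.Finite) (c : V → ι) (ℓ : V → Bool)
    (hadj : ∀ u ∈ L, ∀ v ∈ L, G.Adj u v → c u = c v → ℓ u = ℓ v)
    (hD : ∀ s : ι → Bool, (∃ v ∈ L, ℓ v = s (c v)) ∧ ∀ v ∈ L, ∀ v' ∈ L, ℓ v = s (c v) → ℓ v' = s (c v') →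
      Relation.ReflTransGen (fun b d => b ∈ L ∧ d ∈ L ∧ ℓ b = s (c b) ∧ ℓ d = s (c d) ∧ G.Adj b d ∧ c b ≠ c d) v v') :
    Fb (KL G L) := by
  classical
  set ρ := seedMap L c ℓ hadj with hρ
  set σ : RACG G →* (ι → ℤˣ) := (MonoidHom.pi (fun i => dS.comp (Pi.evalMonoidHom _ i))).comp ρ with hσ
  have hσi : ∀ g i, σ g i = dS (ρ g i) := fun g i => rfl
  set f : RACG G → ℤ := fun g => ∑ i, dP (ρ g i) with hf
  have hadd : ∀ x y, σ x = 1 → f (x * y) = f x + f y := by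
    intro x y hx
    simp only [hf]
    rw [← Finset.sum_add_distrib]
    refine Finset.sum_congr rfl fun i _ => ?_
    rw [map_mul, Pi.mul_apply, dP_mul]
    rw [← hσi, hx]; rfl
  have hstep : ∀ (v : L) g, f (g * gen G v) = f g + (if (decide (σ g (c v) = 1) = ℓ v) then 1 else -1) := by
    intro v g
    simp only [hf]
    rw [← Finset.add_sum_erase _ _ (Finset.mem_univ (c v)), ← Finset.add_sum_erase Finset.univ (fun i => dP (ρ g i)) (Finset.mem_univ (c v))]
    have h1 : ∀ i ∈ Finset.univ.erase (c v), dP (ρ (g * gen G v) i) = dP (ρ g i) := by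
      intro i hi
      rw [map_mul, hρ, seedMap_gen _ _ _ _ v.2, Pi.mul_apply, Pi.mulSingle_eq_of_ne (Finset.ne_of_mem_erase hi), mul_one]
    rw [Finset.sum_congr rfl h1]
    have h2 : dP (ρ (g * gen G v) (c v)) = dP (ρ g (c v)) + (if (decide (σ g (c v) = 1) = ℓ v) then 1 else -1) := by
      rw [map_mul, hσi, Pi.mul_apply]
      conv_lhs => rw [hρ, seedMap_gen _ _ _ _ v.2, Pi.mulSingle_eq_same]
      rw [dP_step]
    rw [h2]; ring
  have hσs : ∀ (v : L) g i, i ≠ c v → σ (g * gen G v) i = σ g i := by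
    intro v g i hi
    rw [hσi, hσi, map_mul, Pi.mul_apply]
    conv_lhs => rw [hρ, seedMap_gen _ _ _ _ v.2, Pi.mulSingle_eq_of_ne hi, mul_one]
  set m : L → RACG G → RACG G := fun v g => g * gen G v with hm
  -- the combinatorial condition
  have hDC : ∀ (ε : ℤ) (hε : ε = 1 ∨ ε = -1) x, (∃ v, f (m v x) = f x + ε) ∧ ∀ v v', f (m v x) = f x + ε →
      f (m v' x) = f x + ε → Relation.ReflTransGen (fun b d => f (m b x) = f x + ε ∧ f (m d x) = f x + ε ∧
        m d (m b x) = m b (m d x) ∧ f (m d (m b x)) = f x + 2 * ε) v v' := by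
    intro ε hε x
    obtain ⟨s, hs⟩ : ∃ s : ι → Bool, ∀ v : L, ∀ g, σ g (c v) = σ x (c v) → (f (m v g) = f g + ε ↔ ℓ v = s (c v)) := by
      refine ⟨fun i => if ε = 1 then decide (σ x i = 1) else !decide (σ x i = 1), fun v g hg => ?_⟩
      simp only [hm]
      rw [hstep v g, hg]
      rcases hε with rfl | rfl <;> cases ℓ v <;> by_cases h : σ x (c v) = 1 <;> simp [h] 
    have hs' := fun v => hs v x rfl
    obtain ⟨⟨v0, hv0, hv0'⟩, hcon⟩ := hD s
    refine ⟨⟨⟨v0, hv0⟩, (hs' _).2 hv0'⟩, ?_⟩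
    intro v v' hv hv'
    have := hcon v v.2 v' v'.2 ((hs' _).1 hv) ((hs' _).1 hv')
    have key : ∀ w, Relation.ReflTransGen (fun b d => b ∈ L ∧ d ∈ L ∧ ℓ b = s (c b) ∧ ℓ d = s (c d) ∧ G.Adj b d ∧ c b ≠ c d) v w →
        ∃ hw : w ∈ L, Relation.ReflTransGen (fun b d => f (m b x) = f x + ε ∧ f (m d x) = f x + ε ∧
        m d (m b x) = m b (m d x) ∧ f (m d (m b x)) = f x + 2 * ε) v ⟨w, hw⟩ := by
      intro w hw
      induction hw with
      | refl => exact ⟨v.2, .refl⟩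
      | @tail b d _ h ih =>
        obtain ⟨hb, hd, hb', hd', ha, hc⟩ := h
        obtain ⟨_, ih⟩ := ih
        refine ⟨hd, ih.tail ⟨(hs' ⟨b, hb⟩).2 hb', (hs' ⟨d, hd⟩).2 hd', ?_, ?_⟩⟩
        · simp only [hm]; rw [mul_assoc, mul_assoc, gen_comm ha]
        · have h1 := (hs ⟨d, hd⟩ (m ⟨b, hb⟩ x) (hσs ⟨b, hb⟩ x _ (Ne.symm hc))).2 hd'
          rw [h1, (hs' ⟨b, hb⟩).2 hb']; ring
    exact (key _ this).2
  have hDd : DC m f := by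
    intro x
    have := hDC (-1) (Or.inr rfl) x
    simpa [sub_eq_add_neg] using this
  have hDu : DC m (fun x => 1 - f x) := by
    intro x
    have e1 : ∀ v, (1 - f (m v x) = 1 - f x - 1) ↔ f (m v x) = f x + 1 := fun v => by omega
    have e2 : ∀ b d, (1 - f (m d (m b x)) = 1 - f x - 2) ↔ f (m d (m b x)) = f x + 2 * 1 := fun b d => by omega
    simp only [e1, e2]
    exact hDC 1 (Or.inl rfl) x
  set K1 : Subgroup (RACG G) := KL G L ⊓ σ.ker with hK1
  have hAO : AddOn K1 f := fun x hx y _ => hadd x y hx.2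
  have hdiff : ∀ x y, σ x = σ y → σ (x * y⁻¹) = 1 ∧ f (x * y⁻¹) = f x - f y := by
    intro x y h
    have h1 : σ (x * y⁻¹) = 1 := by rw [map_mul, map_inv, h, mul_inv_cancel]
    refine ⟨h1, ?_⟩
    have := hadd _ y h1
    rw [inv_mul_cancel_right] at this
    omega
  have hf1 : f 1 = 0 := hAO.one
  refine ⟨K1, inf_le_left, ?_, f, hAO, ?_, ?_⟩
  · rw [hK1, inf_comm, Subgroup.inf_relIndex_right]
    have : σ.ker.FiniteIndex := inferInstance
    exact ne_zero_of_dvd_ne_zero this.index_ne_zero (Subgroup.relIndex_dvd_index_of_normal _ _)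
  · have hup : ∀ n : ℕ, ∃ g ∈ KL G L, f g = n := by
      intro n
      induction n with
      | zero => exact ⟨1, one_mem _, hf1⟩
      | succ n ih =>
        obtain ⟨g, hg, hgn⟩ := ih
        obtain ⟨v, hv⟩ := (hDC 1 (Or.inl rfl) g).1
        exact ⟨m v g, mul_mem hg (gen_mem_KL v.2), by rw [hv, hgn]; push_cast; rfl⟩
    choose g hg hgn using hup
    obtain ⟨i, j, hij, he⟩ := Finite.exists_ne_map_eq_of_infinite (fun n => σ (g n))
    obtain ⟨h1, h2⟩ := hdiff _ _ he
    refine ⟨g i * (g j)⁻¹, ⟨mul_mem (hg i) ((KL G L).inv_mem (hg j)), h1⟩, ?_⟩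
    rw [h2, hgn, hgn]; omega
  · refine slab_fg _ (gen G '' L) (hL.image _) (fun x => (σ x, f x)) {x | x ∈ KL G L ∧ 0 ≤ f x ∧ f x ≤ 1} ?_ ?_ ?_ ?_
    · intro x hx y hy h
      have e1 : σ x = σ y := congrArg Prod.fst h
      have e2 : f x = f y := congrArg Prod.snd h
      obtain ⟨h1, h2⟩ := hdiff _ _ e1
      exact ⟨⟨mul_mem hx.1 ((KL G L).inv_mem hy.1), h1⟩, by rw [h2, e2]; simp⟩
    · refine (Set.finite_univ.prod (Set.finite_Icc (0 : ℤ) 1)).subset ?_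
      rintro _ ⟨x, hx, rfl⟩
      exact ⟨trivial, hx.2.1, hx.2.2⟩
    · exact ⟨one_mem _, by omega, by omega⟩
    · intro g hg
      have hm2 : ∀ v x, m v (m v x) = x := fun v x => by
        simp only [hm]; rw [mul_assoc, gen_sq, mul_one]
      have hff : ∀ v x, f (m v x) = f x + 1 ∨ f (m v x) = f x - 1 := by
        intro v x
        have := hstep v x
        simp only [hm]
        rw [this]; split_ifs <;> omega
      have hgL : g ∈ KL G L := hg.1.1
      have hg2 : f g = 0 := hg.2
      clear hg
      have hcon : Relation.ReflTransGen (fun a b => ∃ v, b = m v a) 1 g := by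
        clear hg2
        induction hgL using Subgroup.closure_induction_right with
        | one => exact .refl
        | mul_right x hx y hy ih =>
          obtain ⟨v, hv, rfl⟩ := hy
          exact (ih).tail ⟨⟨v, hv⟩, rfl⟩
        | mul_inv_cancel x hx y hy ih =>
          obtain ⟨v, hv, rfl⟩ := hy
          rw [gen_inv]
          exact (ih).tail ⟨⟨v, hv⟩, rfl⟩
      have hmor := morse hm2 hff hDd hDu 1 g (by omega) (by omega) hcon
      have key : ∀ w, Relation.ReflTransGen (SA m f) 1 w → w ∈ KL G L ∧ Relation.ReflTransGen (fun x y => x ∈ {x | x ∈ KL G L ∧ 0 ≤ f x ∧ f x ≤ 1} ∧ y ∈ {x | x ∈ KL G L ∧ 0 ≤ f x ∧ f x ≤ 1} ∧ ∃ s ∈ gen G '' L, y = x * s) 1 w := by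
        intro w hw
        induction hw with
        | refl => exact ⟨one_mem _, .refl⟩
        | @tail b d _ h ih =>
          obtain ⟨hb, hd, v, rfl⟩ := h
          have := mul_mem ih.1 (gen_mem_KL (G := G) v.2)
          exact ⟨this, ih.2.tail ⟨⟨ih.1, hb⟩, ⟨this, hd⟩, gen G v, ⟨v, v.2, rfl⟩, rfl⟩⟩
      exact (key g hmor).2
end seed
end RacgFib

namespace RacgFib
section ext
variable {V : Type*} {G : SimpleGraph V}

lemma kill_mem_KL (L : Set V) (g : RACG G) : kill G L g ∈ KL G L := by
  have hg : g ∈ Subgroup.closure (Set.range (gen G)) := by rw [closure_gen]; trivial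
  induction hg using Subgroup.closure_induction with
  | mem x hx =>
    obtain ⟨v, rfl⟩ := hx
    by_cases h : v ∈ L
    · rw [kill_mem h]; exact gen_mem_KL h
    · rw [kill_not_mem h]; exact one_mem _
  | one => rw [map_one]; exact one_mem _
  | mul x y _ _ hx hy => rw [map_mul]; exact mul_mem hx hy
  | inv x _ hx => rw [map_inv]; exact (KL G L).inv_mem hx

lemma kill_KL {L : Set V} {g : RACG G} (hg : g ∈ KL G L) : kill G L g = g := by
  induction hg using Subgroup.closure_induction with
  | mem x hx =>
    obtain ⟨v, hv, rfl⟩ := hx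
    exact kill_mem hv
  | one => rw [map_one]
  | mul x y _ _ hx hy => rw [map_mul, hx, hy]
  | inv x _ hx => rw [map_inv, hx]

lemma kill_quot {L : Set V} {v : V} (hv : v ∉ L) {g : RACG G} (hg : g ∈ KL G (insert v L)) :
    g * (kill G L g)⁻¹ ∈ Subgroup.closure {z | ∃ y ∈ KL G L, z = y * gen G v * y⁻¹} := by
  have main : ∀ x, x * (kill G L x)⁻¹ ∈ Subgroup.closure {z | ∃ y ∈ KL G L, z = y * gen G v * y⁻¹} →
      ∀ u ∈ insert v L, x * gen G u * (kill G L (x * gen G u))⁻¹ ∈ Subgroup.closure {z | ∃ y ∈ KL G L, z = y * gen G v * y⁻¹} := by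
    intro x ih u hu
    rcases hu with rfl | hu
    · rw [map_mul, kill_not_mem hv, mul_one]
      have : x * gen G u * (kill G L x)⁻¹ = (x * (kill G L x)⁻¹) * (kill G L x * gen G u * (kill G L x)⁻¹) := by group
      rw [this]
      exact mul_mem ih (Subgroup.subset_closure ⟨_, kill_mem_KL _ _, rfl⟩)
    · rw [map_mul, kill_mem hu]
      have : x * gen G u * (kill G L x * gen G u)⁻¹ = x * (kill G L x)⁻¹ := by group
      rw [this]; exact ih
  induction hg using Subgroup.closure_induction_right with
  | one => rw [map_one, inv_one, mul_one]; exact one_mem _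
  | mul_right x hx y hy ih =>
    obtain ⟨u, hu, rfl⟩ := hy
    exact main x ih u hu
  | mul_inv_cancel x hx y hy ih =>
    obtain ⟨u, hu, rfl⟩ := hy
    rw [gen_inv]; exact main x ih u hu

lemma coset_reps {K : Type*} [Group K] {K1 Q : Subgroup K} (h : K1.relIndex Q ≠ 0) :
    ∃ T : Set K, T.Finite ∧ (∀ τ ∈ T, τ ∈ Q) ∧ ∀ y ∈ Q, ∃ τ ∈ T, y * τ⁻¹ ∈ K1 := by
  have hfin : Finite (Q ⧸ K1.subgroupOf Q) := Nat.finite_of_card_ne_zero h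
  refine ⟨Set.range (fun q : Q ⧸ K1.subgroupOf Q => ((q.out : Q) : K)⁻¹), Set.finite_range _, ?_, ?_⟩
  · rintro _ ⟨q, rfl⟩
    exact Q.inv_mem (q.out).2
  · intro y hy
    set q : Q ⧸ K1.subgroupOf Q := QuotientGroup.mk ⟨y, hy⟩⁻¹ with hq
    refine ⟨_, ⟨q, rfl⟩, ?_⟩
    have h1 : (QuotientGroup.mk q.out : Q ⧸ K1.subgroupOf Q) = QuotientGroup.mk ⟨y, hy⟩⁻¹ := by
      rw [QuotientGroup.out_eq']
    rw [QuotientGroup.eq, Subgroup.mem_subgroupOf] at h1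
    have := K1.inv_mem h1
    simpa using this

lemma dP_conj (d : DihedralGroup 0) (k : ℤ) :
    dP (d * DihedralGroup.r k * d⁻¹) = 2 * k ∨ dP (d * DihedralGroup.r k * d⁻¹) = -(2 * k) := by
  rcases d with i | i
  · left
    have : ∀ i k : ℤ, 2 * (i + k + -i) = 2 * k := fun i k => by ring
    exact this i k
  · right
    have : ∀ i k : ℤ, 2 * (i - (i + k)) = -(2 * k) := fun i k => by ring
    exact this i k

theorem ext_step {L : Set V} {a b v : V} (ha : a ∈ L) (hb : b ∈ L) (hab : a ≠ b) (hn : ¬ G.Adj a b)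
    (hv : v ∉ L) (hva : G.Adj v a) (hvb : G.Adj v b) (hF : Fb (KL G L)) : Fb (KL G (insert v L)) := by
  classical
  obtain ⟨K0, hK0, hidx0, f0, hf0, hne0, hfg0⟩ := hF
  set Q := KL G L with hQ
  set ρ := dihedralMap a b hab hn with hρ
  set h := gen G a * gen G b with hh
  have hhQ : h ∈ Q := mul_mem (gen_mem_KL ha) (gen_mem_KL hb)
  set E := (dS.comp ρ).ker with hE
  have hEi : E.index ≠ 0 := (inferInstance : E.FiniteIndex).index_ne_zero
  set K1 := K0 ⊓ E with hK1
  have hK1Q : K1 ≤ Q := inf_le_left.trans hK0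
  have hidx : K1.relIndex Q ≠ 0 := Subgroup.relIndex_inf_ne_zero hidx0
    (ne_zero_of_dvd_ne_zero hEi (Subgroup.relIndex_dvd_index_of_normal _ _))
  have hf0' : AddOn K1 f0 := hf0.mono inf_le_left
  have hne1 : ∃ x ∈ K1, f0 x ≠ 0 := by
    obtain ⟨x, hx, hfx⟩ := hne0
    refine ⟨x * x, ⟨mul_mem hx hx, ?_⟩, by rw [hf0 x hx x hx]; omega⟩
    show dS.comp ρ (x * x) = 1
    rw [map_mul]
    exact Int.units_mul_self _
  have hfg1 : (kerOn K1 f0 hf0').FG := by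
    have := fg_inf hfg0 hEi
    convert! this using 1
    ext x
    simp only [mem_kerOn, Subgroup.mem_inf, hK1]
    tauto
  obtain ⟨f, hf, ht, hker⟩ := rescale hf0' hne1
  rw [← hker] at hfg1
  set ψ : RACG G → ℤ := fun g => dP (ρ g) with hψ
  have hψa : AddOn K1 ψ := by
    intro x hx y hy
    simp only [hψ]
    rw [map_mul, dP_mul hx.2]
  obtain ⟨N0, hN0⟩ := openness hf hψa ht hfg1
  obtain ⟨k, hk0, hk⟩ : ∃ k : ℕ, 0 < k ∧ ∀ y ∈ Q, y ^ k ∈ K1 := by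
    refine ⟨(K1.relIndex Q).factorial, Nat.factorial_pos _, fun y hy => ?_⟩
    exact (Subgroup.pow_mem_of_relIndex_ne_zero_of_dvd hidx hy
      (fun m h1 h2 => Nat.dvd_factorial h1 h2)).1
  obtain ⟨hχ, hfgχ⟩ := hN0 (max N0 (2 * k + 1)) (le_max_left _ _)
  have hN : 2 * k + 1 ≤ max N0 (2 * k + 1) := le_max_right _ _
  set N := max N0 (2 * k + 1)
  set χ : RACG G → ℤ := fun x => N * f x + ψ x with hχd
  have hyk : ∀ y ∈ Q, y * h ^ k * y⁻¹ ∈ K1 := by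
    intro y hy
    have := hk (y * h * y⁻¹) (mul_mem (mul_mem hy hhQ) (Q.inv_mem hy))
    rwa [conj_pow] at this
  have hχne : ∀ y ∈ Q, χ (y * h ^ k * y⁻¹) ≠ 0 := by
    intro y hy h0
    have h1 : ψ (y * h ^ k * y⁻¹) = 2 * k ∨ ψ (y * h ^ k * y⁻¹) = - (2 * k) := by
      have e : ρ (h ^ k) = DihedralGroup.r (k : ℤ) := by
        have := dihedralMap_ab_zpow a b hab hn (k : ℤ)
        rwa [zpow_natCast] at this
      have := dP_conj (ρ y) k
      simp only [hψ]
      rw [map_mul, map_mul, map_inv, e]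
      exact this
    simp only [hχd] at h0
    rcases lt_trichotomy (f (y * h ^ k * y⁻¹)) 0 with h2 | h2 | h2
    · have : (N : ℤ) * f (y * h ^ k * y⁻¹) ≤ N * (-1) := mul_le_mul_of_nonneg_left (by omega) (by omega)
      omega
    · rw [h2] at h0; omega
    · have : (N : ℤ) * 1 ≤ N * f (y * h ^ k * y⁻¹) := mul_le_mul_of_nonneg_left (by omega) (by omega)
      omega
  have hxh : ∀ j : ℤ, h ^ j * gen G v = gen G v * h ^ j := by
    intro j
    have : Commute h (gen G v) := by
      show h * gen G v = gen G v * h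
      rw [hh, mul_assoc, ← gen_comm hvb, ← mul_assoc, ← gen_comm hva, mul_assoc]
    exact this.zpow_left j
  set r := kill G L with hr
  set Q' := KL G (insert v L) with hQ'
  have hQQ' : Q ≤ Q' := Subgroup.closure_mono (Set.image_mono (Set.subset_insert _ _))
  set K2 := Q' ⊓ K1.comap r with hK2
  have hadd2 : AddOn K2 (fun x => χ (r x)) := by
    intro x hx y hy
    simp only []
    rw [map_mul]
    exact hχ _ hx.2 _ hy.2
  have hK12 : ∀ x ∈ K1, x ∈ K2 ∧ r x = x := by
    intro x hx
    have := kill_KL (hK1Q hx)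
    refine ⟨⟨hQQ' (hK1Q hx), ?_⟩, this⟩
    show r x ∈ K1
    rw [hr, this]; exact hx
  refine ⟨K2, inf_le_left, ?_, fun x => χ (r x), hadd2, ?_, ?_⟩
  · rw [hK2, inf_comm, Subgroup.inf_relIndex_right, Subgroup.relIndex_comap]
    refine fun h0 => hidx (Subgroup.relIndex_eq_zero_of_le_right ?_ h0)
    rintro _ ⟨x, _, rfl⟩
    exact kill_mem_KL L x
  · have h1 := hyk 1 Q.one_mem
    refine ⟨_, (hK12 _ h1).1, ?_⟩
    simp only []
    rw [(hK12 _ h1).2]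
    exact hχne 1 Q.one_mem
  · obtain ⟨S0, hS0⟩ := hfgχ
    obtain ⟨T, hT, hTQ, hTc⟩ := coset_reps hidx
    have hz : ∀ e : ℤ, ∃ z ∈ K1, (∃ z' ∈ K1, χ z' = e) → χ z = e := by
      intro e
      by_cases he : ∃ z' ∈ K1, χ z' = e
      · obtain ⟨z, hz, hz'⟩ := he; exact ⟨z, hz, fun _ => hz'⟩
      · exact ⟨1, K1.one_mem, fun h => absurd h he⟩
    choose z hzK hzχ using hz
    set Y : Set (RACG G) := ⋃ τ ∈ T, (fun e => z e * τ) '' Set.Ico 0 |χ (τ * h ^ k * τ⁻¹)| with hY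
    have hYf : Y.Finite := hT.biUnion fun τ _ => (Set.finite_Ico _ _).image _
    set W : Set (RACG G) := S0 ∪ (fun y => y * gen G v * y⁻¹) '' Y with hW
    have hWf : W.Finite := S0.finite_toSet.union (hYf.image _)
    rw [Subgroup.fg_iff]
    refine ⟨W, ?_, hWf⟩
    have hS0m : ∀ x, x ∈ K1 → χ x = 0 → x ∈ Subgroup.closure W := by
      intro x hx hx0
      have : x ∈ kerOn K1 χ hχ := ⟨hx, hx0⟩
      rw [← hS0] at this
      exact Subgroup.closure_mono Set.subset_union_left this
    have hall : ∀ y ∈ Q, y * gen G v * y⁻¹ ∈ Subgroup.closure W := by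
      intro y hy
      obtain ⟨τ, hτ, hκ⟩ := hTc y hy
      set κ := y * τ⁻¹ with hκd
      set u := τ * h ^ k * τ⁻¹ with hu
      have huK := hyk τ (hTQ τ hτ)
      have hd := hχne τ (hTQ τ hτ)
      obtain ⟨j, hj⟩ : ∃ j : ℤ, χ κ + j * χ u = χ κ % χ u := ⟨-(χ κ / χ u), by
        have := Int.emod_add_mul_ediv (χ κ) (χ u)
        linarith⟩
      have hw : κ * u ^ j ∈ K1 := mul_mem hκ (zpow_mem huK j)
      have hχw : χ (κ * u ^ j) = χ κ % χ u := by
        have h1 := hχ _ hκ _ (zpow_mem huK j)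
        have h2 := hχ.zpow huK j
        rw [← hj]
        exact h1.trans (by rw [h2])
      set e := χ κ % χ u with he
      have hze : χ (z e) = e := hzχ e ⟨_, hw, hχw⟩
      set c := κ * u ^ j * (z e)⁻¹ with hc
      have hcm : c ∈ Subgroup.closure W := by
        apply hS0m c (mul_mem hw (inv_mem (hzK e)))
        have h1 := hχ _ hw _ (inv_mem (hzK e))
        have h2 := hχ.inv (hzK e)
        refine h1.trans ?_
        rw [h2]
        show χ (κ * u ^ j) + - χ (z e) = 0
        rw [hχw, hze]; ring
      have hg : (z e * τ) * gen G v * (z e * τ)⁻¹ ∈ Subgroup.closure W := by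
        apply Subgroup.subset_closure
        right
        refine ⟨z e * τ, ?_, rfl⟩
        rw [hY]
        refine Set.mem_biUnion hτ ⟨e, ⟨Int.emod_nonneg _ hd, ?_⟩, rfl⟩
        exact Int.emod_lt_abs _ hd
      have key : y * gen G v * y⁻¹ = c * ((z e * τ) * gen G v * (z e * τ)⁻¹) * c⁻¹ := by
        have h1 : c * (z e * τ) = y * h ^ (k * j) := by
          have : u ^ j = τ * h ^ (k * j) * τ⁻¹ := by rw [hu, conj_zpow, zpow_mul, zpow_natCast]
          rw [hc, this, hκd]; group
        calc y * gen G v * y⁻¹ = y * (gen G v * h ^ (k * j)) * (h ^ (k * j))⁻¹ * y⁻¹ := by group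
          _ = (y * h ^ (k * j)) * gen G v * (y * h ^ (k * j))⁻¹ := by rw [← hxh]; group
          _ = _ := by rw [← h1]; group
      rw [key]
      exact mul_mem (mul_mem hcm hg) (Subgroup.inv_mem _ hcm)
    apply le_antisymm
    · rw [Subgroup.closure_le]
      rintro x (hx | ⟨y, hy, rfl⟩)
      · have : x ∈ kerOn K1 χ hχ := by rw [← hS0]; exact Subgroup.subset_closure hx
        obtain ⟨h1, h2⟩ := hK12 x this.1
        refine ⟨h1, ?_⟩
        simp only []
        rw [h2]; exact this.2
      · have hyQ : y ∈ Q := by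
          rw [hY] at hy
          simp only [Set.mem_iUnion] at hy
          obtain ⟨τ, hτ, e, _, rfl⟩ := hy
          exact mul_mem (hK1Q (hzK e)) (hTQ τ hτ)
        have hr1 : r (y * gen G v * y⁻¹) = 1 := by
          rw [map_mul, map_mul, hr, kill_not_mem hv, map_inv]; simp
        refine ⟨⟨mul_mem (mul_mem (hQQ' hyQ) (gen_mem_KL (Set.mem_insert _ _))) (Q'.inv_mem (hQQ' hyQ)), ?_⟩, ?_⟩
        · show r (y * gen G v * y⁻¹) ∈ K1
          rw [hr1]; exact K1.one_mem
        · show χ (r (y * gen G v * y⁻¹)) = 0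
          rw [hr1]; exact hχ.one
    · intro g hg
      have h1 : g = (g * (r g)⁻¹) * r g := by group
      rw [h1]
      refine mul_mem ?_ (hS0m _ hg.1.2 hg.2)
      have := kill_quot hv hg.1.1
      refine (Subgroup.closure_le _).2 ?_ this
      rintro _ ⟨y, hy, rfl⟩
      exact hall y hy

/-- the interface with graph theory -/
theorem percolate [Finite V] {L0 : Set V} (h0 : Fb (KL G L0)) :
    ∃ L : Set V, L0 ⊆ L ∧ Fb (KL G L) ∧
      ∀ v, v ∉ L → ∀ a ∈ L, ∀ b ∈ L, a ≠ b → G.Adj v a → G.Adj v b → G.Adj a b := by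
  obtain ⟨L, hL⟩ := (Set.toFinite {L : Set V | L0 ⊆ L ∧ Fb (KL G L)}).exists_maximal ⟨L0, subset_rfl, h0⟩
  refine ⟨L, hL.1.1, hL.1.2, ?_⟩
  intro v hv a ha b hb hab hva hvb
  by_contra hn
  have := hL.2 (y := insert v L) ⟨hL.1.1.trans (Set.subset_insert _ _), ext_step ha hb hab hn hv hva hvb hL.1.2⟩ (Set.subset_insert _ _)
  exact hv (this (Set.mem_insert _ _))

theorem vf_of_univ (h : Fb (KL G Set.univ)) : VirtuallyAlgebraicallyFibers (RACG G) := by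
  apply vf_of_Fb
  have : KL G Set.univ = ⊤ := by rw [KL, Set.image_univ, closure_gen]
  rwa [this] at h

/-- non-adjacent pair seed -/
theorem seed_pair {a b : V} (hab : a ≠ b) (hn : ¬ G.Adj a b) : Fb (KL G {a, b}) := by
  classical
  refine seed (ι := Unit) {a, b} (Set.toFinite _) (fun _ => ()) (fun v => decide (v = a)) ?_ ?_
  · rintro u (rfl | rfl) v (rfl | rfl) h _
    · rfl
    · exact absurd h hn
    · exact absurd h.symm hn
    · rfl
  · intro s
    cases hs : s () with
    | true =>
      refine ⟨⟨a, by simp, by simp [hs]⟩, ?_⟩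
      rintro v _ v' _ h h'
      simp only [hs, decide_eq_true_eq] at h h'
      rw [h, h']
    | false =>
      refine ⟨⟨b, by simp, by simp [hs, hab.symm]⟩, ?_⟩
      rintro v hv v' hv' h h'
      simp only [hs, decide_eq_false_iff_not] at h h'
      rw [hv.resolve_left h, hv'.resolve_left h']
end ext
end RacgFib

namespace RacgFib
section four
variable {V : Type*} {G : SimpleGraph V}

open Classical in
/-- small cut contradiction -/
lemma small_cut {A B X Y : Finset V} {m : ℕ} (hX : X ⊆ A) (hY : Y ⊆ B)
    (hA : ∀ X ⊆ A, X.Nonempty → X.card < m → X.card < (B.filter (fun y => ∃ x ∈ X, G.Adj x y)).card)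
    (hB : ∀ Y ⊆ B, Y.Nonempty → Y.card < m → Y.card < (A.filter (fun x => ∃ y ∈ Y, G.Adj y x)).card)
    (hXm : X.card < m) (hYm : Y.card < m) (hne : X.Nonempty ∨ Y.Nonempty)
    (h1 : ∀ x ∈ X, ∀ y ∈ B, G.Adj x y → y ∈ Y) (h2 : ∀ y ∈ Y, ∀ x ∈ A, G.Adj x y → x ∈ X) : False := by
  have e1 : (B.filter (fun y => ∃ x ∈ X, G.Adj x y)).card ≤ Y.card := by
    apply Finset.card_le_card
    intro y hy
    obtain ⟨hy, x, hx, hxy⟩ := Finset.mem_filter.1 hy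
    exact h1 x hx y hy hxy
  have e2 : (A.filter (fun x => ∃ y ∈ Y, G.Adj y x)).card ≤ X.card := by
    apply Finset.card_le_card
    intro x hx
    obtain ⟨hx, y, hy, hxy⟩ := Finset.mem_filter.1 hx
    exact h2 y hy x hx hxy.symm
  rcases Finset.eq_empty_or_nonempty X with hx | hx
  · have := hB Y hY (hne.resolve_left (by simp [hx])) hYm
    have e3 : X.card = 0 := by rw [hx]; rfl
    omega
  · rcases Finset.eq_empty_or_nonempty Y with hy | hy
    · have := hA X hX hx hXm
      have e3 : Y.card = 0 := by rw [hy]; rfl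
      omega
    · have := hA X hX hx hXm
      have := hB Y hY hy hYm
      omega

/-- hole-freeness -/
def NoHole (G : SimpleGraph V) (m : ℕ) (A B : Finset V) : Prop :=
  ∀ X ⊆ A, ∀ Y ⊆ B, X.card = m → Y.card = m → ∃ x ∈ X, ∃ y ∈ Y, G.Adj x y

lemma NoHole.ge {m : ℕ} {A B : Finset V} (h : NoHole G m A B) {X Y : Finset V} (hX : X ⊆ A) (hY : Y ⊆ B)
    (h1 : m ≤ X.card) (h2 : m ≤ Y.card) : ∃ x ∈ X, ∃ y ∈ Y, G.Adj x y := by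
  obtain ⟨X', hX', e1⟩ := Finset.exists_subset_card_eq h1
  obtain ⟨Y', hY', e2⟩ := Finset.exists_subset_card_eq h2
  obtain ⟨x, hx, y, hy, hxy⟩ := h X' (hX'.trans hX) Y' (hY'.trans hY) e1 e2
  exact ⟨x, hX' hx, y, hY' hy, hxy⟩

open Classical in
/-- connectivity of bipartite graphs without bad sets -/
lemma bip_conn {A B : Finset V} {m : ℕ}
    (hA : ∀ X ⊆ A, X.Nonempty → X.card < m → X.card < (B.filter (fun y => ∃ x ∈ X, G.Adj x y)).card)
    (hB : ∀ Y ⊆ B, Y.Nonempty → Y.card < m → Y.card < (A.filter (fun x => ∃ y ∈ Y, G.Adj y x)).card)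
    (hh : NoHole G m A B) (hAc : 2 * m ≤ A.card) (hBc : 2 * m ≤ B.card)
    {R : V → V → Prop} (hR1 : ∀ x ∈ A, ∀ y ∈ B, G.Adj x y → R x y)
    (hR2 : ∀ x ∈ A, ∀ y ∈ B, G.Adj x y → R y x) {v v' : V} (hv : v ∈ A ∪ B) (hv' : v' ∈ A ∪ B) :
    Relation.ReflTransGen R v v' := by
  by_contra hcon
  set X := A.filter (fun w => Relation.ReflTransGen R v w) with hX
  set Y := B.filter (fun w => Relation.ReflTransGen R v w) with hY
  have mX : ∀ x, x ∈ X ↔ x ∈ A ∧ Relation.ReflTransGen R v x := fun x => Finset.mem_filter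
  have mY : ∀ x, x ∈ Y ↔ x ∈ B ∧ Relation.ReflTransGen R v x := fun x => Finset.mem_filter
  have h1 : ∀ x ∈ X, ∀ y ∈ B, G.Adj x y → y ∈ Y := by
    intro x hx y hy hxy
    rw [mX] at hx
    exact (mY y).2 ⟨hy, hx.2.tail (hR1 x hx.1 y hy hxy)⟩
  have h2 : ∀ y ∈ Y, ∀ x ∈ A, G.Adj x y → x ∈ X := by
    intro y hy x hx hxy
    rw [mY] at hy
    exact (mX x).2 ⟨hx, hy.2.tail (hR2 x hx y hy.1 hxy)⟩
  have hXA : X ⊆ A := Finset.filter_subset _ _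
  have hYB : Y ⊆ B := Finset.filter_subset _ _
  have c1 : X.card + (A \ X).card = A.card := by
    rw [Finset.card_sdiff_of_subset hXA]; have := Finset.card_le_card hXA; omega
  have c2 : Y.card + (B \ Y).card = B.card := by
    rw [Finset.card_sdiff_of_subset hYB]; have := Finset.card_le_card hYB; omega
  have d1 : m ≤ X.card → m ≤ (B \ Y).card → False := by
    intro a b
    obtain ⟨x, hx, y, hy, hxy⟩ := hh.ge hXA Finset.sdiff_subset a b
    exact (Finset.mem_sdiff.1 hy).2 (h1 x hx y (Finset.mem_sdiff.1 hy).1 hxy)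
  have d2 : m ≤ (A \ X).card → m ≤ Y.card → False := by
    intro a b
    obtain ⟨x, hx, y, hy, hxy⟩ := hh.ge Finset.sdiff_subset hYB a b
    exact (Finset.mem_sdiff.1 hx).2 (h2 y hy x (Finset.mem_sdiff.1 hx).1 hxy)
  by_cases hc : X.card < m
  · have hYm : Y.card < m := by
      by_contra h
      exact d2 (by omega) (by omega)
    refine small_cut hXA hYB hA hB hc hYm ?_ h1 h2
    rcases Finset.mem_union.1 hv with h | h
    · exact Or.inl ⟨v, (mX v).2 ⟨h, .refl⟩⟩
    · exact Or.inr ⟨v, (mY v).2 ⟨h, .refl⟩⟩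
  · have e1 : (B \ Y).card < m := by
      by_contra h
      exact d1 (by omega) (by omega)
    have e2 : (A \ X).card < m := by
      by_contra h
      exact d2 (by omega) (by omega)
    refine small_cut (X := A \ X) (Y := B \ Y) Finset.sdiff_subset Finset.sdiff_subset hA hB e2 e1 ?_ ?_ ?_
    · rcases Finset.mem_union.1 hv' with h | h
      · exact Or.inl ⟨v', Finset.mem_sdiff.2 ⟨h, fun hx => hcon ((mX _).1 hx).2⟩⟩
      · exact Or.inr ⟨v', Finset.mem_sdiff.2 ⟨h, fun hx => hcon ((mY _).1 hx).2⟩⟩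
    · intro x hx y hy hxy
      refine Finset.mem_sdiff.2 ⟨hy, fun h => (Finset.mem_sdiff.1 hx).2 (h2 y h x (Finset.mem_sdiff.1 hx).1 hxy)⟩
    · intro y hy x hx hxy
      refine Finset.mem_sdiff.2 ⟨hx, fun h => (Finset.mem_sdiff.1 hy).2 (h1 x h y (Finset.mem_sdiff.1 hy).1 hxy)⟩

open Classical in
/-- trimming -/
lemma trim [Finite V] {P : Bool → Bool → Finset V} {m s : ℕ} (hs : 8 * m ≤ s) (hPs : ∀ c l, (P c l).card = s)
    (hh : ∀ c l l', NoHole G m (P c l) (P (!c) l')) :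
    ∃ Q : Bool → Bool → Finset V, (∀ c l, Q c l ⊆ P c l) ∧ (∀ c l, s ≤ (Q c l).card + 2 * m) ∧
      ∀ c l l', ∀ X ⊆ Q c l, X.Nonempty → X.card < m →
        X.card < ((Q (!c) l').filter (fun y => ∃ x ∈ X, G.Adj x y)).card := by
  have := Fintype.ofFinite V
  rcases Nat.eq_zero_or_pos m with hm0 | hm0
  · subst hm0
    exact ⟨P, fun _ _ => subset_rfl, fun c l => by rw [hPs]; omega, fun c l l' X _ _ h => absurd h (by omega)⟩
  let Qf : (Bool → Bool → Bool → Finset V) → Bool → Bool → Finset V :=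
    fun r c l => P c l \ (r c l true ∪ r c l false)
  let good : (Bool → Bool → Bool → Finset V) → Prop := fun r => ∀ c l l', r c l l' ⊆ P c l ∧ (r c l l').card < m ∧
    ((Qf r (!c) l').filter (fun y => ∃ x ∈ r c l l', G.Adj x y)).card ≤ 2 * (r c l l').card
  obtain ⟨r, hr, hmax⟩ := Finset.exists_max_image (Finset.univ.filter good)
    (fun r => ∑ c, ∑ l, ∑ l', (r c l l').card) ⟨fun _ _ _ => ∅, by
      rw [Finset.mem_filter]
      exact ⟨Finset.mem_univ _, fun c l l' => ⟨by simp, by simpa using hm0, by simp⟩⟩⟩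
  have hgood : good r := (Finset.mem_filter.1 hr).2
  have hcard : ∀ c l, s ≤ (Qf r c l).card + 2 * m := by
    intro c l
    have h1 := (hgood c l true).2.1
    have h2 := (hgood c l false).2.1
    have h3 := Finset.card_union_le (r c l true) (r c l false)
    have h4 := Finset.le_card_sdiff (r c l true ∪ r c l false) (P c l)
    rw [hPs] at h4
    show s ≤ (P c l \ (r c l true ∪ r c l false)).card + 2 * m
    omega
  refine ⟨Qf r, fun c l => Finset.sdiff_subset, hcard, ?_⟩
  intro c l l' X hX hXne hXm
  by_contra hbad
  push Not at hbad
  set r' : Bool → Bool → Bool → Finset V := fun a b d => if a = c ∧ b = l ∧ d = l' then r a b d ∪ X else r a b d with hr'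
  have hXP : X ⊆ P c l := hX.trans Finset.sdiff_subset
  have hsub : ∀ a b d, r a b d ⊆ r' a b d := by
    intro a b d
    simp only [hr']
    split_ifs
    · exact Finset.subset_union_left
    · exact subset_rfl
  have hQsub : ∀ a b, Qf r' a b ⊆ Qf r a b := by
    intro a b
    exact Finset.sdiff_subset_sdiff subset_rfl (Finset.union_subset_union (hsub _ _ _) (hsub _ _ _))
  have hdisj : Disjoint (r c l l') X := by
    rw [Finset.disjoint_left]
    intro x hx hxX
    have := (Finset.mem_sdiff.1 (hX hxX)).2
    apply this
    cases l'
    · exact Finset.mem_union_right _ hx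
    · exact Finset.mem_union_left _ hx
  have hcu : (r c l l' ∪ X).card = (r c l l').card + X.card := Finset.card_union_of_disjoint hdisj
  have hN : ((Qf r (!c) l').filter (fun y => ∃ x ∈ r c l l' ∪ X, G.Adj x y)).card ≤ 2 * (r c l l' ∪ X).card := by
    have h1 : (Qf r (!c) l').filter (fun y => ∃ x ∈ r c l l' ∪ X, G.Adj x y) ⊆
        (Qf r (!c) l').filter (fun y => ∃ x ∈ r c l l', G.Adj x y) ∪ (Qf r (!c) l').filter (fun y => ∃ x ∈ X, G.Adj x y) := by
      intro y hy
      obtain ⟨hy, x, hx, hxy⟩ := Finset.mem_filter.1 hy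
      rcases Finset.mem_union.1 hx with h | h
      · exact Finset.mem_union_left _ (Finset.mem_filter.2 ⟨hy, x, h, hxy⟩)
      · exact Finset.mem_union_right _ (Finset.mem_filter.2 ⟨hy, x, h, hxy⟩)
    have h2 := (Finset.card_le_card h1).trans (Finset.card_union_le _ _)
    have h3 := (hgood c l l').2.2
    omega
  have hlt : (r c l l' ∪ X).card < m := by
    by_contra hge
    push Not at hge
    have h1 := (hgood c l l').2.1
    have h2 := hcard (!c) l'
    set F := (Qf r (!c) l').filter (fun y => ∃ x ∈ r c l l' ∪ X, G.Adj x y) with hF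
    have h3 := Finset.le_card_sdiff F (Qf r (!c) l')
    obtain ⟨x, hx, y, hy, hxy⟩ := (hh c l l').ge (X := r c l l' ∪ X) (Y := Qf r (!c) l' \ F)
      (Finset.union_subset (hgood c l l').1 hXP) (Finset.sdiff_subset.trans Finset.sdiff_subset) hge (by omega)
    rw [Finset.mem_sdiff] at hy
    exact hy.2 (Finset.mem_filter.2 ⟨hy.1, x, hx, hxy⟩)
  have hgood' : good r' := by
    intro a b d
    by_cases he : a = c ∧ b = l ∧ d = l'
    · have e : r' a b d = r c l l' ∪ X := by
        simp only [hr', he, and_self, if_true]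
      rw [e]
      obtain ⟨rfl, rfl, rfl⟩ := he
      refine ⟨Finset.union_subset (hgood _ _ _).1 hXP, hlt, le_trans (Finset.card_le_card ?_) hN⟩
      exact Finset.filter_subset_filter _ (hQsub _ _)
    · have e : r' a b d = r a b d := by
        simp only [hr', he, if_false]
      rw [e]
      refine ⟨(hgood _ _ _).1, (hgood _ _ _).2.1, le_trans (Finset.card_le_card ?_) (hgood a b d).2.2⟩
      exact Finset.filter_subset_filter _ (hQsub _ _)
  have hle := hmax r' (Finset.mem_filter.2 ⟨Finset.mem_univ _, hgood'⟩)
  have hlt2 : ∑ a, ∑ b, ∑ d, (r a b d).card < ∑ a, ∑ b, ∑ d, (r' a b d).card := by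
    refine Finset.sum_lt_sum (fun a _ => Finset.sum_le_sum fun b _ => Finset.sum_le_sum fun d _ => Finset.card_le_card (hsub _ _ _)) ⟨c, Finset.mem_univ _, ?_⟩
    refine Finset.sum_lt_sum (fun b _ => Finset.sum_le_sum fun d _ => Finset.card_le_card (hsub _ _ _)) ⟨l, Finset.mem_univ _, ?_⟩
    refine Finset.sum_lt_sum (fun d _ => Finset.card_le_card (hsub _ _ _)) ⟨l', Finset.mem_univ _, ?_⟩
    have e : r' c l l' = r c l l' ∪ X := by simp [hr']
    rw [e, hcu]
    have := hXne.card_pos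
    omega
  omega

/-- the four-set seed -/
theorem four_set [Finite V] {P : Bool → Bool → Finset V} {m s : ℕ} (hm : 0 < m) (hs : 8 * m ≤ s)
    (hPs : ∀ c l, (P c l).card = s)
    (hdis : ∀ c l c' l' v, v ∈ P c l → v ∈ P c' l' → c = c' ∧ l = l')
    (hh : ∀ c l l', NoHole G m (P c l) (P (!c) l'))
    (hno : ∀ c, ∀ x ∈ P c true, ∀ y ∈ P c false, ¬ G.Adj x y) :
    ∃ Q : Bool → Bool → Finset V, (∀ c l, Q c l ⊆ P c l) ∧ (∀ c l, s ≤ (Q c l).card + 2 * m) ∧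
      Fb (KL G {v | ∃ c l, v ∈ Q c l}) := by
  classical
  obtain ⟨Q, hQP, hQs, hQ⟩ := trim hs hPs hh
  refine ⟨Q, hQP, hQs, ?_⟩
  set col : V → Bool := fun v => decide (∃ l, v ∈ P true l) with hcol
  set lab : V → Bool := fun v => decide (∃ c, v ∈ P c true) with hlab
  have hc : ∀ c l v, v ∈ Q c l → col v = c ∧ lab v = l := by
    intro c l v hv
    have hv := hQP c l hv
    constructor
    · cases c
      · simp only [hcol, decide_eq_false_iff_not]
        rintro ⟨l', h'⟩
        exact absurd (hdis _ _ _ _ _ hv h').1 (by simp)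
      · simp only [hcol, decide_eq_true_eq]; exact ⟨l, hv⟩
    · cases l
      · simp only [hlab, decide_eq_false_iff_not]
        rintro ⟨l', h'⟩
        exact absurd (hdis _ _ _ _ _ hv h').2 (by simp)
      · simp only [hlab, decide_eq_true_eq]; exact ⟨c, hv⟩
  refine seed (ι := Bool) _ (Set.toFinite _) col lab ?_ ?_
  · rintro u ⟨c, l, hu⟩ v ⟨c', l', hv⟩ huv he
    obtain ⟨h1, h2⟩ := hc _ _ _ hu
    obtain ⟨h3, h4⟩ := hc _ _ _ hv
    rw [h1, h3] at he
    subst he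
    rw [h2, h4]
    cases l <;> cases l'
    · rfl
    · exact absurd huv.symm (hno c v (hQP _ _ hv) u (hQP _ _ hu))
    · exact absurd huv (hno c u (hQP _ _ hu) v (hQP _ _ hv))
    · rfl
  · intro st
    have hmem : ∀ v, v ∈ {v | ∃ c l, v ∈ Q c l} → lab v = st (col v) → v ∈ Q true (st true) ∪ Q false (st false) := by
      rintro v ⟨c, l, hv⟩ h
      obtain ⟨h1, h2⟩ := hc _ _ _ hv
      rw [h1, h2] at h
      subst h
      cases c
      · exact Finset.mem_union_right _ hv
      · exact Finset.mem_union_left _ hv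
    constructor
    · have : (Q true (st true)).Nonempty := by
        rw [← Finset.card_pos]; have := hQs true (st true); omega
      obtain ⟨v, hv⟩ := this
      obtain ⟨h1, h2⟩ := hc _ _ _ hv
      exact ⟨v, ⟨_, _, hv⟩, by rw [h1, h2]⟩
    · intro v hv v' hv' h h'
      have hs1 := hQs true (st true)
      have hs2 := hQs false (st false)
      refine bip_conn (A := Q true (st true)) (B := Q false (st false)) (hQ true (st true) (st false)) (hQ false (st false) (st true))
        (fun X hX Y hY => hh true (st true) (st false) X (hX.trans (hQP _ _)) Y (hY.trans (hQP _ _)))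
        (by omega) (by omega) ?_ ?_ (hmem v hv h) (hmem v' hv' h')
      · intro x hx y hy hxy
        obtain ⟨h1, h2⟩ := hc _ _ _ hx
        obtain ⟨h3, h4⟩ := hc _ _ _ hy
        exact ⟨⟨_, _, hx⟩, ⟨_, _, hy⟩, by rw [h1, h2], by rw [h3, h4], hxy, by rw [h1, h3]; simp⟩
      · intro x hx y hy hxy
        obtain ⟨h1, h2⟩ := hc _ _ _ hx
        obtain ⟨h3, h4⟩ := hc _ _ _ hy
        exact ⟨⟨_, _, hy⟩, ⟨_, _, hx⟩, by rw [h3, h4], by rw [h1, h2], hxy.symm, by rw [h1, h3]; simp⟩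
end four
end RacgFib

namespace RacgFib
section r2
variable {V : Type*} {G : SimpleGraph V}

/-- closed sets -/
def Closed (G : SimpleGraph V) (L : Set V) : Prop :=
  ∀ v, v ∉ L → ∀ a ∈ L, ∀ b ∈ L, a ≠ b → G.Adj v a → G.Adj v b → G.Adj a b

theorem r2_closure [Fintype V] {P : Bool → Bool → Finset V} {m s x0 z1 : ℕ} (hm : 0 < m) (hs : 8 * m ≤ s)
    (hx0 : x0 + 2 * m ≤ s)
    (hPs : ∀ c l, (P c l).card = s)
    (hdis : ∀ c l c' l' v, v ∈ P c l → v ∈ P c' l' → c = c' ∧ l = l')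
    (hh : ∀ c l l', NoHole G m (P c l) (P (!c) l'))
    (hno : ∀ c, ∀ x ∈ P c true, ∀ y ∈ P c false, ¬ G.Adj x y)
    (h3 : ∀ X Z : Finset V, X.card = x0 → Z.card = z1 → Disjoint X Z → ∃ x ∈ X, ∃ z ∈ Z, G.Adj x z) :
    ∃ L : Set V, Fb (KL G L) ∧ Closed G L ∧ ∀ Z : Finset V, (∀ z ∈ Z, z ∉ L) → Z.card < 2 * z1 := by
  classical
  obtain ⟨Q, hQP, hQs, hF⟩ := four_set hm hs hPs hdis hh hno
  obtain ⟨L, hL0, hFL, hcl⟩ := percolate hF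
  refine ⟨L, hFL, hcl, ?_⟩
  intro Z hZ
  have hsm : ∀ l, ∀ Z' ⊆ Z, (∀ z ∈ Z', ∀ x ∈ Q true l, ¬ G.Adj x z) → Z'.card < z1 := by
    intro l Z' hZ' hn
    by_contra hc
    push Not at hc
    obtain ⟨Z2, hZ2, e2⟩ := Finset.exists_subset_card_eq hc
    obtain ⟨X2, hX2, e3⟩ := Finset.exists_subset_card_eq (s := Q true l) (n := x0) (by have := hQs true l; omega)
    obtain ⟨x, hx, z, hz, hxz⟩ := h3 X2 Z2 e3 e2 (by
      rw [Finset.disjoint_left]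
      intro x hx hxz
      exact hZ x (hZ' (hZ2 hxz)) (hL0 ⟨_, _, hX2 hx⟩))
    exact hn z (hZ2 hz) x (hX2 hx) hxz
  have h1 := hsm true (Z.filter (fun z => ∀ x ∈ Q true true, ¬ G.Adj x z)) (Finset.filter_subset _ _)
    (fun z hz => (Finset.mem_filter.1 hz).2)
  have h2 := hsm false (Z.filter (fun z => ∀ x ∈ Q true false, ¬ G.Adj x z)) (Finset.filter_subset _ _)
    (fun z hz => (Finset.mem_filter.1 hz).2)
  have h4 : Z ⊆ Z.filter (fun z => ∀ x ∈ Q true true, ¬ G.Adj x z) ∪ Z.filter (fun z => ∀ x ∈ Q true false, ¬ G.Adj x z) := by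
    intro z hz
    by_contra hc
    rw [Finset.mem_union, Finset.mem_filter, Finset.mem_filter] at hc
    push Not at hc
    obtain ⟨a, ha, haz⟩ := hc.1 hz
    obtain ⟨b, hb, hbz⟩ := hc.2 hz
    have hab := hno true a (hQP _ _ ha) b (hQP _ _ hb)
    refine hab (hcl z (hZ z hz) a (hL0 ⟨_, _, ha⟩) b (hL0 ⟨_, _, hb⟩) ?_ haz.symm hbz.symm)
    rintro rfl
    exact absurd (hdis _ _ _ _ _ (hQP _ _ ha) (hQP _ _ hb)).2 (by simp)
  have := (Finset.card_le_card h4).trans (Finset.card_union_le _ _)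
  omega

open Classical in
lemma closed_deg [Fintype V] {L : Set V} (hcl : Closed G L) {κ : ℕ}
    (hκ : ∀ S : Finset V, (∀ a ∈ S, ∀ b ∈ S, a ≠ b → G.Adj a b) → S.card ≤ κ) {z : V} (hz : z ∉ L) :
    (Finset.univ.filter (fun w => w ∈ L ∧ G.Adj z w)).card ≤ κ := by
  apply hκ
  intro a ha b hb hab
  obtain ⟨_, ha1, ha2⟩ := Finset.mem_filter.1 ha
  obtain ⟨_, hb1, hb2⟩ := Finset.mem_filter.1 hb
  exact hcl z hz a ha1 b hb1 hab ha2 hb2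

open Classical in
lemma closed_small [Fintype V] {L : Set V} (hcl : Closed G L) {κ z0 z1 : ℕ}
    (hκ : ∀ S : Finset V, (∀ a ∈ S, ∀ b ∈ S, a ≠ b → G.Adj a b) → S.card ≤ κ)
    (hL : ∀ Z : Finset V, (∀ z ∈ Z, z ∉ L) → Z.card < 2 * z1)
    (hS4 : ∀ Z : Finset V, z0 ≤ Z.card → Z.card < 2 * z1 →
      κ * Z.card < ∑ z ∈ Z, (Finset.univ.filter (fun w => w ∉ Z ∧ G.Adj z w)).card) :
    (Finset.univ.filter (fun z => z ∉ L)).card < z0 := by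
  by_contra hc
  push Not at hc
  set Z := Finset.univ.filter (fun z => z ∉ L) with hZ
  have hmem : ∀ z, z ∈ Z ↔ z ∉ L := fun z => by simp [hZ]
  have h1 := hS4 Z hc (hL Z fun z hz => (hmem z).1 hz)
  have h2 : ∑ z ∈ Z, (Finset.univ.filter (fun w => w ∉ Z ∧ G.Adj z w)).card ≤ ∑ z ∈ Z, κ := by
    apply Finset.sum_le_sum
    intro z hz
    refine le_trans (Finset.card_le_card ?_) (closed_deg hcl hκ ((hmem z).1 hz))
    intro w hw
    simp only [Finset.mem_filter, Finset.mem_univ, true_and, hmem, not_not] at hw ⊢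
    exact hw
  rw [Finset.sum_const, smul_eq_mul, mul_comm] at h2
  omega

open Classical in
lemma low_finish [Fintype V] {G1 G3 : SimpleGraph V} {L : Set V} (hcl : Closed G L) {κ D z0 : ℕ} (hD : κ + 6 ≤ D)
    (h1 : G1 ≤ G) (h3 : G ≤ G3)
    (hκ : ∀ S : Finset V, (∀ a ∈ S, ∀ b ∈ S, a ≠ b → G.Adj a b) → S.card ≤ κ)
    (hz0 : (Finset.univ.filter (fun z => z ∉ L)).card < z0)
    (l1 : ∀ u v, (Finset.univ.filter (G1.Adj u)).card ≤ D → (Finset.univ.filter (G1.Adj v)).card ≤ D → ¬ G3.Adj u v)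
    (l2 : ∀ u v w, u ≠ v → (Finset.univ.filter (G1.Adj u)).card ≤ D → (Finset.univ.filter (G1.Adj v)).card ≤ D →
      G3.Adj u w → ¬ G3.Adj v w)
    (l3 : ∀ u v w, (Finset.univ.filter (G1.Adj u)).card ≤ D → G3.Adj u v → G3.Adj u w → ¬ G3.Adj v w)
    (h6 : ∀ X : Finset V, X.Nonempty → X.card < z0 → ∑ x ∈ X, (X.filter (G3.Adj x)).card < 6 * X.card)
    (hdeg : ∀ v, ∃ a b, a ≠ b ∧ G.Adj v a ∧ G.Adj v b) : L = Set.univ := by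
  set H := Finset.univ.filter (fun z => z ∉ L ∧ ¬ (Finset.univ.filter (G1.Adj z)).card ≤ D) with hH
  have hHe : H = ∅ := by
    by_contra hne
    have hne : H.Nonempty := Finset.nonempty_iff_ne_empty.2 hne
    have hc : H.card < z0 := lt_of_le_of_lt (Finset.card_le_card (by
      intro z hz
      simp only [hH, Finset.mem_filter, Finset.mem_univ, true_and] at hz ⊢
      exact hz.1)) hz0
    have := h6 H hne hc
    have h7 : ∑ x ∈ H, 6 ≤ ∑ x ∈ H, (H.filter (G3.Adj x)).card := by
      apply Finset.sum_le_sum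
      intro z hz
      simp only [hH, Finset.mem_filter, Finset.mem_univ, true_and] at hz
      obtain ⟨hzL, hzD⟩ := hz
      have e1 := closed_deg hcl hκ hzL
      have e2 : (Finset.univ.filter (fun w => (Finset.univ.filter (G1.Adj w)).card ≤ D ∧ G3.Adj z w)).card ≤ 1 := by
        rw [Finset.card_le_one]
        intro a ha b hb
        simp only [Finset.mem_filter, Finset.mem_univ, true_and] at ha hb
        by_contra hab
        exact l2 a b z hab ha.1 hb.1 ha.2.symm hb.2.symm
      have e3 : Finset.univ.filter (G1.Adj z) ⊆ Finset.univ.filter (fun w => w ∈ L ∧ G.Adj z w) ∪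
          (Finset.univ.filter (fun w => (Finset.univ.filter (G1.Adj w)).card ≤ D ∧ G3.Adj z w) ∪ H.filter (G3.Adj z)) := by
        intro w hw
        simp only [Finset.mem_filter, Finset.mem_univ, true_and, Finset.mem_union, hH] at hw ⊢
        have g1 := h1 hw
        have g2 := h3 g1
        tauto
      have e4 := (Finset.card_le_card e3).trans ((Finset.card_union_le _ _).trans (Nat.add_le_add_left (Finset.card_union_le _ _) _))
      omega
    simp only [Finset.sum_const, smul_eq_mul] at h7
    omega
  have hlow : ∀ z, z ∉ L → (Finset.univ.filter (G1.Adj z)).card ≤ D := by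
    intro z hz
    by_contra hc
    have : z ∈ H := by simp [hH, hz]; omega
    rw [hHe] at this
    simp at this
  rw [Set.eq_univ_iff_forall]
  intro z
  by_contra hz
  have hz1 := hlow z hz
  obtain ⟨a, b, hab, ha, hb⟩ := hdeg z
  have hL : ∀ a, G.Adj z a → a ∈ L := by
    intro a ha
    by_contra h
    exact l1 z a hz1 (hlow a h) (h3 ha)
  exact l3 z a b hz1 (h3 ha) (h3 hb) (h3 (hcl z hz a (hL a ha) b (hL b hb) hab ha hb))

/-- regime 3 -/
theorem r3_det [Finite V] {a b : V} (hab : a ≠ b) (hn : ¬ G.Adj a b)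
    (h : ∀ v, v ≠ a → v ≠ b → ∃ x y, x ≠ y ∧ ¬ G.Adj x y ∧ G.Adj a x ∧ G.Adj b x ∧ G.Adj v x ∧
      G.Adj a y ∧ G.Adj b y ∧ G.Adj v y) : VirtuallyAlgebraicallyFibers (RACG G) := by
  obtain ⟨L, hL0, hF, hcl⟩ := percolate (seed_pair hab hn)
  have ha : a ∈ L := hL0 (by simp)
  have hb : b ∈ L := hL0 (by simp)
  have hc : ∀ x, G.Adj a x → G.Adj b x → x ∈ L := by
    intro x h1 h2
    by_contra hx
    exact hn (hcl x hx a ha b hb hab h1.symm h2.symm)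
  have : L = Set.univ := by
    rw [Set.eq_univ_iff_forall]
    intro v
    by_contra hv
    obtain ⟨x, y, hxy, hnxy, h1, h2, h3, h4, h5, h6⟩ := h v (fun h => hv (h ▸ ha)) (fun h => hv (h ▸ hb))
    exact hnxy (hcl v hv x (hc x h1 h2) y (hc y h4 h5) hxy h3 h6)
  exact vf_of_univ (this ▸ hF)
end r2
end RacgFib

namespace RacgFib

lemma r6_det {V : Type*} [Finite V] {G G6 : SimpleGraph V} (h6 : G6 ≤ G) {a b : V} (hab : a ≠ b)
    (hn : ¬ G.Adj a b) (H1 : ∀ u v w, u ≠ v → u ≠ w → v ≠ w → G6.Adj u v ∨ G6.Adj u w) :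
    VirtuallyAlgebraicallyFibers (RACG G) := by
  obtain ⟨L, h0, hF, hL⟩ := percolate (seed_pair hab hn)
  have : L = Set.univ := by
    refine Set.eq_univ_of_forall fun v => ?_
    by_contra hv
    have ha : a ∈ L := h0 (by simp)
    have hb : b ∈ L := h0 (by simp)
    have hva : v ≠ a := fun h => hv (h ▸ ha)
    have hvb : v ≠ b := fun h => hv (h ▸ hb)
    refine hn (hL v hv a ha b hb hab ?_ ?_)
    · rcases H1 a b v hab hva.symm hvb.symm with h | h
      · exact absurd (h6 h) hn
      · exact (h6 h).symm
    · rcases H1 b a v hab.symm hvb.symm hva.symm with h | h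
      · exact absurd (h6 h).symm hn
      · exact (h6 h).symm
  rw [this] at hF
  exact vf_of_univ hF

lemma r4_det {V : Type*} [Finite V] {G5 G G6 : SimpleGraph V} (h5 : G5 ≤ G) (h6 : G ≤ G6)
    (H1 : ∀ u v w, u ≠ v → u ≠ w → v ≠ w → G6.Adj u v ∨ G6.Adj u w)
    (H2 : ∀ a b c d, a ≠ b → a ≠ c → a ≠ d → b ≠ c → b ≠ d → c ≠ d → ¬ G6.Adj a b → ¬ G6.Adj c d →
      G5.Adj a c)
    (H3 : ∃ a b : Fin 6 → V, ∀ i, a i ≠ b i ∧ ¬ G6.Adj (a i) (b i) ∧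
      ∀ j, i ≠ j → s(a i, b i) ≠ s(a j, b j))
    (H4 : ∀ v, ∀ a b : Fin 6 → V, (∀ i, v ≠ a i ∧ v ≠ b i ∧ a i ≠ b i ∧ ¬ G6.Adj (a i) (b i) ∧
      ∀ j, i ≠ j → a i ≠ a j ∧ a i ≠ b j ∧ b i ≠ b j) → ∃ i, G5.Adj v (a i)) :
    VirtuallyAlgebraicallyFibers (RACG G) := by
  obtain ⟨a, b, hab⟩ := H3
  have key : ∀ x y x' y' : V, x ≠ y → x' ≠ y' → ¬ G6.Adj x y → ¬ G6.Adj x' y' → s(x, y) ≠ s(x', y') →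
      x ≠ x' := by
    rintro x y x' y' h1 h2 h3 h4 h5 rfl
    have : y ≠ y' := by rintro rfl; exact h5 rfl
    rcases H1 x y y' h1 h2 this with h | h
    exacts [h3 h, h4 h]
  have hdis : ∀ i j, i ≠ j → a i ≠ a j ∧ a i ≠ b j ∧ b i ≠ b j := by
    intro i j hij
    obtain ⟨i1, i2, i3⟩ := hab i
    obtain ⟨j1, j2, -⟩ := hab j
    have h3 := i3 j hij
    refine ⟨key _ _ _ _ i1 j1 i2 j2 h3, key _ _ _ _ i1 j1.symm i2 (fun h => j2 h.symm) ?_,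
      key _ _ _ _ i1.symm j1.symm (fun h => i2 h.symm) (fun h => j2 h.symm) ?_⟩
    · rwa [Sym2.eq_swap (a := b j)]
    · rwa [Sym2.eq_swap (a := b j), Sym2.eq_swap (a := b i)]
  have hn : ∀ i, ¬ G.Adj (a i) (b i) := fun i h => (hab i).2.1 (h6 h)
  have hn' : ∀ i, ¬ G6.Adj (b i) (a i) := fun i h => (hab i).2.1 h.symm
  obtain ⟨L, h0, hF, hL⟩ := percolate (seed_pair (hab 0).1 (hn 0))
  have ha0 : a 0 ∈ L := h0 (by simp)
  have hb0 : b 0 ∈ L := h0 (by simp)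
  have hall : ∀ j, a j ∈ L ∧ b j ∈ L := by
    intro j
    by_cases hj : j = 0
    · subst hj; exact ⟨ha0, hb0⟩
    have d1 := hdis j 0 hj
    have d2 := hdis 0 j (Ne.symm hj)
    have e0 := hab 0
    have ej := hab j
    constructor
    · by_contra hv
      exact hn 0 (hL _ hv _ ha0 _ hb0 e0.1
        (h5 (H2 _ _ _ _ ej.1 d1.1 d1.2.1 d2.2.1.symm d1.2.2 e0.1 ej.2.1 e0.2.1))
        (h5 (H2 _ _ _ _ ej.1 d1.2.1 d1.1 d1.2.2 d2.2.1.symm e0.1.symm ej.2.1 (hn' 0))))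
    · by_contra hv
      exact hn 0 (hL _ hv _ ha0 _ hb0 e0.1
        (h5 (H2 _ _ _ _ ej.1.symm d2.2.1.symm d1.2.2 d1.1 d1.2.1 e0.1 (hn' j) e0.2.1))
        (h5 (H2 _ _ _ _ ej.1.symm d1.2.2 d2.2.1.symm d1.2.1 d1.1 e0.1.symm (hn' j) (hn' 0))))
  have : L = Set.univ := by
    refine Set.eq_univ_of_forall fun v => ?_
    by_contra hv
    have hva : ∀ i, v ≠ a i := fun i h => hv (h ▸ (hall i).1)
    have hvb : ∀ i, v ≠ b i := fun i h => hv (h ▸ (hall i).2)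
    have hc : ∀ i, ∃ c d, s(c, d) = s(a i, b i) ∧ ¬ G.Adj v c := by
      intro i
      by_cases h1 : G.Adj v (a i)
      · refine ⟨b i, a i, Sym2.eq_swap, fun h2 => ?_⟩
        exact hn i (hL v hv _ (hall i).1 _ (hall i).2 (hab i).1 h1 h2)
      · exact ⟨a i, b i, rfl, h1⟩
    choose c d hcd hvc using hc
    obtain ⟨i, hi⟩ := H4 v c d (by
      intro i
      have e := hab i
      rcases Sym2.eq_iff.1 (hcd i) with ⟨h1, h2⟩ | ⟨h1, h2⟩ <;> rw [h1, h2]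
      · refine ⟨hva i, hvb i, e.1, e.2.1, fun j hij => ?_⟩
        have d1 := hdis i j hij
        have d2 := hdis j i hij.symm
        rcases Sym2.eq_iff.1 (hcd j) with ⟨h1, h2⟩ | ⟨h1, h2⟩ <;> rw [h1, h2]
        · exact d1
        · exact ⟨d1.2.1, d1.1, d2.2.1.symm⟩
      · refine ⟨hvb i, hva i, e.1.symm, hn' i, fun j hij => ?_⟩
        have d1 := hdis i j hij
        have d2 := hdis j i hij.symm
        rcases Sym2.eq_iff.1 (hcd j) with ⟨h1, h2⟩ | ⟨h1, h2⟩ <;> rw [h1, h2]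
        · exact ⟨d2.2.1.symm, d1.2.2, d1.2.1⟩
        · exact ⟨d1.2.2, d2.2.1.symm, d1.1⟩)
    exact hvc i (h5 hi)
  rw [this] at hF
  exact vf_of_univ hF
end RacgFib

namespace RacgFib
open Classical Finset

section tools
variable {E : Type*} [Fintype E] {R : ℕ}

noncomputable def Ex (X : (E → Fin R) → ℝ) : ℝ := (∑ ω, X ω) / (R : ℝ) ^ Fintype.card E

noncomputable def Pr (A : Set (E → Fin R)) : ℝ := Ex (A.indicator 1)

noncomputable def pr (P : Fin R → Prop) : ℝ := ((univ.filter P).card : ℝ) / R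

lemma Ex_prod (hR : 0 < R) (F : Finset E) (w : E → Fin R → ℝ) :
    Ex (fun ω : E → Fin R => ∏ e ∈ F, w e (ω e)) = ∏ e ∈ F, ((∑ x, w e x) / R) := by
  have h1 : ∀ ω : E → Fin R, ∏ e ∈ F, w e (ω e) = ∏ e, if e ∈ F then w e (ω e) else 1 := by
    intro ω; rw [Finset.prod_ite_mem, Finset.univ_inter]
  have hR' : (R : ℝ) ≠ 0 := by positivity
  have h2 := Finset.prod_univ_sum (fun _ : E => (univ : Finset (Fin R)))
    (fun e x => if e ∈ F then w e x else 1)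
  rw [Fintype.piFinset_univ] at h2
  unfold Ex
  rw [Finset.sum_congr rfl (fun ω _ => h1 ω), ← h2, ← Finset.card_univ, ← Finset.prod_const,
    ← Finset.prod_div_distrib, ← Finset.univ_inter F, ← Finset.prod_ite_mem]
  refine Finset.prod_congr rfl fun e _ => ?_
  by_cases he : e ∈ F <;> simp [he, hR']

lemma Ex_sum {ι : Type*} (I : Finset ι) (X : ι → (E → Fin R) → ℝ) :
    Ex (fun ω => ∑ i ∈ I, X i ω) = ∑ i ∈ I, Ex (X i) := by
  unfold Ex
  rw [Finset.sum_comm, Finset.sum_div]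

lemma Ex_mul (c : ℝ) (X : (E → Fin R) → ℝ) : Ex (fun ω => c * X ω) = c * Ex X := by
  unfold Ex
  rw [← Finset.mul_sum, mul_div_assoc]

lemma Ex_mono {X Y : (E → Fin R) → ℝ} (h : ∀ ω, X ω ≤ Y ω) : Ex X ≤ Ex Y := by
  unfold Ex
  gcongr with ω
  exact h ω

lemma Ex_block {ι : Type*} (hR : 0 < R) (I : Finset ι) (T : ι → Finset E)
    (hT : ∀ i ∈ I, ∀ j ∈ I, i ≠ j → Disjoint (T i) (T j)) (c : ℝ) (w : E → Fin R → ℝ) :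
    Ex (fun ω : E → Fin R => ∏ i ∈ I, (1 - c * ∏ e ∈ T i, w e (ω e))) =
      ∏ i ∈ I, (1 - c * ∏ e ∈ T i, ((∑ x, w e x) / R)) := by
  simp only [sub_eq_add_neg, Finset.prod_one_add]
  rw [Ex_sum]
  refine Finset.sum_congr rfl fun J hJ => ?_
  have hJ' := Finset.mem_powerset.1 hJ
  have h1 : ∀ f : E → ℝ, ∏ i ∈ J, -(c * ∏ e ∈ T i, f e) =
      (-c) ^ J.card * ∏ e ∈ J.biUnion T, f e := by
    intro f
    rw [Finset.prod_biUnion (fun i hi j hj hij => hT i (hJ' hi) j (hJ' hj) hij),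
      ← Finset.prod_const, ← Finset.prod_mul_distrib]
    exact Finset.prod_congr rfl fun _ _ => by ring
  rw [h1]
  have h2 : (fun ω : E → Fin R => ∏ i ∈ J, -(c * ∏ e ∈ T i, w e (ω e))) =
      fun ω => (-c) ^ J.card * ∏ e ∈ J.biUnion T, w e (ω e) := funext fun ω => h1 _
  rw [h2, Ex_mul, Ex_prod hR]

lemma Pr_le_Ex {A : Set (E → Fin R)} {X : (E → Fin R) → ℝ} (h0 : ∀ ω, 0 ≤ X ω)
    (h1 : ∀ ω ∈ A, 1 ≤ X ω) : Pr A ≤ Ex X := by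
  refine Ex_mono fun ω => ?_
  by_cases h : ω ∈ A
  · simpa [h] using h1 ω h
  · simpa [h] using h0 ω

lemma Pr_nonneg (A : Set (E → Fin R)) : 0 ≤ Pr A := by
  unfold Pr Ex
  refine div_nonneg (Finset.sum_nonneg fun ω _ => Set.indicator_nonneg (by simp) _) (by positivity)

lemma Pr_bUnion {ι : Type*} (I : Finset ι) {B : Set (E → Fin R)} (A : ι → Set (E → Fin R))
    (h : ∀ ω ∈ B, ∃ i ∈ I, ω ∈ A i) : Pr B ≤ ∑ i ∈ I, Pr (A i) := by
  unfold Pr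
  rw [← Ex_sum]
  refine Pr_le_Ex (fun ω => Finset.sum_nonneg fun i _ => Set.indicator_nonneg (by simp) _) ?_
  intro ω hω
  obtain ⟨i, hi, h⟩ := h ω hω
  calc (1:ℝ) = (A i).indicator 1 ω := by simp [h]
    _ ≤ _ := Finset.single_le_sum (f := fun i => (A i).indicator (1 : (E → Fin R) → ℝ) ω)
      (fun i _ => Set.indicator_nonneg (by simp) _) hi

lemma Pr_union_bound {ι : Type*} (I : Finset ι) {B : Set (E → Fin R)} (A : ι → Set (E → Fin R))
    (h : ∀ ω ∈ B, ∃ i ∈ I, ω ∈ A i) {b c : ℝ} (hb : ∀ i ∈ I, Pr (A i) ≤ b)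
    (hc : (I.card : ℝ) * b ≤ c) : Pr B ≤ c :=
  (Pr_bUnion I A h).trans ((Finset.sum_le_card_nsmul _ _ _ hb).trans (by simpa using hc))

lemma Pr_mono {A B : Set (E → Fin R)} (h : A ⊆ B) : Pr A ≤ Pr B := by
  have := Pr_bUnion ({()} : Finset Unit) (B := A) (fun _ => B) (fun ω hω => ⟨(), by simp, h hω⟩)
  simpa using this

lemma Pr_union_le {A B C : Set (E → Fin R)} (h : ∀ ω ∈ C, ω ∈ A ∨ ω ∈ B) :
    Pr C ≤ Pr A + Pr B := by
  have := Pr_bUnion (univ : Finset Bool) (B := C) (fun b => if b then A else B) (by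
    intro ω hω
    rcases h ω hω with h | h
    exacts [⟨true, by simpa using h⟩, ⟨false, by simpa using h⟩])
  simpa using this

lemma pr_nonneg (P : Fin R → Prop) : 0 ≤ pr P := by unfold pr; positivity

/-- main moment bound -/
lemma Pr_moment (hR : 0 < R) (A : Set (E → Fin R)) (F E' : Finset E) (hd : Disjoint F E')
    (P Q : Fin R → Prop) (c θ : ℝ) (hθ : 0 ≤ θ) (hc : 0 < c)
    (hF : ∀ ω ∈ A, ∀ e ∈ F, P (ω e))
    (hE : ∀ ω ∈ A, ∀ J : Finset E, (∀ e, e ∈ J ↔ e ∈ E' ∧ Q (ω e)) → c ≤ θ ^ J.card) :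
    Pr A ≤ c⁻¹ * (pr P ^ F.card * (1 - pr Q + pr Q * θ) ^ E'.card) := by
  have hR' : (R : ℝ) ≠ 0 := by positivity
  set w : E → Fin R → ℝ := fun e x => if e ∈ F then (if P x then 1 else 0) else
    (if Q x then θ else 1) with hw
  have key : ∀ ω : E → Fin R, ∏ e ∈ F ∪ E', w e (ω e) =
      (∏ e ∈ F, if P (ω e) then 1 else 0) * θ ^ (E'.filter (fun e => Q (ω e))).card := by
    intro ω
    rw [Finset.prod_union hd]
    congr 1
    · exact Finset.prod_congr rfl fun e he => by simp [hw, he]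
    · rw [← Finset.prod_const, Finset.prod_filter]
      exact Finset.prod_congr rfl fun e he => by
        simp [hw, Finset.disjoint_right.1 hd he]
  have hw0 : ∀ e x, 0 ≤ w e x := by
    intro e x; simp only [hw]; split_ifs <;> first | exact hθ | norm_num
  have h1 : Pr A ≤ Ex (fun ω => c⁻¹ * ∏ e ∈ F ∪ E', w e (ω e)) := by
    refine Pr_le_Ex (fun ω => mul_nonneg (inv_nonneg.2 hc.le)
      (Finset.prod_nonneg fun e _ => hw0 _ _)) fun ω hω => ?_
    rw [key, Finset.prod_eq_one (fun e he => by simp [hF ω hω e he]), one_mul,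
      inv_mul_eq_div, one_le_div hc]
    exact hE ω hω _ (by simp)
  refine h1.trans (le_of_eq ?_)
  rw [Ex_mul, Ex_prod hR, Finset.prod_union hd]
  congr 2
  · rw [← Finset.prod_const]
    refine Finset.prod_congr rfl fun e he => ?_
    simp [hw, he, pr]
  · rw [← Finset.prod_const]
    refine Finset.prod_congr rfl fun e he => ?_
    have he' := Finset.disjoint_right.1 hd he
    simp only [hw, he', if_false, pr]
    have : ∀ x : Fin R, (if Q x then θ else 1) = 1 + (θ - 1) * (if Q x then 1 else 0) := by
      intro x; split_ifs <;> ring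
    rw [Finset.sum_congr rfl fun x _ => this x, Finset.sum_add_distrib, ← Finset.mul_sum]
    simp only [Finset.sum_const, Finset.card_univ, Fintype.card_fin, nsmul_eq_mul, mul_one,
      Finset.sum_boole]
    field_simp
    ring

/-- all of `F` satisfy `P`, and all of `E'` fail `Q` -/
lemma Pr_absent (hR : 0 < R) (A : Set (E → Fin R)) (F E' : Finset E) (hd : Disjoint F E')
    (P Q : Fin R → Prop) (hF : ∀ ω ∈ A, ∀ e ∈ F, P (ω e))
    (hE : ∀ ω ∈ A, ∀ e ∈ E', ¬ Q (ω e)) :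
    Pr A ≤ pr P ^ F.card * (1 - pr Q) ^ E'.card := by
  have := Pr_moment hR A F E' hd P Q 1 0 le_rfl one_pos hF (by
    intro ω hω J hJ
    have : J = ∅ := Finset.eq_empty_of_forall_notMem fun e he =>
      hE ω hω e ((hJ e).1 he).1 ((hJ e).1 he).2
    simp [this])
  simpa using this

/-- transfer of a fraction bound -/
lemma Pr_eq_card (A : Set (E → Fin R)) : Pr A = (Nat.card A : ℝ) / (R : ℝ) ^ Fintype.card E := by
  unfold Pr Ex
  congr 1
  simp only [Set.indicator_apply, Pi.one_apply]
  rw [Finset.sum_boole, Nat.card_eq_fintype_card, Fintype.card_subtype]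

lemma pr_lt {t : ℕ} (ht : t ≤ R) : pr (fun x : Fin R => (x : ℕ) < t) = (t : ℝ) / R := by
  unfold pr
  congr 2
  have : (univ.filter (fun x : Fin R => (x : ℕ) < t)) = (univ : Finset (Fin t)).map (Fin.castLEEmb ht) := by
    ext x
    simp only [mem_filter, mem_univ, true_and, Finset.mem_map, Fin.castLEEmb_apply]
    constructor
    · intro h; exact ⟨⟨x, h⟩, by ext; simp⟩
    · rintro ⟨y, rfl⟩; simp
  convert congrArg Finset.card this
  simp

lemma pr_ge {t : ℕ} (hR : 0 < R) (ht : t ≤ R) : pr (fun x : Fin R => ¬ (x : ℕ) < t) = 1 - (t : ℝ) / R := by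
  have h1 := pr_lt ht
  have hR' : (R : ℝ) ≠ 0 := by positivity
  rw [← h1]
  unfold pr
  rw [eq_sub_iff_add_eq, ← add_div, div_eq_one_iff_eq hR', ← Nat.cast_add, add_comm,
    Finset.card_filter_add_card_filter_not]
  simp
end tools
end RacgFib

namespace RacgFib
open Classical Finset

/-- level graph -/
def gr {n R : ℕ} (ω : Sym2 (Fin n) → Fin R) (t : ℕ) : SimpleGraph (Fin n) where
  Adj u v := u ≠ v ∧ (ω s(u, v) : ℕ) < t
  symm := ⟨fun u v h => ⟨h.1.symm, by rw [Sym2.eq_swap]; exact h.2⟩⟩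
  loopless := ⟨fun _ h => h.1 rfl⟩

lemma gr_mono {n R : ℕ} (ω : Sym2 (Fin n) → Fin R) {t t' : ℕ} (h : t ≤ t') : gr ω t ≤ gr ω t' :=
  fun _ _ h1 => ⟨h1.1, h1.2.trans_le h⟩

abbrev NDg (n : ℕ) := {e : Sym2 (Fin n) // ¬ e.IsDiag}
abbrev Ord (n : ℕ) := Fin (n.choose 2) ≃ NDg n

noncomputable def lev {n R : ℕ} (σ : Ord n) (S : {S : Finset (Fin R) // S.card = n.choose 2})
    (d : {e : Sym2 (Fin n) // e.IsDiag} → Fin R) (e : Sym2 (Fin n)) : Fin R :=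
  if h : e.IsDiag then d ⟨e, h⟩ else S.1.orderEmbOfFin S.2 (σ.symm ⟨e, h⟩)

lemma gr_lev {n R : ℕ} (σ : Ord n) (S : {S : Finset (Fin R) // S.card = n.choose 2})
    (d : {e : Sym2 (Fin n) // e.IsDiag} → Fin R) (m : ℕ) (hm : m < n.choose 2) :
    gr (lev σ S d) (S.1.orderEmbOfFin S.2 ⟨m, hm⟩ : Fin R) = processGraph σ m := by
  ext u v
  by_cases huv : u = v
  · subst huv; simp
  have hd : ¬ (s(u, v)).IsDiag := by simpa using huv
  simp only [gr, processGraph, SimpleGraph.fromEdgeSet_adj, Set.mem_ofPred_eq, lev, hd, dite_false,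
    Fin.val_fin_lt, OrderEmbedding.lt_iff_lt, ne_eq, huv, not_false_eq_true, true_and, and_true]
  constructor
  · intro h; exact ⟨_, h, by simp⟩
  · rintro ⟨i, hi, he⟩
    have : (⟨s(u, v), hd⟩ : NDg n) = σ i := Subtype.ext he.symm
    rw [this]; simpa [Fin.lt_def] using hi

lemma lev_inj {n R : ℕ} {σ σ' : Ord n} {S S' : {S : Finset (Fin R) // S.card = n.choose 2}}
    {d d' : {e : Sym2 (Fin n) // e.IsDiag} → Fin R} (h : lev σ S d = lev σ' S' d') :
    σ = σ' ∧ S = S' ∧ d = d' := by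
  have h1 : ∀ e : NDg n, S.1.orderEmbOfFin S.2 (σ.symm e) = S'.1.orderEmbOfFin S'.2 (σ'.symm e) := by
    intro e
    have := congrFun h e.1
    simpa [lev, e.2] using this
  have h2 : S = S' := by
    have a1 : Set.range (S.1.orderEmbOfFin S.2) = Set.range (S'.1.orderEmbOfFin S'.2) := by
      rw [← σ.symm.surjective.range_comp, ← σ'.symm.surjective.range_comp]
      exact congrArg _ (funext h1)
    rw [Finset.range_orderEmbOfFin, Finset.range_orderEmbOfFin] at a1
    exact Subtype.ext (Finset.coe_injective a1)
  subst h2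
  refine ⟨?_, rfl, ?_⟩
  · have : σ.symm = σ'.symm := Equiv.ext fun e => (S.1.orderEmbOfFin S.2).injective (h1 e)
    simpa using congrArg Equiv.symm this
  · ext1 e
    have := congrFun h e.1
    simpa [lev, e.2] using this

lemma desc_bound {N R : ℕ} (h : 2 * N ^ 2 ≤ R) : R ^ N ≤ 2 * R.descFactorial N := by
  rcases Nat.eq_zero_or_pos N with rfl | hN
  · simp
  have hNR : N ≤ R := by nlinarith
  have hR : 0 < R := hN.trans_le hNR
  have h1 : (R - N) ^ N ≤ R.descFactorial N :=
    (Nat.pow_le_pow_left (by omega) N).trans (Nat.pow_sub_le_descFactorial R N)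
  refine le_trans ?_ (Nat.mul_le_mul_left 2 h1)
  have hR' : (0 : ℝ) < R := by exact_mod_cast hR
  have h2 : (1 : ℝ) + N * (-(N / R : ℝ)) ≤ (1 + -(N / R : ℝ)) ^ N := by
    apply one_add_mul_le_pow
    have : (N / R : ℝ) ≤ 1 := by rw [div_le_one hR']; exact_mod_cast hNR
    linarith
  have h3 : (1 : ℝ) / 2 ≤ 1 + N * (-(N / R : ℝ)) := by
    have : (N : ℝ) * (N / R) ≤ 1 / 2 := by
      rw [← mul_div_assoc, div_le_iff₀ hR']
      have : (2 : ℝ) * N ^ 2 ≤ R := by exact_mod_cast h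
      nlinarith
    linarith
  have h4 : ((R - N : ℕ) : ℝ) ^ N = (1 + -(N / R : ℝ)) ^ N * R ^ N := by
    rw [← mul_pow, Nat.cast_sub hNR]; congr 1; field_simp; ring
  have : ((R : ℝ)) ^ N ≤ 2 * ((R - N : ℕ) : ℝ) ^ N := by
    rw [h4]
    have : (0 : ℝ) < (R : ℝ) ^ N := by positivity
    nlinarith
  exact_mod_cast this

lemma transfer {n R : ℕ} (h : 2 * (n.choose 2) ^ 2 ≤ R) (hR : 0 < R) (Bd : SimpleGraph (Fin n) → Prop) :
    (Nat.card {σ : Ord n // ∃ m, m < n.choose 2 ∧ Bd (processGraph σ m)} : ℝ) / (Nat.card (Ord n) : ℝ) ≤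
      2 * Pr {ω : Sym2 (Fin n) → Fin R | ∃ t, t ≤ R ∧ Bd (gr ω t)} := by
  set N := n.choose 2 with hN
  set B := {σ : Ord n // ∃ m, m < n.choose 2 ∧ Bd (processGraph σ m)} with hB
  set A := {ω : Sym2 (Fin n) → Fin R | ∃ t, t ≤ R ∧ Bd (gr ω t)} with hA
  let f : B × {S : Finset (Fin R) // S.card = n.choose 2} × ({e : Sym2 (Fin n) // e.IsDiag} → Fin R) → A :=
    fun x => ⟨lev x.1.1 x.2.1 x.2.2, by
      obtain ⟨m, hm, h⟩ := x.1.2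
      refine ⟨(x.2.1.1.orderEmbOfFin x.2.1.2 ⟨m, hm⟩ : Fin R), (Fin.isLt _).le, ?_⟩
      rw [gr_lev]; exact h⟩
  have hf : Function.Injective f := by
    rintro ⟨⟨σ, hσ⟩, S, d⟩ ⟨⟨σ', hσ'⟩, S', d'⟩ h
    obtain ⟨h1, h2, h3⟩ := lev_inj (congrArg Subtype.val h)
    simp only at h1 h2 h3
    subst h1 h2 h3
    rfl
  have h1 := Nat.card_le_card_of_injective f hf
  have cS : Nat.card {S : Finset (Fin R) // S.card = n.choose 2} = R.choose N := by
    have := Finset.card_powersetCard N (univ : Finset (Fin R))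
    rw [Finset.card_univ, Fintype.card_fin] at this
    rw [← this, Nat.card_eq_fintype_card, Fintype.card_subtype]
    congr 1
    ext S; simp [Finset.mem_powersetCard, hN]
  set D := Fintype.card {e : Sym2 (Fin n) // e.IsDiag} with hD
  have cND : Fintype.card (NDg n) = N := by
    rw [Sym2.card_subtype_not_diag, Fintype.card_fin]
  have cE : Fintype.card (Sym2 (Fin n)) = N + D := by
    rw [← cND, hD, add_comm]
    exact (Fintype.card_congr (Equiv.sumCompl (fun e : Sym2 (Fin n) => e.IsDiag))).symm.trans
      Fintype.card_sum
  have cO : Nat.card (Ord n) = N.factorial := by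
    rw [Nat.card_eq_fintype_card, Fintype.card_equiv (Fintype.equivFinOfCardEq cND).symm,
      Fintype.card_fin]
  rw [Nat.card_prod, Nat.card_prod, cS, Nat.card_fun, Nat.card_eq_fintype_card (α := Fin R),
    Fintype.card_fin, Nat.card_eq_fintype_card (α := {e : Sym2 (Fin n) // e.IsDiag}), ← hD] at h1
  have h2 := desc_bound h
  rw [Nat.descFactorial_eq_factorial_mul_choose] at h2
  rw [Pr_eq_card, cE, cO, pow_add]
  have hR' : (0 : ℝ) < R := by exact_mod_cast hR
  have h1' : (Nat.card B : ℝ) * ((R.choose N : ℝ) * (R : ℝ) ^ D) ≤ Nat.card A := by exact_mod_cast h1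
  have h2' : (R : ℝ) ^ N ≤ 2 * (N.factorial * (R.choose N : ℝ)) := by exact_mod_cast h2
  have hF : (0 : ℝ) < N.factorial := by positivity
  rw [div_le_iff₀ hF, ← mul_div_assoc, div_mul_eq_mul_div, le_div_iff₀ (by positivity)]
  have hb : (0 : ℝ) ≤ Nat.card B := by positivity
  have hRD : (0 : ℝ) ≤ (R : ℝ) ^ D := by positivity
  calc (Nat.card B : ℝ) * ((R : ℝ) ^ N * (R : ℝ) ^ D)
      ≤ (Nat.card B : ℝ) * ((2 * (N.factorial * (R.choose N : ℝ))) * (R : ℝ) ^ D) := by gcongr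
    _ = 2 * N.factorial * ((Nat.card B : ℝ) * ((R.choose N : ℝ) * (R : ℝ) ^ D)) := by ring
    _ ≤ 2 * N.factorial * Nat.card A := by gcongr
    _ = _ := by ring
end RacgFib

namespace RacgFib
open Classical Finset Filter

lemma Pr_block {E : Type*} [Fintype E] {R : ℕ} {ι : Type*} (hR : 0 < R) (A : Set (E → Fin R))
    (I : Finset ι) (T : ι → Finset E)
    (hT : ∀ i ∈ I, ∀ j ∈ I, i ≠ j → Disjoint (T i) (T j)) (w : E → Fin R → Prop) (δ : ℝ) (s : ℕ)
    (hδ0 : 0 ≤ δ) (hδ : ∀ i ∈ I, δ ≤ ∏ e ∈ T i, pr (w e))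
    (hA : ∀ ω ∈ A, ∀ J : Finset ι, J ⊆ I → (∀ i ∈ J, ∀ e ∈ T i, w e (ω e)) → J.card ≤ s) :
    Pr A ≤ Real.exp (s - δ * I.card / 2) := by
  set c : ℝ := 1 - Real.exp (-1) with hc
  have he1 : Real.exp (-1) < 1 / 2 := by
    rw [Real.exp_neg, inv_lt_comm₀ (Real.exp_pos _) (by norm_num)]
    have := Real.exp_one_gt_d9; norm_num; linarith
  have he0 := Real.exp_pos (-1)
  set u : E → Fin R → ℝ := fun e x => if w e x then 1 else 0 with hu
  have hpu : ∀ (ω : E → Fin R) i, (1 - c * ∏ e ∈ T i, u e (ω e)) =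
      if ∀ e ∈ T i, w e (ω e) then Real.exp (-1) else 1 := by
    intro ω i
    simp only [hu, Finset.prod_boole]
    split_ifs <;> simp [hc]
  have h1 : Pr A ≤ Ex (fun ω : E → Fin R => Real.exp s * ∏ i ∈ I, (1 - c * ∏ e ∈ T i, u e (ω e))) := by
    refine Pr_le_Ex (fun ω => mul_nonneg (Real.exp_pos _).le (Finset.prod_nonneg fun i _ => ?_)) ?_
    · rw [hpu]; split_ifs <;> positivity
    · intro ω hω
      simp only [hpu]
      rw [← Finset.prod_filter, Finset.prod_const, ← Real.exp_nat_mul, ← Real.exp_add,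
        Real.one_le_exp_iff]
      have : ((I.filter (fun i => ∀ e ∈ T i, w e (ω e))).card : ℝ) ≤ s := by
        exact_mod_cast hA ω hω _ (Finset.filter_subset _ _) (by simp)
      linarith
  refine h1.trans ?_
  rw [Ex_mul, Ex_block hR I T hT, sub_eq_add_neg, Real.exp_add]
  refine mul_le_mul_of_nonneg_left ?_ (Real.exp_pos _).le
  have hpr : ∀ e, (∑ x, u e x) / R = pr (w e) := by
    intro e; simp [hu, pr]
  simp only [hpr]
  have hle1 : ∀ e, pr (w e) ≤ 1 := by
    intro e
    unfold pr
    rw [div_le_one (by positivity)]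
    have := Finset.card_le_univ (univ.filter (w e))
    simp only [Fintype.card_fin] at this
    exact_mod_cast this
  calc ∏ i ∈ I, (1 - c * ∏ e ∈ T i, pr (w e)) ≤ ∏ i ∈ I, Real.exp (- (δ / 2)) := by
        refine Finset.prod_le_prod (fun i _ => ?_) fun i hi => ?_
        · have a1 : ∏ e ∈ T i, pr (w e) ≤ 1 :=
            Finset.prod_le_one (fun e _ => pr_nonneg _) (fun e _ => hle1 e)
          have a2 : 0 ≤ ∏ e ∈ T i, pr (w e) := Finset.prod_nonneg (fun e _ => pr_nonneg _)
          nlinarith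
        · have a3 := hδ i hi
          refine le_trans ?_ (Real.add_one_le_exp _)
          nlinarith
    _ = Real.exp (-(δ * I.card / 2)) := by
        rw [Finset.prod_const, ← Real.exp_nat_mul]; congr 1; ring

lemma ev_log (C : ℝ) (k : ℕ) {c : ℝ} (hc : 0 < c) :
    ∀ᶠ n : ℕ in atTop, C * (Real.log n) ^ k ≤ (n : ℝ) ^ c := by
  have h := (isLittleO_log_rpow_rpow_atTop (k : ℝ) hc).comp_tendsto tendsto_natCast_atTop_atTop
  have h2 := h.def (c := (|C| + 1)⁻¹) (by positivity)
  filter_upwards [h2] with n hn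
  have hL : 0 ≤ Real.log n := Real.log_natCast_nonneg n
  simp only [Function.comp, Real.rpow_natCast, Real.norm_eq_abs] at hn
  rw [abs_of_nonneg (pow_nonneg hL k), abs_of_nonneg (Real.rpow_nonneg (Nat.cast_nonneg n) c), inv_mul_eq_div,
    le_div_iff₀ (by positivity)] at hn
  have := le_abs_self C
  have : 0 ≤ (Real.log n) ^ k := by positivity
  nlinarith

lemma ev_const (C : ℝ) {c : ℝ} (hc : 0 < c) : ∀ᶠ n : ℕ in atTop, C ≤ (n : ℝ) ^ c := by
  filter_upwards [ev_log C 0 hc] with n hn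
  simpa using hn

lemma ev_L (C : ℝ) : ∀ᶠ n : ℕ in atTop, C ≤ Real.log n :=
  (Real.tendsto_log_atTop.comp tendsto_natCast_atTop_atTop).eventually_ge_atTop C

/-- `n ^ k * exp (-x) ≤ n ^ (-7)` once `x ≥ (k+7) log n` -/
lemma pow_exp_le {n k : ℕ} (hn : 0 < n) {x : ℝ} (h : (k + 7 : ℝ) * Real.log n ≤ x) :
    (n : ℝ) ^ k * Real.exp (-x) ≤ 1 / (n : ℝ) ^ 7 := by
  have hn' : (0 : ℝ) < n := by exact_mod_cast hn
  have h0 : (n : ℝ) ^ (k + 7) = Real.exp ((k + 7 : ℝ) * Real.log n) := by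
    rw [mul_comm, Real.exp_mul, Real.exp_log hn']; norm_cast
  rw [le_div_iff₀ (by positivity)]
  calc (n : ℝ) ^ k * Real.exp (-x) * (n : ℝ) ^ 7 = n ^ (k + 7) * Real.exp (-x) := by ring
    _ ≤ 1 := by
      rw [h0, ← Real.exp_add, Real.exp_le_one_iff]; linarith

def R3P {n : ℕ} (G : SimpleGraph (Fin n)) : Prop :=
  ∀ a b v, a ≠ b → v ≠ a → v ≠ b → ∃ x y, x ≠ y ∧ ¬ G.Adj x y ∧ G.Adj a x ∧ G.Adj b x ∧ G.Adj v x ∧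
    G.Adj a y ∧ G.Adj b y ∧ G.Adj v y

lemma r3_one {n R t : ℕ} (hR : 0 < R) (ht : t ≤ R) (hn : 3 ≤ n) (a b v : Fin n) (p : ℝ) (hp : p = t / R)
    :
    Pr {ω : Sym2 (Fin n) → Fin R | ¬ ∃ x y, x ≠ y ∧ ¬ (gr ω t).Adj x y ∧ (gr ω t).Adj a x ∧
      (gr ω t).Adj b x ∧ (gr ω t).Adj v x ∧ (gr ω t).Adj a y ∧ (gr ω t).Adj b y ∧ (gr ω t).Adj v y}
      ≤ Real.exp (- (p ^ 6 * (1 - p) * ((n - 3) / 2 : ℕ) / 2)) := by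
  have hR' : (0:ℝ) < R := by exact_mod_cast hR
  have hp0 : 0 ≤ p := by rw [hp]; positivity
  have hp1 : p ≤ 1 := by rw [hp, div_le_one hR']; exact_mod_cast ht
  set Q : Finset (Fin n) := {a, b, v} with hQ
  have hW : n - 3 ≤ (univ \ Q).card := by
    have h1 := Finset.le_card_sdiff Q (univ : Finset (Fin n))
    have h2 : Q.card ≤ 3 := Finset.card_le_three
    rw [Finset.card_univ, Fintype.card_fin] at h1
    omega
  obtain ⟨g, hg⟩ : ∃ g : Fin (n - 3) → Fin n, Function.Injective g ∧ ∀ i, g i ∉ Q := by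
    obtain ⟨W, hWs, hWc⟩ := Finset.exists_subset_card_eq hW
    refine ⟨fun i => W.orderEmbOfFin hWc i, (W.orderEmbOfFin hWc).injective, fun i => ?_⟩
    exact (Finset.mem_sdiff.1 (hWs (W.orderEmbOfFin_mem hWc i))).2
  set k := (n - 3) / 2 with hk
  set x : Fin k → Fin n := fun i => g ⟨2 * i, by omega⟩ with hx
  set y : Fin k → Fin n := fun i => g ⟨2 * i + 1, by omega⟩ with hy
  have hxy : ∀ i j, x i ≠ y j := by
    intro i j h; have := congrArg Fin.val (hg.1 h); simp only at this; omega
  have hxx : ∀ i j, x i = x j → i = j := by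
    intro i j h; have := congrArg Fin.val (hg.1 h); simp only at this; omega
  have hyy : ∀ i j, y i = y j → i = j := by
    intro i j h; have := congrArg Fin.val (hg.1 h); simp only at this; omega
  set T : Fin k → Finset (Sym2 (Fin n)) := fun i =>
    insert s(x i, y i) ((Q ×ˢ {x i, y i}).image (fun q => s(q.1, q.2))) with hT
  have hTm : ∀ i e, e ∈ T i → (x i ∈ e ∨ y i ∈ e) ∧ ∀ z ∈ e, z = x i ∨ z = y i ∨ z ∈ Q := by
    intro i e he
    simp only [hT, Finset.mem_insert, Finset.mem_image, Finset.mem_product,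
      Finset.mem_singleton] at he
    rcases he with rfl | ⟨⟨q, z⟩, ⟨h1, h2⟩, rfl⟩
    · refine ⟨by simp, fun z hz => ?_⟩
      rcases Sym2.mem_iff.1 hz with h | h <;> simp [h]
    · refine ⟨by rcases h2 with h | h <;> simp only at h <;> simp [h], fun z' hz => ?_⟩
      rcases Sym2.mem_iff.1 hz with h | h
      · subst h; exact Or.inr (Or.inr h1)
      · subst h; simp only at h2; tauto
  set w : Sym2 (Fin n) → Fin R → Prop := fun e l => if ∃ q ∈ Q, q ∈ e then (l : ℕ) < t else ¬ (l : ℕ) < t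
  have hno : ∀ i, ¬ ∃ q ∈ Q, q ∈ s(x i, y i) := by
    rintro i ⟨q, hq, hm⟩
    rcases Sym2.mem_iff.1 hm with h | h
    · exact hg.2 _ (by rw [h] at hq; exact hq)
    · exact hg.2 _ (by rw [h] at hq; exact hq)
  have main := Pr_block hR {ω : Sym2 (Fin n) → Fin R | ¬ ∃ x y, x ≠ y ∧ ¬ (gr ω t).Adj x y ∧ (gr ω t).Adj a x ∧
      (gr ω t).Adj b x ∧ (gr ω t).Adj v x ∧ (gr ω t).Adj a y ∧ (gr ω t).Adj b y ∧ (gr ω t).Adj v y}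
      univ T ?_ w (p ^ 6 * (1 - p)) 0 (by nlinarith [pow_nonneg hp0 6]) ?_ ?_
  · refine main.trans (le_of_eq ?_)
    simp
  · intro i _ j _ hij
    refine Finset.disjoint_left.2 fun e h1 h2 => ?_
    have m1 := hTm i e h1
    have m2 := hTm j e h2
    rcases m1.1 with h | h
    · rcases m2.2 _ h with h | h | h
      · exact hij (hxx _ _ h)
      · exact hxy _ _ h
      · exact hg.2 _ h
    · rcases m2.2 _ h with h | h | h
      · exact hxy _ _ h.symm
      · exact hij (hyy _ _ h)
      · exact hg.2 _ h
  · intro i _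
    have hnm : s(x i, y i) ∉ (Q ×ˢ {x i, y i}).image (fun q => s(q.1, q.2)) := by
      intro hm
      obtain ⟨⟨q, z⟩, h1, h2⟩ := Finset.mem_image.1 hm
      exact hno i ⟨q, (Finset.mem_product.1 h1).1, by rw [← h2]; simp⟩
    rw [hT, Finset.prod_insert hnm, mul_comm]
    have e1 : pr (w s(x i, y i)) = 1 - p := by
      have : w s(x i, y i) = fun l : Fin R => ¬ (l : ℕ) < t := by
        ext l; simp only [w, if_neg (hno i)]
      rw [this, pr_ge hR ht, hp]
    rw [e1]
    refine mul_le_mul_of_nonneg_left ?_ (by linarith)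
    have e2 : ∀ e ∈ (Q ×ˢ {x i, y i}).image (fun q => s(q.1, q.2)), pr (w e) = p := by
      intro e he
      obtain ⟨⟨q, z⟩, h1, rfl⟩ := Finset.mem_image.1 he
      have : w s(q, z) = fun l : Fin R => (l : ℕ) < t := by
        ext l
        have : ∃ q' ∈ Q, q' ∈ s(q, z) := ⟨q, (Finset.mem_product.1 h1).1, by simp⟩
        simp only [w, if_pos this]
      rw [this, pr_lt ht, hp]
    rw [Finset.prod_congr rfl e2, Finset.prod_const]
    refine pow_le_pow_of_le_one hp0 hp1 (Finset.card_image_le.trans ?_)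
    rw [Finset.card_product]
    exact Nat.mul_le_mul Finset.card_le_three Finset.card_le_two
  · intro ω hω J _ hJ
    rw [Nat.le_zero, Finset.card_eq_zero, Finset.eq_empty_iff_forall_notMem]
    intro i hi
    have hall := hJ i hi
    refine hω ⟨x i, y i, hxy i i, ?_, ?_⟩
    · intro h
      have := hall s(x i, y i) (Finset.mem_insert_self _ _)
      simp only [w, if_neg (hno i)] at this
      exact this h.2
    · have : ∀ q ∈ Q, ∀ z, z = x i ∨ z = y i → (gr ω t).Adj q z := by
        intro q hq z hz
        refine ⟨?_, ?_⟩
        · rintro rfl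
          rcases hz with h | h <;> rw [h] at hq <;> exact hg.2 _ hq
        · have := hall s(q, z) (Finset.mem_insert_of_mem (Finset.mem_image.2 ⟨(q, z),
            Finset.mem_product.2 ⟨hq, by simpa using hz⟩, rfl⟩))
          have h2 : ∃ q' ∈ Q, q' ∈ s(q, z) := ⟨q, hq, by simp⟩
          simp only [w, if_pos h2] at this
          exact this
      have ha : a ∈ Q := by simp [hQ]
      have hb : b ∈ Q := by simp [hQ]
      have hv : v ∈ Q := by simp [hQ]
      exact ⟨this a ha _ (Or.inl rfl), this b hb _ (Or.inl rfl), this v hv _ (Or.inl rfl),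
        this a ha _ (Or.inr rfl), this b hb _ (Or.inr rfl), this v hv _ (Or.inr rfl)⟩

lemma r3_prob : ∀ᶠ n : ℕ in atTop, ∀ R t : ℕ, 0 < R → t ≤ R →
    (n : ℝ) ^ (-(1/9) : ℝ) ≤ (t : ℝ) / R → (t : ℝ) / R ≤ 1 - (n : ℝ) ^ (-(1/4) : ℝ) →
    Pr {ω : Sym2 (Fin n) → Fin R | ¬ R3P (gr ω t)} ≤ 1 / (n : ℝ) ^ 7 := by
  filter_upwards [ev_log 5120 1 (c := 1/3) (by norm_num), eventually_ge_atTop 9,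
    ev_const 64 (c := 5/12) (by norm_num)] with n hn hn9 hc R t hR ht h1 h2
  have hn0 : (0 : ℝ) < n := by positivity
  set p : ℝ := t / R with hp
  have hpos : (0:ℝ) ≤ p := by positivity
  have hq : (n : ℝ) ^ (-(2/3) : ℝ) / 64 ≤ p ^ 6 * (1 - p) := by
    have q4 : (0:ℝ) < (n : ℝ) ^ (-(1/4) : ℝ) := by positivity
    rcases le_or_gt p (1/2) with h | h
    · have : ((n : ℝ) ^ (-(1/9) : ℝ)) ^ 6 ≤ p ^ 6 := by gcongr
      rw [← Real.rpow_natCast, ← Real.rpow_mul hn0.le] at this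
      norm_num at this ⊢
      have h3 : (0:ℝ) < (n : ℝ) ^ (-(2/3) : ℝ) := by positivity
      nlinarith
    · have a1 : (1/2 : ℝ) ^ 6 ≤ p ^ 6 := by gcongr
      have a2 : (n : ℝ) ^ (-(2/3) : ℝ) ≤ (n : ℝ) ^ (-(1/4) : ℝ) :=
        Real.rpow_le_rpow_of_exponent_le (by exact_mod_cast (by omega : 1 ≤ n)) (by norm_num)
      have a3 : (1/2 : ℝ) ^ 6 * (1 - p) ≤ p ^ 6 * (1 - p) := by gcongr; linarith
      linarith
  refine Pr_union_bound (univ : Finset (Fin n × Fin n × Fin n)) (fun q => {ω | ¬ ∃ x y, x ≠ y ∧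
      ¬ (gr ω t).Adj x y ∧ (gr ω t).Adj q.1 x ∧ (gr ω t).Adj q.2.1 x ∧ (gr ω t).Adj q.2.2 x ∧
      (gr ω t).Adj q.1 y ∧ (gr ω t).Adj q.2.1 y ∧ (gr ω t).Adj q.2.2 y}) ?_
    (fun q _ => r3_one hR ht (by omega) q.1 q.2.1 q.2.2 p hp) ?_
  · intro ω hω
    by_contra hcon
    apply hω
    intro a b v _ _ _
    by_contra h
    exact hcon ⟨(a, b, v), mem_univ _, h⟩
  · have hcard : ((univ : Finset (Fin n × Fin n × Fin n)).card : ℝ) = (n : ℝ) ^ 3 := by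
      rw [card_univ]; simp; ring
    rw [hcard]
    refine pow_exp_le (by omega) ?_
    have hk : (n : ℝ) / 4 ≤ ((n - 3) / 2 : ℕ) := by
      have : n ≤ 4 * ((n - 3) / 2) := by omega
      have : (n : ℝ) ≤ 4 * ((n - 3) / 2 : ℕ) := by exact_mod_cast this
      linarith
    have e1 : (n : ℝ) ^ (-(2/3) : ℝ) * n = (n : ℝ) ^ (1/3 : ℝ) := by
      nth_rewrite 2 [← Real.rpow_one (n : ℝ)]
      rw [← Real.rpow_add hn0]; norm_num
    have h3 : (n : ℝ) ^ (-(2/3) : ℝ) / 64 * (n / 4) ≤ p ^ 6 * (1 - p) * ((n - 3) / 2 : ℕ) := by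
      gcongr
      exact le_trans (by positivity) hq
    push_cast
    rw [pow_one] at hn
    linarith
end RacgFib

namespace RacgFib
open Classical Finset Filter

section r4
variable {n R t5 t6 : ℕ} {x : ℝ}

lemma gr_not {ω : Sym2 (Fin n) → Fin R} {t : ℕ} {u v : Fin n} (huv : u ≠ v) (h : ¬ (gr ω t).Adj u v) :
    ¬ (ω s(u, v) : ℕ) < t := fun h1 => h ⟨huv, h1⟩

lemma r4_h1 (hR : 0 < R) (h6 : t6 ≤ R) (hx : 1 ≤ x) (hn : (n : ℝ) = x ^ 16)
    (hq : 1 - (t6 : ℝ) / R ≤ 2 / x ^ 31) :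
    Pr {ω : Sym2 (Fin n) → Fin R | ¬ ∀ u v w, u ≠ v → u ≠ w → v ≠ w →
      (gr ω t6).Adj u v ∨ (gr ω t6).Adj u w} ≤ 4 / x := by
  have hq0 : 0 ≤ 1 - (t6 : ℝ) / R := by rw [← pr_ge hR h6]; exact pr_nonneg _
  refine Pr_union_bound (univ.filter (fun q : Fin n × Fin n × Fin n => q.1 ≠ q.2.1 ∧ q.1 ≠ q.2.2 ∧ q.2.1 ≠ q.2.2))
    (fun q => {ω | ¬ (gr ω t6).Adj q.1 q.2.1 ∧ ¬ (gr ω t6).Adj q.1 q.2.2}) ?_ (b := (2 / x ^ 31) ^ 2) ?_ ?_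
  · intro ω hω
    by_contra hcon
    refine hω fun u v w h1 h2 h3 => ?_
    by_contra h
    rw [not_or] at h
    exact hcon ⟨(u, v, w), by simp [h1, h2, h3], h⟩
  · rintro ⟨u, v, w⟩ hq'
    simp only [mem_filter, mem_univ, true_and] at hq'
    obtain ⟨h1, h2, h3⟩ := hq'
    have h4 : s(u, v) ≠ s(u, w) := by simp [h3, h1, h2]
    have := Pr_absent hR {ω : Sym2 (Fin n) → Fin R | ¬ (gr ω t6).Adj u v ∧ ¬ (gr ω t6).Adj u w}
      {s(u, v), s(u, w)} ∅ (by simp) (fun l => ¬ (l : ℕ) < t6) (fun l => False)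
      (by
        intro ω hω e he
        simp only [mem_insert, mem_singleton] at he
        rcases he with rfl | rfl
        exacts [gr_not h1 hω.1, gr_not h2 hω.2]) (by simp)
    rw [pr_ge hR h6, card_pair h4, card_empty, pow_zero, mul_one] at this
    exact this.trans (by gcongr)
  · have hc : ((univ.filter (fun q : Fin n × Fin n × Fin n => q.1 ≠ q.2.1 ∧ q.1 ≠ q.2.2 ∧ q.2.1 ≠ q.2.2)).card : ℝ)
        ≤ (x ^ 16) ^ 3 := by
      rw [← hn]
      refine (Nat.cast_le.2 (card_le_univ _)).trans (le_of_eq ?_)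
      simp; ring
    refine (mul_le_mul_of_nonneg_right hc (by positivity)).trans ?_
    have h14 : x ≤ x ^ 14 := le_self_pow₀ hx (by norm_num)
    calc (x ^ 16) ^ 3 * (2 / x ^ 31) ^ 2 = 4 / x ^ 14 := by field_simp; norm_num
      _ ≤ 4 / x := by gcongr

lemma r4_h2 (hR : 0 < R) (h5 : t5 ≤ R) (h6 : t6 ≤ R) (hx : 1 ≤ x) (hn : (n : ℝ) = x ^ 16)
    (hq : 1 - (t6 : ℝ) / R ≤ 2 / x ^ 31) (hq5 : 1 - (t5 : ℝ) / R ≤ 2 / x ^ 4) :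
    Pr {ω : Sym2 (Fin n) → Fin R | ¬ ∀ a b c d, a ≠ b → a ≠ c → a ≠ d → b ≠ c → b ≠ d → c ≠ d →
      ¬ (gr ω t6).Adj a b → ¬ (gr ω t6).Adj c d → (gr ω t5).Adj a c} ≤ 8 / x := by
  have hq0 : 0 ≤ 1 - (t6 : ℝ) / R := by rw [← pr_ge hR h6]; exact pr_nonneg _
  have hq50 : 0 ≤ 1 - (t5 : ℝ) / R := by rw [← pr_ge hR h5]; exact pr_nonneg _
  set S := (univ.filter (fun q : (Fin n × Fin n) × Fin n × Fin n => q.1.1 ≠ q.1.2 ∧ q.1.1 ≠ q.2.1 ∧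
      q.1.1 ≠ q.2.2 ∧ q.1.2 ≠ q.2.1 ∧ q.1.2 ≠ q.2.2 ∧ q.2.1 ≠ q.2.2))
  refine Pr_union_bound S
    (fun q => {ω | ¬ (gr ω t6).Adj q.1.1 q.1.2 ∧ ¬ (gr ω t6).Adj q.2.1 q.2.2 ∧ ¬ (gr ω t5).Adj q.1.1 q.2.1})
    ?_ (b := (2 / x ^ 31) ^ 2 * (2 / x ^ 4)) ?_ ?_
  · intro ω hω
    by_contra hcon
    refine hω fun a b c d h1 h2 h3 h4 h5 h6 h7 h8 => ?_
    by_contra h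
    exact hcon ⟨((a, b), (c, d)), by simp [S, h1, h2, h3, h4, h5, h6], h7, h8, h⟩
  · rintro ⟨⟨a, b⟩, c, d⟩ hq'
    simp only [S, mem_filter, mem_univ, true_and] at hq'
    obtain ⟨h1, h2, h3, h4, h5', h6'⟩ := hq'
    have e1 : s(a, b) ≠ s(c, d) := by simp [h2, h3]
    have e2 : s(a, c) ≠ s(a, b) := by simp [h4.symm, h1]
    have e3 : s(a, c) ≠ s(c, d) := by simp [h2, h3]
    have := Pr_absent hR {ω : Sym2 (Fin n) → Fin R | ¬ (gr ω t6).Adj a b ∧ ¬ (gr ω t6).Adj c d ∧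
        ¬ (gr ω t5).Adj a c}
      {s(a, b), s(c, d)} {s(a, c)} (by simp [e2, e3, h1, h2, h3, h4, h5', h6']) (fun l => ¬ (l : ℕ) < t6) (fun l => (l : ℕ) < t5)
      (by
        intro ω hω e he
        simp only [mem_insert, mem_singleton] at he
        rcases he with rfl | rfl
        exacts [gr_not h1 hω.1, gr_not h6' hω.2.1]) (by
        intro ω hω e he
        rw [mem_singleton] at he; subst he
        exact gr_not h2 hω.2.2)
    rw [pr_ge hR h6, pr_lt h5, card_pair e1, card_singleton, pow_one] at this
    exact this.trans (by gcongr)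
  · have hc : (S.card : ℝ) ≤ (x ^ 16) ^ 4 := by
      rw [← hn]
      refine (Nat.cast_le.2 (card_le_univ _)).trans (le_of_eq ?_)
      simp; ring
    refine (mul_le_mul_of_nonneg_right hc (by positivity)).trans ?_
    have h14 : x ≤ x ^ 2 := le_self_pow₀ hx (by norm_num)
    calc (x ^ 16) ^ 4 * ((2 / x ^ 31) ^ 2 * (2 / x ^ 4)) = 8 / x ^ 2 := by field_simp; norm_num
      _ ≤ 8 / x := by gcongr

def R4c (v : Fin n) (a b : Fin 6 → Fin n) : Prop := ∀ i, v ≠ a i ∧ v ≠ b i ∧ a i ≠ b i ∧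
  ∀ j, i ≠ j → a i ≠ a j ∧ a i ≠ b j ∧ b i ≠ b j

lemma r4_h4 (hR : 0 < R) (h5 : t5 ≤ R) (h6 : t6 ≤ R) (hx : 1 ≤ x) (hn : (n : ℝ) = x ^ 16)
    (hq : 1 - (t6 : ℝ) / R ≤ 2 / x ^ 31) (hq5 : 1 - (t5 : ℝ) / R ≤ 2 / x ^ 4) :
    Pr {ω : Sym2 (Fin n) → Fin R | ¬ ∀ v, ∀ a b : Fin 6 → Fin n, (∀ i, v ≠ a i ∧ v ≠ b i ∧ a i ≠ b i ∧
      ¬ (gr ω t6).Adj (a i) (b i) ∧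
      ∀ j, i ≠ j → a i ≠ a j ∧ a i ≠ b j ∧ b i ≠ b j) → ∃ i, (gr ω t5).Adj v (a i)} ≤ 4096 / x := by
  have hq0 : 0 ≤ 1 - (t6 : ℝ) / R := by rw [← pr_ge hR h6]; exact pr_nonneg _
  have hq50 : 0 ≤ 1 - (t5 : ℝ) / R := by rw [← pr_ge hR h5]; exact pr_nonneg _
  set S := (univ.filter (fun q : Fin n × (Fin 6 → Fin n) × (Fin 6 → Fin n) => R4c q.1 q.2.1 q.2.2))
  refine Pr_union_bound S
    (fun q => {ω | ∀ i, ¬ (gr ω t6).Adj (q.2.1 i) (q.2.2 i) ∧ ¬ (gr ω t5).Adj q.1 (q.2.1 i)})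
    ?_ (b := (2 / x ^ 31) ^ 6 * (2 / x ^ 4) ^ 6) ?_ ?_
  · intro ω hω
    by_contra hcon
    refine hω fun v a b h => ?_
    by_contra h'
    push Not at h'
    refine hcon ⟨(v, a, b), ?_, fun i => ⟨(h i).2.2.2.1, h' i⟩⟩
    simp only [S, mem_filter, mem_univ, true_and]
    exact fun i => ⟨(h i).1, (h i).2.1, (h i).2.2.1, (h i).2.2.2.2⟩
  · rintro ⟨v, a, b⟩ hq'
    simp only [S, mem_filter, mem_univ, true_and] at hq'
    have i1 : Function.Injective (fun i => s(a i, b i)) := by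
      intro i j hij
      by_contra hne
      obtain ⟨-, -, -, h⟩ := hq' i
      have := h j hne
      simp [this.1, this.2.1] at hij
    have i2 : Function.Injective (fun i => s(v, a i)) := by
      intro i j hij
      by_contra hne
      obtain ⟨-, -, -, h⟩ := hq' i
      have := h j hne
      have h2 := hq' j
      simp [this.1, h2.1] at hij
    have := Pr_absent hR {ω : Sym2 (Fin n) → Fin R | ∀ i, ¬ (gr ω t6).Adj (a i) (b i) ∧ ¬ (gr ω t5).Adj v (a i)}
      (univ.image (fun i => s(a i, b i))) (univ.image (fun i => s(v, a i))) (by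
        refine disjoint_left.2 fun e he he' => ?_
        obtain ⟨i, -, rfl⟩ := mem_image.1 he
        obtain ⟨j, -, hj⟩ := mem_image.1 he'
        obtain ⟨h1, h2, -⟩ := hq' i
        simp [h1, h2] at hj) (fun l => ¬ (l : ℕ) < t6) (fun l => (l : ℕ) < t5)
      (by
        intro ω hω e he
        obtain ⟨i, -, rfl⟩ := mem_image.1 he
        exact gr_not (hq' i).2.2.1 (hω i).1) (by
        intro ω hω e he
        obtain ⟨i, -, rfl⟩ := mem_image.1 he
        exact gr_not (hq' i).1 (hω i).2)
    rw [pr_ge hR h6, pr_lt h5, card_image_of_injective _ i1, card_image_of_injective _ i2] at this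
    simp only [card_univ, Fintype.card_fin] at this
    exact this.trans (by gcongr)
  · have hc : (S.card : ℝ) ≤ (x ^ 16) ^ 13 := by
      rw [← hn]
      refine (Nat.cast_le.2 (card_le_univ _)).trans (le_of_eq ?_)
      simp; ring
    refine (mul_le_mul_of_nonneg_right hc (by positivity)).trans ?_
    have h14 : x ≤ x ^ 2 := le_self_pow₀ hx (by norm_num)
    calc (x ^ 16) ^ 13 * ((2 / x ^ 31) ^ 6 * (2 / x ^ 4) ^ 6) = 4096 / x ^ 2 := by field_simp; norm_num
      _ ≤ 4096 / x := by gcongr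

lemma choose_ge (hn : 2 ≤ n) : (n : ℝ) ^ 2 / 4 ≤ (n.choose 2 : ℕ) := by
  rw [Nat.cast_choose_two]
  have : (2 : ℝ) ≤ n := by exact_mod_cast hn
  nlinarith

lemma card_nd : (univ.filter (fun e : Sym2 (Fin n) => ¬ e.IsDiag)).card = n.choose 2 := by
  have h := Sym2.card_subtype_not_diag (α := Fin n)
  rw [Fintype.card_fin, Fintype.card_subtype] at h
  convert h

lemma r4_h3 (hR : 0 < R) (h6 : t6 ≤ R) (hx : 1 ≤ x) (hn2 : 2 ≤ n) (hn : (n : ℝ) = x ^ 16)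
    (hq : 1 / x ^ 31 ≤ 1 - (t6 : ℝ) / R) :
    Pr {ω : Sym2 (Fin n) → Fin R | ¬ ∃ a b : Fin 6 → Fin n, ∀ i, a i ≠ b i ∧ ¬ (gr ω t6).Adj (a i) (b i) ∧
      ∀ j, i ≠ j → s(a i, b i) ≠ s(a j, b j)} ≤ 256 / x := by
  have hq0 : 0 ≤ 1 - (t6 : ℝ) / R := by rw [← pr_ge hR h6]; exact pr_nonneg _
  have := Pr_moment hR {ω : Sym2 (Fin n) → Fin R | ¬ ∃ a b : Fin 6 → Fin n, ∀ i, a i ≠ b i ∧ ¬ (gr ω t6).Adj (a i) (b i) ∧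
      ∀ j, i ≠ j → s(a i, b i) ≠ s(a j, b j)} ∅ (univ.filter (fun e => ¬ e.IsDiag)) (by simp)
      (fun _ => True) (fun l => ¬ (l : ℕ) < t6) ((1/2 : ℝ) ^ 5) (1/2) (by norm_num) (by norm_num) (by simp) (by
      intro ω hω J hJ
      refine pow_le_pow_of_le_one (by norm_num) (by norm_num) ?_
      by_contra hcon
      apply hω
      obtain ⟨J', hJ', hc⟩ := exists_subset_card_eq (show 6 ≤ J.card by omega)
      let g : Fin 6 ≃ J' := (Fintype.equivFinOfCardEq (by simpa using hc)).symm
      have : ∀ e : Sym2 (Fin n), ∃ q : Fin n × Fin n, s(q.1, q.2) = e := fun e =>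
        Sym2.ind (fun a b => ⟨(a, b), rfl⟩) e
      choose q hq using this
      refine ⟨fun i => (q (g i)).1, fun i => (q (g i)).2, fun i => ⟨?_, ?_, ?_⟩⟩
      · have h1 := ((hJ _).1 (hJ' (g i).2)).1
        rw [mem_filter] at h1
        intro h
        apply h1.2
        rw [← hq (g i)]
        simpa using h
      · intro h
        refine ((hJ _).1 (hJ' (g i).2)).2 ?_
        have := h.2
        rwa [hq] at this
      · intro j hij h
        simp only [hq] at h
        exact hij (g.injective (Subtype.ext h)))
  rw [card_empty, pow_zero, one_mul, pr_ge hR h6, card_nd] at this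
  refine this.trans ?_
  set p : ℝ := 1 - (t6 : ℝ) / R with hp
  have hp1 : p ≤ 1 := by have : (0:ℝ) ≤ (t6 : ℝ) / R := by positivity
                         linarith
  have h2 : (1 - p + p * (1 / 2)) ^ n.choose 2 ≤ Real.exp (-(x / 8)) := by
    have : (1 - p + p * (1 / 2)) ≤ Real.exp (-(p / 2)) := by
      have := Real.add_one_le_exp (-(p / 2)); linarith
    refine (pow_le_pow_left₀ (by linarith) this _).trans ?_
    rw [← Real.exp_nat_mul, Real.exp_le_exp]
    have h3 := choose_ge hn2
    have h4 : (x ^ 16) ^ 2 / 4 * (1 / x ^ 31) ≤ (n.choose 2 : ℕ) * p := by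
      rw [← hn]; gcongr
    have h5 : (x ^ 16) ^ 2 / 4 * (1 / x ^ 31) = x / 4 := by field_simp
    linarith
  have h3 : Real.exp (-(x / 8)) ≤ 8 / x := by
    rw [Real.exp_neg, inv_le_comm₀ (Real.exp_pos _) (by positivity), inv_div]
    have := Real.add_one_le_exp (x / 8); linarith
  calc ((1/2 : ℝ) ^ 5)⁻¹ * (1 - p + p * (1 / 2)) ^ n.choose 2 ≤ ((1/2 : ℝ) ^ 5)⁻¹ * (8 / x) := by
        gcongr; exact h2.trans h3
    _ = 256 / x := by ring
end r4
end RacgFib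

namespace RacgFib
open Classical Finset Filter

def MinDeg2 {n : ℕ} (G : SimpleGraph (Fin n)) : Prop := ∀ v, ∃ a b, a ≠ b ∧ G.Adj v a ∧ G.Adj v b

lemma exp_le_one_sub {p : ℝ} (hp : p < 1) : Real.exp (-(p / (1 - p))) ≤ 1 - p := by
  have h : 0 < 1 - p := by linarith
  have h1 := Real.one_sub_inv_le_log_of_pos h
  rw [← Real.le_log_iff_exp_le h]
  refine le_trans (le_of_eq ?_) h1
  field_simp; ring

lemma r1_one {n R t w : ℕ} (hR : 0 < R) (ht : t ≤ R) (hw : w ≤ n) (p : ℝ) (hp : p = t / R) :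
    Pr {ω : Sym2 (Fin n) → Fin R | MinDeg2 (gr ω t)} ≤
      Real.exp (-((1 - p) ^ n * w / 2)) + w ^ 3 * p ^ 2 := by
  have hR' : (0:ℝ) < R := by exact_mod_cast hR
  have hp0 : 0 ≤ p := by rw [hp]; positivity
  have hp1 : p ≤ 1 := by rw [hp, div_le_one hR']; exact_mod_cast ht
  obtain ⟨W, -, hWc⟩ := exists_subset_card_eq (s := (univ : Finset (Fin n))) (n := w) (by simpa using hw)
  refine (Pr_union_le (A := {ω | ∀ v ∈ W, ∃ u, u ∉ W ∧ (gr ω t).Adj v u})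
    (B := {ω | ∃ v ∈ W, ∃ a ∈ W, ∃ b ∈ W, a ≠ b ∧ (gr ω t).Adj v a ∧ (gr ω t).Adj v b}) ?_).trans
    (add_le_add ?_ ?_)
  · intro ω hω
    by_cases h : ∃ v ∈ W, ∃ a ∈ W, ∃ b ∈ W, a ≠ b ∧ (gr ω t).Adj v a ∧ (gr ω t).Adj v b
    · exact Or.inr h
    · left
      intro v hv
      obtain ⟨a, b, hab, ha, hb⟩ := hω v
      by_cases haW : a ∈ W
      · by_cases hbW : b ∈ W
        · exact absurd ⟨v, hv, a, haW, b, hbW, hab, ha, hb⟩ h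
        · exact ⟨b, hbW, hb⟩
      · exact ⟨a, haW, ha⟩
  · have := Pr_block hR {ω : Sym2 (Fin n) → Fin R | ∀ v ∈ W, ∃ u, u ∉ W ∧ (gr ω t).Adj v u} W
      (fun v => (univ \ W).image (fun u => s(v, u))) (by
        intro v hv v' hv' hne
        refine disjoint_left.2 fun e he he' => ?_
        obtain ⟨u, hu, rfl⟩ := mem_image.1 he
        obtain ⟨u', hu', h⟩ := mem_image.1 he'
        rcases Sym2.eq_iff.1 h with h | h
        · exact hne h.1.symm
        · exact (mem_sdiff.1 hu).2 (h.1 ▸ hv')) (fun _ l => ¬ (l : ℕ) < t) ((1 - p) ^ n) 0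
      (by have : 0 ≤ 1 - p := by linarith
          positivity) (by
        intro v _
        rw [prod_const, pr_ge hR ht, ← hp]
        refine pow_le_pow_of_le_one (by linarith) (by linarith) (card_image_le.trans ?_)
        exact (card_le_univ _).trans (by simp)) (by
        intro ω hω J hJ hall
        rw [Nat.le_zero, card_eq_zero, eq_empty_iff_forall_notMem]
        intro v hv
        obtain ⟨u, hu, hadj⟩ := hω v (hJ hv)
        exact hall v hv s(v, u) (mem_image.2 ⟨u, by simpa using hu, rfl⟩) hadj.2)
    rw [hWc, Nat.cast_zero, zero_sub] at this
    exact this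
  · refine Pr_union_bound ((W ×ˢ W ×ˢ W))
      (fun q => {ω | q.2.1 ≠ q.2.2 ∧ (gr ω t).Adj q.1 q.2.1 ∧ (gr ω t).Adj q.1 q.2.2}) ?_ (b := p ^ 2) ?_ ?_
    · rintro ω ⟨v, hv, a, ha, b, hb, h⟩
      exact ⟨(v, a, b), by simp [hv, ha, hb], h⟩
    · rintro ⟨v, a, b⟩ -
      by_cases hab : a = b
      · refine le_trans (le_of_eq ?_) (by positivity : (0:ℝ) ≤ p ^ 2)
        simp [hab, Pr, Ex]
      by_cases hav : v = a
      · refine le_trans (le_of_eq ?_) (by positivity : (0:ℝ) ≤ p ^ 2)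
        simp [hav, Pr, Ex]
      have h4 : s(v, a) ≠ s(v, b) := by simp [hab, Ne.symm hav]
      have := Pr_absent hR {ω : Sym2 (Fin n) → Fin R | a ≠ b ∧ (gr ω t).Adj v a ∧ (gr ω t).Adj v b}
        {s(v, a), s(v, b)} ∅ (by simp) (fun l => (l : ℕ) < t) (fun l => False)
        (by
          intro ω hω e he
          simp only [mem_insert, mem_singleton] at he
          rcases he with rfl | rfl
          exacts [hω.2.1.2, hω.2.2.2]) (by simp)
      rw [pr_lt ht, card_pair h4, card_empty, pow_zero, mul_one, ← hp] at this
      exact this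
    · rw [card_product, card_product, hWc]
      push_cast
      exact le_of_eq (by ring)

lemma r1_prob (ε : ℝ) (hε : 0 < ε) : ∀ᶠ n : ℕ in atTop, ∀ R t : ℕ, 0 < R → t ≤ R →
    (t : ℝ) / R ≤ 0.61 * Real.log n / n →
    Pr {ω : Sym2 (Fin n) → Fin R | MinDeg2 (gr ω t)} ≤ ε := by
  filter_upwards [ev_log 62 1 (c := 1) (by norm_num), eventually_ge_atTop 2,
    ev_const (8 / ε) (c := 0.03) (by norm_num), ev_log (2 / ε) 2 (c := 0.05) (by norm_num)] with
    n h1 hn2 h3 h4 R t hR ht hp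
  have hn0 : (0 : ℝ) < n := by positivity
  have hn1 : (1 : ℝ) ≤ n := by exact_mod_cast (by omega : 1 ≤ n)
  set L := Real.log n with hL
  have hL0 : 0 ≤ L := Real.log_natCast_nonneg n
  set p : ℝ := t / R with hpd
  have hp0 : 0 ≤ p := by positivity
  rw [Real.rpow_one, pow_one] at h1
  have hLn : L / n ≤ 1 / 62 := by rw [div_le_iff₀ hn0]; linarith
  have hp' : p ≤ 0.61 * (L / n) := by rw [← mul_div_assoc]; exact hp
  have hp1 : p ≤ 0.01 := by linarith
  set w := ⌊(n : ℝ) ^ (0.65 : ℝ)⌋₊ with hw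
  have hw1 : (w : ℝ) ≤ (n : ℝ) ^ (0.65 : ℝ) := Nat.floor_le (by positivity)
  have hn65 : (1 : ℝ) ≤ (n : ℝ) ^ (0.65 : ℝ) := Real.one_le_rpow hn1 (by norm_num)
  have hw2 : (n : ℝ) ^ (0.65 : ℝ) / 2 ≤ w := by
    have a1 := Nat.lt_floor_add_one ((n : ℝ) ^ (0.65 : ℝ))
    have a2 : 1 ≤ w := Nat.le_floor (by simpa using hn65)
    have a3 : (1 : ℝ) ≤ w := by exact_mod_cast a2
    rw [← hw] at a1
    linarith
  have hwn : w ≤ n := by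
    have : (w : ℝ) ≤ n := hw1.trans (by
      conv_rhs => rw [← Real.rpow_one (n : ℝ)]
      exact Real.rpow_le_rpow_of_exponent_le hn1 (by norm_num))
    exact_mod_cast this
  refine (r1_one hR ht hwn p hpd).trans ?_
  have e1 : (n : ℝ) ^ (-0.62 : ℝ) ≤ (1 - p) ^ n := by
    have a1 := exp_le_one_sub (p := p) (by linarith)
    refine le_trans ?_ (pow_le_pow_left₀ (Real.exp_pos _).le a1 n)
    rw [← Real.exp_nat_mul, Real.rpow_def_of_pos hn0, Real.exp_le_exp]
    have a2 : p / (1 - p) ≤ 0.62 * (L / n) := by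
      rw [div_le_iff₀ (by linarith)]
      have : 0 ≤ L / n := by positivity
      nlinarith
    have a3 : (n : ℝ) * (p / (1 - p)) ≤ n * (0.62 * (L / n)) := by gcongr
    have a4 : n * (0.62 * (L / n)) = 0.62 * L := by field_simp
    rw [← hL]; linarith
  have e2 : (n : ℝ) ^ (0.03 : ℝ) / 4 ≤ (1 - p) ^ n * w / 2 := by
    have : (n : ℝ) ^ (-0.62 : ℝ) * ((n : ℝ) ^ (0.65 : ℝ) / 2) ≤ (1 - p) ^ n * w := by
      gcongr
      exact le_trans (by positivity) e1
    rw [← mul_div_assoc, ← Real.rpow_add hn0] at this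
    norm_num at this ⊢
    linarith
  have e3 : Real.exp (-((1 - p) ^ n * w / 2)) ≤ ε / 2 := by
    set y := (1 - p) ^ n * w / 2
    have hy : 2 / ε ≤ y := by
      have : 8 / ε / 4 ≤ y := le_trans (by gcongr) e2
      calc 2 / ε = 8 / ε / 4 := by ring
        _ ≤ y := this
    rw [Real.exp_neg, inv_le_comm₀ (Real.exp_pos _) (by positivity), inv_div]
    have := Real.add_one_le_exp y; linarith
  have e4 : (w : ℝ) ^ 3 * p ^ 2 ≤ ε / 2 := by
    have a1 : (w : ℝ) ^ 3 * p ^ 2 ≤ ((n : ℝ) ^ (0.65 : ℝ)) ^ 3 * (L / n) ^ 2 := by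
      gcongr
      have : 0 ≤ L / n := by positivity
      linarith
    refine a1.trans ?_
    have a2 : ((n : ℝ) ^ (0.65 : ℝ)) ^ 3 * (n : ℝ) ^ (0.05 : ℝ) = n ^ 2 := by
      rw [← Real.rpow_natCast, ← Real.rpow_mul hn0.le, ← Real.rpow_add hn0, ← Real.rpow_natCast]
      norm_num
    rw [div_pow, ← a2]
    have hA : (0:ℝ) < (n : ℝ) ^ (0.65 : ℝ) := by positivity
    have hB : (0:ℝ) < (n : ℝ) ^ (0.05 : ℝ) := by positivity
    calc ((n : ℝ) ^ (0.65 : ℝ)) ^ 3 * (L ^ 2 / (((n : ℝ) ^ (0.65 : ℝ)) ^ 3 * (n : ℝ) ^ (0.05 : ℝ)))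
        = L ^ 2 / (n : ℝ) ^ (0.05 : ℝ) := by field_simp
      _ ≤ ε / 2 := by
        rw [div_le_iff₀ hB]
        have : 2 / ε * L ^ 2 * (ε / 2) ≤ (n : ℝ) ^ (0.05 : ℝ) * (ε / 2) := by gcongr
        have h5 : 2 / ε * L ^ 2 * (ε / 2) = L ^ 2 := by field_simp
        linarith
  linarith
end RacgFib

namespace RacgFib
open Classical Finset Filter

section edg
variable {n : ℕ}
def edg (A B : Finset (Fin n)) : Finset (Sym2 (Fin n)) := (A ×ˢ B).image (fun q => s(q.1, q.2))

lemma mem_edg {A B : Finset (Fin n)} {e} : e ∈ edg A B ↔ ∃ a ∈ A, ∃ b ∈ B, s(a, b) = e := by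
  simp only [edg, mem_image, mem_product, Prod.exists]
  constructor
  · rintro ⟨a, b, ⟨h1, h2⟩, h⟩; exact ⟨a, h1, b, h2, h⟩
  · rintro ⟨a, h1, b, h2, h⟩; exact ⟨a, b, ⟨h1, h2⟩, h⟩

lemma card_edg {A B : Finset (Fin n)} (h : Disjoint A B) : (edg A B).card = A.card * B.card := by
  rw [edg, card_image_of_injOn, card_product]
  rintro ⟨a, b⟩ h1 ⟨c, d⟩ h2 h3
  simp only [coe_product, Set.mem_prod, mem_coe] at h1 h2
  rcases Sym2.eq_iff.1 h3 with ⟨h4, h5⟩ | ⟨h4, h5⟩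
  · simp only at h4 h5; rw [h4, h5]
  · simp only at h4 h5
    exact absurd (h4 ▸ h1.1) (fun h6 => disjoint_left.1 h h6 h2.2)

lemma not_adj_edg {R t : ℕ} {A B : Finset (Fin n)} {ω : Sym2 (Fin n) → Fin R} (h : Disjoint A B)
    (hA : ∀ a ∈ A, ∀ b ∈ B, ¬ (gr ω t).Adj a b) : ∀ e ∈ edg A B, ¬ (ω e : ℕ) < t := by
  intro e he
  obtain ⟨a, ha, b, hb, rfl⟩ := mem_edg.1 he
  exact gr_not (fun hab => disjoint_left.1 h ha (hab ▸ hb)) (hA a ha b hb)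
end edg

section s12
variable {n R t s M m : ℕ}

lemma s1_prob (hR : 0 < R) (ht : t ≤ R) (p : ℝ) (hp : p = t / R) {A U : Finset (Fin n)}
    (hA : A.card = s) (hd : Disjoint A U) :
    Pr {ω : Sym2 (Fin n) → Fin R | ¬ ∃ A1 ⊆ U, A1.card = s ∧ ∀ x ∈ A1, ∀ y ∈ A, ¬ (gr ω t).Adj x y} ≤
      Real.exp (s - (1 - p) ^ s * U.card / 2) := by
  have hp1 : 0 ≤ 1 - p := by rw [hp, ← pr_ge hR ht]; exact pr_nonneg _
  refine Pr_block hR _ U (fun u => edg {u} A) ?_ (fun _ l => ¬ (l : ℕ) < t) ((1 - p) ^ s) s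
    (by positivity) ?_ ?_
  · intro u hu u' hu' hne
    refine disjoint_left.2 fun e he he' => ?_
    obtain ⟨a, ha, b, hb, rfl⟩ := mem_edg.1 he
    obtain ⟨a', ha', b', hb', h⟩ := mem_edg.1 he'
    rw [mem_singleton] at ha ha'
    subst ha ha'
    rcases Sym2.eq_iff.1 h with h | h
    · exact hne h.1.symm
    · exact disjoint_left.1 hd hb (h.1 ▸ hu')
  · intro u hu
    rw [prod_const, pr_ge hR ht, ← hp, card_edg, card_singleton, one_mul, hA]
    rw [disjoint_singleton_left]
    exact fun h => disjoint_left.1 hd h hu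
  · intro ω hω J hJ hall
    by_contra hcon
    apply hω
    obtain ⟨J', hJ', hc⟩ := exists_subset_card_eq (show s ≤ J.card by omega)
    refine ⟨J', hJ'.trans hJ, hc, fun x hx y hy hadj => ?_⟩
    exact hall x (hJ' hx) s(x, y) (mem_edg.2 ⟨x, by simp, y, hy, rfl⟩) hadj.2

lemma s2_prob (hR : 0 < R) (ht : t ≤ R) (p : ℝ) (hp : p = t / R) {A B U U' : Finset (Fin n)}
    (hA : A.card = s) (hB : B.card = s) (hU : U.card = M) (hU' : U'.card = M)
    (h1 : Disjoint A U) (h2 : Disjoint B U') (h3 : Disjoint (A ∪ U) (B ∪ U')) :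
    Pr {ω : Sym2 (Fin n) → Fin R | ∃ A1 ⊆ U, ∃ B1 ⊆ U', A1.card = s ∧ B1.card = s ∧
      (∀ x ∈ A1, ∀ y ∈ A, ¬ (gr ω t).Adj x y) ∧ (∀ x ∈ B1, ∀ y ∈ B, ¬ (gr ω t).Adj x y) ∧
      ∃ l l' : Bool, ¬ NoHole (gr ω t) m (if l then A1 else A) (if l' then B1 else B)} ≤
      4 * (M.choose s : ℝ) ^ 2 * 4 ^ s * ((1 - p) ^ (2 * s ^ 2) * (1 - p) ^ (m ^ 2)) := by
  have hp1 : 0 ≤ 1 - p := by rw [hp, ← pr_ge hR ht]; exact pr_nonneg _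
  set b0 : ℝ := (1 - p) ^ (2 * s ^ 2) * (1 - p) ^ (m ^ 2) with hb0
  refine Pr_union_bound ((powersetCard s U ×ˢ powersetCard s U') ×ˢ (univ : Finset (Bool × Bool)))
    (fun q => {ω | (∀ x ∈ q.1.1, ∀ y ∈ A, ¬ (gr ω t).Adj x y) ∧ (∀ x ∈ q.1.2, ∀ y ∈ B, ¬ (gr ω t).Adj x y) ∧
      ¬ NoHole (gr ω t) m (if q.2.1 then q.1.1 else A) (if q.2.2 then q.1.2 else B)}) ?_ (b := 4 ^ s * b0) ?_ ?_
  · rintro ω ⟨A1, hA1, B1, hB1, c1, c2, n1, n2, l, l', hh⟩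
    exact ⟨((A1, B1), (l, l')), by simp [mem_powersetCard, hA1, hB1, c1, c2], n1, n2, hh⟩
  · rintro ⟨⟨A1, B1⟩, l, l'⟩ hq
    simp only [mem_product, mem_powersetCard, mem_univ, and_true] at hq
    obtain ⟨⟨hA1, cA1⟩, hB1, cB1⟩ := hq
    set P := if l then A1 else A with hP
    set Q := if l' then B1 else B with hQ
    have cP : P.card = s := by rw [hP]; split_ifs <;> assumption
    have cQ : Q.card = s := by rw [hQ]; split_ifs <;> assumption
    have hPs : P ⊆ A ∪ U := by
      rw [hP]; split_ifs
      exacts [hA1.trans subset_union_right, subset_union_left]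
    have hQs : Q ⊆ B ∪ U' := by
      rw [hQ]; split_ifs
      exacts [hB1.trans subset_union_right, subset_union_left]
    refine Pr_union_bound (powersetCard m P ×ˢ powersetCard m Q) (fun q => {ω |
      (∀ x ∈ A1, ∀ y ∈ A, ¬ (gr ω t).Adj x y) ∧ (∀ x ∈ B1, ∀ y ∈ B, ¬ (gr ω t).Adj x y) ∧
      (∀ x ∈ q.1, ∀ y ∈ q.2, ¬ (gr ω t).Adj x y)}) ?_ (b := b0) ?_ ?_
    · rintro ω ⟨n1, n2, hh⟩
      simp only [NoHole] at hh
      push Not at hh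
      obtain ⟨X, hX, Y, hY, c1, c2, h⟩ := hh
      exact ⟨(X, Y), by simp [mem_powersetCard, hX, hY, c1, c2, P, Q], n1, n2, h⟩
    · rintro ⟨X, Y⟩ hq
      simp only [mem_product, mem_powersetCard] at hq
      obtain ⟨⟨hX, cX⟩, hY, cY⟩ := hq
      have d1 : Disjoint A1 A := (h1.mono_right hA1).symm
      have d2 : Disjoint B1 B := (h2.mono_right hB1).symm
      have d3 : Disjoint X Y := h3.mono (hX.trans hPs) (hY.trans hQs)
      have hAB : ∀ v, v ∈ A ∪ U → v ∈ B ∪ U' → False := fun v k1 k2 => disjoint_left.1 h3 k1 k2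
      have e1 : Disjoint (edg A1 A) (edg B1 B) := by
        refine disjoint_left.2 fun e he he' => ?_
        obtain ⟨a, ha, b, hb, rfl⟩ := mem_edg.1 he
        obtain ⟨a', ha', b', hb', h⟩ := mem_edg.1 he'
        have k1 : a ∈ A ∪ U := mem_union_right _ (hA1 ha)
        have k2 : a' ∈ B ∪ U' := mem_union_right _ (hB1 ha')
        have k3 : b' ∈ B ∪ U' := mem_union_left _ hb'
        rcases Sym2.eq_iff.1 h with h | h
        · exact hAB a k1 (h.1 ▸ k2)
        · exact hAB a k1 (h.2 ▸ k3)
      have e2 : Disjoint (edg A1 A ∪ edg B1 B) (edg X Y) := by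
        refine disjoint_left.2 fun e he he' => ?_
        obtain ⟨a', ha', b', hb', h⟩ := mem_edg.1 he'
        have k1 : a' ∈ A ∪ U := hPs (hX ha')
        have k2 : b' ∈ B ∪ U' := hQs (hY hb')
        rcases mem_union.1 he with he | he
        · obtain ⟨a, ha, b, hb, rfl⟩ := mem_edg.1 he
          have k3 : a ∈ A ∪ U := mem_union_right _ (hA1 ha)
          have k4 : b ∈ A ∪ U := mem_union_left _ hb
          rcases Sym2.eq_iff.1 h with h | h
          · exact hAB b k4 (h.2 ▸ k2)
          · exact hAB a k3 (h.2 ▸ k2)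
        · obtain ⟨a, ha, b, hb, rfl⟩ := mem_edg.1 he
          have k3 : a ∈ B ∪ U' := mem_union_right _ (hB1 ha)
          have k4 : b ∈ B ∪ U' := mem_union_left _ hb
          rcases Sym2.eq_iff.1 h with h | h
          · exact hAB a (h.1 ▸ k1) k3
          · exact hAB b (h.1 ▸ k1) k4
      have := Pr_absent hR {ω : Sym2 (Fin n) → Fin R |
        (∀ x ∈ A1, ∀ y ∈ A, ¬ (gr ω t).Adj x y) ∧ (∀ x ∈ B1, ∀ y ∈ B, ¬ (gr ω t).Adj x y) ∧
        (∀ x ∈ X, ∀ y ∈ Y, ¬ (gr ω t).Adj x y)} ∅ ((edg A1 A ∪ edg B1 B) ∪ edg X Y) (by simp)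
        (fun _ => True) (fun l => (l : ℕ) < t) (by simp) (by
          rintro ω ⟨n1, n2, n3⟩ e he
          rcases mem_union.1 he with he | he
          · rcases mem_union.1 he with he | he
            · exact not_adj_edg d1 n1 e he
            · exact not_adj_edg d2 n2 e he
          · exact not_adj_edg d3 n3 e he)
      rw [card_empty, pow_zero, one_mul, pr_lt ht, card_union_of_disjoint e2, card_union_of_disjoint e1,
        card_edg d1, card_edg d2, card_edg d3, cA1, cB1, hA, hB, cX, cY, pow_add, ← hp] at this
      refine this.trans (le_of_eq ?_)
      rw [hb0, sq m]
      congr 2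
      ring
    · rw [card_product, card_powersetCard, card_powersetCard, cP, cQ]
      have : (s.choose m : ℝ) ≤ 2 ^ s := by exact_mod_cast Nat.choose_le_two_pow s m
      push_cast
      refine mul_le_mul_of_nonneg_right ?_ (by positivity)
      calc (s.choose m : ℝ) * s.choose m ≤ 2 ^ s * 2 ^ s := by gcongr
        _ = 4 ^ s := by rw [← mul_pow]; norm_num
  · rw [card_product, card_product, card_powersetCard, card_powersetCard, hU, hU', card_univ]
    simp only [Fintype.card_prod, Fintype.card_bool]
    push_cast
    exact le_of_eq (by ring)

/-- the four sets -/
def FourP (G : SimpleGraph (Fin n)) (s m : ℕ) : Prop :=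
  ∃ P : Bool → Bool → Finset (Fin n), (∀ c l, (P c l).card = s) ∧
    (∀ c l c' l' v, v ∈ P c l → v ∈ P c' l' → c = c' ∧ l = l') ∧
    (∀ c l l', NoHole G m (P c l) (P (!c) l')) ∧ (∀ c, ∀ x ∈ P c true, ∀ y ∈ P c false, ¬ G.Adj x y)

lemma s12_prob (hR : 0 < R) (ht : t ≤ R) (p : ℝ) (hp : p = t / R) (hn : 2 * s + 2 * M ≤ n) :
    Pr {ω : Sym2 (Fin n) → Fin R | ¬ FourP (gr ω t) s m} ≤
      2 * Real.exp (s - (1 - p) ^ s * M / 2) +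
      4 * (M.choose s : ℝ) ^ 2 * 4 ^ s * ((1 - p) ^ (2 * s ^ 2) * (1 - p) ^ (m ^ 2)) := by
  obtain ⟨A, -, hA⟩ := exists_subset_card_eq (s := (univ : Finset (Fin n))) (n := s) (by simp; omega)
  obtain ⟨B, hBs, hB⟩ := exists_subset_card_eq (s := univ \ A) (n := s) (by
    rw [card_sdiff_of_subset (subset_univ _)]; simp; omega)
  obtain ⟨U, hUs, hU⟩ := exists_subset_card_eq (s := univ \ (A ∪ B)) (n := M) (by
    rw [card_sdiff_of_subset (subset_univ _)]
    have := card_union_le A B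
    simp; omega)
  obtain ⟨U', hUs', hU'⟩ := exists_subset_card_eq (s := univ \ (A ∪ B ∪ U)) (n := M) (by
    rw [card_sdiff_of_subset (subset_univ _)]
    have := card_union_le A B
    have := card_union_le (A ∪ B) U
    rw [card_univ, Fintype.card_fin]; omega)
  have q1 : ∀ v ∈ B, v ∉ A := fun v hv => by simpa using hBs hv
  have q2 : ∀ v ∈ U, v ∉ A ∧ v ∉ B := fun v hv => by simpa using hUs hv
  have q3 : ∀ v ∈ U', v ∉ A ∧ v ∉ B ∧ v ∉ U := fun v hv => by simpa using hUs' hv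
  have dAU : Disjoint A U := disjoint_left.2 fun v h1 h2 => (q2 v h2).1 h1
  have dBU : Disjoint B U' := disjoint_left.2 fun v h1 h2 => (q3 v h2).2.1 h1
  have dd : Disjoint (A ∪ U) (B ∪ U') := disjoint_left.2 fun v h1 h2 => by
    rw [mem_union] at h1 h2
    have := q1 v; have := q2 v; have := q3 v
    tauto
  have b1 := s1_prob hR ht p hp hA dAU
  have b2 := s1_prob hR ht p hp hB dBU
  have b3 := s2_prob (m := m) hR ht p hp hA hB hU hU' dAU dBU dd
  rw [hU] at b1
  rw [hU'] at b2
  rw [two_mul]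
  set S1 := {ω : Sym2 (Fin n) → Fin R | ¬ ∃ A1 ⊆ U, A1.card = s ∧ ∀ x ∈ A1, ∀ y ∈ A, ¬ (gr ω t).Adj x y} with hS1
  set S2 := {ω : Sym2 (Fin n) → Fin R | ¬ ∃ A1 ⊆ U', A1.card = s ∧ ∀ x ∈ A1, ∀ y ∈ B, ¬ (gr ω t).Adj x y} with hS2
  refine (Pr_union_le (A := S1 ∪ S2) ?_).trans
    (add_le_add ((Pr_union_le (A := S1) (B := S2) fun ω hω => hω).trans (add_le_add b1 b2)) b3)
  intro ω hω
  by_contra hcon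
  simp only [Set.mem_union, hS1, hS2, Set.mem_ofPred_eq] at hcon
  rw [not_or, not_or] at hcon
  obtain ⟨⟨c1, c2⟩, c3⟩ := hcon
  obtain ⟨A1, hA1, cA1, nA⟩ := not_not.1 c1
  obtain ⟨B1, hB1, cB1, nB⟩ := not_not.1 c2
  have hole : ∀ l l' : Bool, NoHole (gr ω t) m (if l then A1 else A) (if l' then B1 else B) := by
    intro l l'
    by_contra h
    exact c3 ⟨A1, hA1, B1, hB1, cA1, cB1, nA, nB, l, l', h⟩
  refine hω ⟨fun c l => if c then (if l then A1 else A) else (if l then B1 else B), ?_, ?_, ?_, ?_⟩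
  · intro c l; cases c <;> cases l <;> simp [hA, hB, cA1, cB1]
  · intro c l c' l' v h h'
    have k1 := q1 v
    have k2 := q2 v
    have k3 := q3 v
    have k4 := @hA1 v
    have k5 := @hB1 v
    cases c <;> cases l <;> cases c' <;> cases l' <;> simp at h h' ⊢ <;> grind
  · intro c l l'
    cases c
    · intro X hX Y hY c1 c2
      obtain ⟨y, hy, x, hx, h⟩ := hole l' l Y (by simpa using hY) X (by simpa using hX) c2 c1
      exact ⟨x, hx, y, hy, h.symm⟩
    · simpa using hole l l'
  · intro c; cases c
    · simpa using nB
    · simpa using nA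

lemma s3_prob (hR : 0 < R) (ht : t ≤ R) (p : ℝ) (hp : p = t / R) (x0 z1 : ℕ) :
    Pr {ω : Sym2 (Fin n) → Fin R | ¬ ∀ X Z : Finset (Fin n), X.card = x0 → Z.card = z1 → Disjoint X Z →
      ∃ x ∈ X, ∃ z ∈ Z, (gr ω t).Adj x z} ≤ 4 ^ n * (1 - p) ^ (x0 * z1) := by
  have hp1 : 0 ≤ 1 - p := by rw [hp, ← pr_ge hR ht]; exact pr_nonneg _
  refine Pr_union_bound (univ.filter (fun q : Finset (Fin n) × Finset (Fin n) => q.1.card = x0 ∧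
    q.2.card = z1 ∧ Disjoint q.1 q.2)) (fun q => {ω | ∀ x ∈ q.1, ∀ z ∈ q.2, ¬ (gr ω t).Adj x z}) ?_
    (b := (1 - p) ^ (x0 * z1)) ?_ ?_
  · intro ω hω
    by_contra hcon
    refine hω fun X Z h1 h2 h3 => ?_
    by_contra h
    push Not at h
    exact hcon ⟨(X, Z), by simp [h1, h2, h3], h⟩
  · rintro ⟨X, Z⟩ hq
    simp only [mem_filter, mem_univ, true_and] at hq
    obtain ⟨h1, h2, h3⟩ := hq
    have := Pr_absent hR {ω : Sym2 (Fin n) → Fin R | ∀ x ∈ X, ∀ z ∈ Z, ¬ (gr ω t).Adj x z} ∅ (edg X Z)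
      (by simp) (fun _ => True) (fun l => (l : ℕ) < t) (by simp) (fun ω hω => not_adj_edg h3 hω)
    rw [card_empty, pow_zero, one_mul, pr_lt ht, card_edg h3, h1, h2, ← hp] at this
    exact this
  · refine mul_le_mul_of_nonneg_right ((Nat.cast_le.2 (card_le_univ _)).trans (le_of_eq ?_)) (by positivity)
    simp
    rw [← mul_pow]; norm_num
end s12
end RacgFib

namespace RacgFib
open Classical Finset Filter

def ClosP {n : ℕ} (G : SimpleGraph (Fin n)) (z1 : ℕ) : Prop :=
  ∃ L : Set (Fin n), Fb (KL G L) ∧ Closed G L ∧ ∀ Z : Finset (Fin n), (∀ z ∈ Z, z ∉ L) → Z.card < 2 * z1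

lemma four_pow_le (k : ℕ) : (4 : ℝ) ^ k ≤ Real.exp (2 * k) := by
  have : (4 : ℝ) ≤ Real.exp 2 := by
    have := Real.exp_one_gt_d9
    have h2 : Real.exp 2 = Real.exp 1 * Real.exp 1 := by rw [← Real.exp_add]; norm_num
    nlinarith
  calc (4 : ℝ) ^ k ≤ Real.exp 2 ^ k := by gcongr
    _ = _ := by rw [← Real.exp_nat_mul]; congr 1; ring

set_option maxHeartbeats 2000000 in
lemma r2a_core {n R t : ℕ} (hR : 0 < R) (ht : t ≤ R) (p : ℝ) (hp : p = t / R) (hp0 : 0 < p) (hp2 : p ≤ 1 / 2)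
    (hn : 2001 * (11 * Real.exp 4002) ≤ p * n) :
    Pr {ω : Sym2 (Fin n) → Fin R | ¬ ClosP (gr ω t) (n / 100 + 1)} ≤
      6 * Real.exp (-(2000 / p)) + Real.exp (-n) := by
  set s : ℕ := ⌈2000 / p⌉₊ with hs
  have s1 : 2000 / p ≤ s := Nat.le_ceil _
  have s2 : (s : ℝ) < 2000 / p + 1 := Nat.ceil_lt_add_one (by positivity)
  have ps1 : 2000 ≤ p * s := by rw [div_le_iff₀ hp0] at s1; linarith
  have ps2 : p * s ≤ 2001 := by
    have : p * s ≤ p * (2000 / p + 1) := by gcongr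
    rw [mul_add, mul_div_cancel₀ _ hp0.ne'] at this; linarith
  have s3 : (4000 : ℝ) ≤ s := by nlinarith
  have s3' : 4000 ≤ s := by exact_mod_cast s3
  set q : ℝ := (1 - p) ^ s with hq
  have q0 : 0 < q := pow_pos (by linarith) _
  have q1 : q ≤ 1 := pow_le_one₀ (by linarith) (by linarith)
  have qK : 1 / q ≤ Real.exp 4002 := by
    rw [one_div, inv_le_comm₀ q0 (Real.exp_pos _), ← Real.exp_neg]
    calc Real.exp (-4002) ≤ Real.exp (-(2 * p)) ^ s := by
          rw [← Real.exp_nat_mul]; apply Real.exp_le_exp.2; nlinarith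
      _ ≤ q := by
          refine pow_le_pow_left₀ (Real.exp_pos _).le (le_trans (Real.exp_le_exp.2 ?_) (exp_le_one_sub (by linarith))) _
          rw [neg_le_neg_iff, div_le_iff₀ (by linarith)]
          nlinarith
  set M : ℕ := ⌈4 * s / q⌉₊ with hM
  have M1 : 4 * s / q ≤ M := Nat.le_ceil _
  have M2 : (M : ℝ) < 4 * s / q + 1 := Nat.ceil_lt_add_one (by positivity)
  have qM1 : 4 * s ≤ q * M := by rw [div_le_iff₀ q0] at M1; linarith
  have qM2 : q * M ≤ 5 * s := by
    have : q * M ≤ q * (4 * s / q + 1) := by gcongr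
    rw [mul_add, mul_div_cancel₀ _ q0.ne'] at this; linarith
  have hbig : 2 * s + 2 * M ≤ n := by
    have k1 : (M : ℝ) ≤ 4 * s * Real.exp 4002 + 1 := by
      refine M2.le.trans ?_
      rw [mul_div_assoc, mul_assoc, div_eq_mul_one_div]
      have : (s : ℝ) * (1 / q) ≤ s * Real.exp 4002 := by gcongr
      linarith
    have k2 : (1 : ℝ) ≤ Real.exp 4002 := Real.one_le_exp (by norm_num)
    have k3 : 11 * Real.exp 4002 * s ≤ n := by
      have : p * (11 * Real.exp 4002 * s) ≤ p * n := by
        refine le_trans ?_ hn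
        have : p * s * (11 * Real.exp 4002) ≤ 2001 * (11 * Real.exp 4002) := by gcongr
        linarith
      exact le_of_mul_le_mul_left this hp0
    have k4 : (s : ℝ) * 1 ≤ s * Real.exp 4002 := by gcongr
    have : (2 * s + 2 * M : ℝ) ≤ n := by linarith
    exact_mod_cast this
  set m : ℕ := s / 8 with hm
  have m1 : (s : ℝ) ≤ 9 * m := by
    have : s ≤ 9 * m := by omega
    exact_mod_cast this
  have b1 := s12_prob (m := m) hR ht p hp hbig
  have b2 := s3_prob (n := n) hR ht p hp (s / 2) (n / 100 + 1)
  have p1 : 0 ≤ 1 - p := by linarith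
  have pe : ∀ k : ℕ, (1 - p) ^ k ≤ Real.exp (-(p * k)) := fun k => by
    calc (1 - p) ^ k ≤ Real.exp (-p) ^ k := by
          gcongr; have := Real.add_one_le_exp (-p); linarith
      _ = _ := by rw [← Real.exp_nat_mul]; congr 1; ring
  have e1 : Real.exp (s - (1 - p) ^ s * M / 2) ≤ Real.exp (-s) := by
    apply Real.exp_le_exp.2; rw [← hq]; linarith
  have e2 : (M.choose s : ℝ) * q ^ s ≤ Real.exp (5 * s) := by
    have k1 : (M.choose s : ℝ) ≤ M ^ s / s.factorial := Nat.choose_le_pow_div s M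
    calc (M.choose s : ℝ) * q ^ s ≤ M ^ s / s.factorial * q ^ s := by gcongr
      _ = (q * M) ^ s / s.factorial := by rw [mul_pow]; ring
      _ ≤ (5 * s) ^ s / s.factorial := by gcongr
      _ ≤ _ := Real.pow_div_factorial_le_exp _ (by positivity) _
  have e3 : 4 * (M.choose s : ℝ) ^ 2 * 4 ^ s * ((1 - p) ^ (2 * s ^ 2) * (1 - p) ^ (m ^ 2)) ≤ 4 * Real.exp (-s) := by
    have k1 : (1 - p) ^ (2 * s ^ 2) = (q ^ s) ^ 2 := by rw [hq, ← pow_mul, ← pow_mul]; congr 1; ring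
    have k2 : (4 : ℝ) ^ s ≤ Real.exp (2 * s) := four_pow_le _
    have k3 := pe (m ^ 2)
    have k4 : 24 * (s : ℝ) ≤ p * (m ^ 2 : ℕ) := by
      push_cast
      have : (s : ℝ) * s ≤ (9 * m) * (9 * m) := by gcongr
      have : p * (s * s) ≤ p * ((9 * m) * (9 * m)) := by gcongr
      have : 2000 * (s : ℝ) ≤ p * s * s := by gcongr
      nlinarith
    calc 4 * (M.choose s : ℝ) ^ 2 * 4 ^ s * ((1 - p) ^ (2 * s ^ 2) * (1 - p) ^ (m ^ 2))
        = 4 * ((M.choose s : ℝ) * q ^ s) ^ 2 * 4 ^ s * (1 - p) ^ (m ^ 2) := by rw [k1]; ring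
      _ ≤ 4 * (Real.exp (5 * s)) ^ 2 * Real.exp (2 * s) * Real.exp (-(p * (m ^ 2 : ℕ))) := by gcongr
      _ = 4 * Real.exp (2 * (5 * s) + 2 * s - p * (m ^ 2 : ℕ)) := by
          rw [Real.exp_sub, Real.exp_add, ← Real.exp_nat_mul, Real.exp_neg]; push_cast; ring
      _ ≤ 4 * Real.exp (-s) := by gcongr; linarith
  have e4 : (4 : ℝ) ^ n * (1 - p) ^ (s / 2 * (n / 100 + 1)) ≤ Real.exp (-n) := by
    have k2 : (4 : ℝ) ^ n ≤ Real.exp (2 * n) := four_pow_le _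
    have k3 := pe (s / 2 * (n / 100 + 1))
    have k4 : 3 * (n : ℝ) ≤ p * (s / 2 * (n / 100 + 1) : ℕ) := by
      have r1 : (s : ℝ) ≤ 4 * (s / 2 : ℕ) := by
        have : s ≤ 4 * (s / 2) := by omega
        exact_mod_cast this
      have r2 : (n : ℝ) ≤ 100 * (n / 100 + 1 : ℕ) := by
        have : n ≤ 100 * (n / 100 + 1) := by omega
        exact_mod_cast this
      rw [Nat.cast_mul]
      have r3 : (s : ℝ) * n ≤ (4 * (s / 2 : ℕ)) * (100 * (n / 100 + 1 : ℕ)) := by gcongr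
      have r4 : p * (s * n) ≤ p * ((4 * (s / 2 : ℕ)) * (100 * (n / 100 + 1 : ℕ))) := by gcongr
      have r5 : 2000 * (n : ℝ) ≤ p * s * n := by gcongr
      linarith
    calc (4 : ℝ) ^ n * (1 - p) ^ (s / 2 * (n / 100 + 1)) ≤ Real.exp (2 * n) * Real.exp (-(p * (s / 2 * (n / 100 + 1) : ℕ))) := by
          gcongr
      _ ≤ _ := by rw [← Real.exp_add]; apply Real.exp_le_exp.2; linarith
  refine (Pr_union_le (A := {ω : Sym2 (Fin n) → Fin R | ¬ FourP (gr ω t) s m}) ?_).trans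
    (add_le_add (b1.trans ?_) (b2.trans e4))
  · intro ω hω
    by_contra hcon
    simp only [Set.mem_ofPred_eq] at hcon
    rw [not_or, not_not, not_not] at hcon
    obtain ⟨⟨P, hPs, hdis, hh, hno⟩, h3⟩ := hcon
    exact hω (r2_closure (by omega) (by omega) (by omega) hPs hdis hh hno h3)
  · have : Real.exp (-s) ≤ Real.exp (-(2000 / p)) := by apply Real.exp_le_exp.2; linarith
    linarith

lemma r2a : ∀ᶠ n : ℕ in atTop, ∀ R t : ℕ, 0 < R → t ≤ R → 0.6 * Real.log n / n ≤ (t : ℝ) / R →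
    (t : ℝ) / R ≤ 2 * (n : ℝ) ^ (-(1 / 9) : ℝ) →
    Pr {ω : Sym2 (Fin n) → Fin R | ¬ ClosP (gr ω t) (n / 100 + 1)} ≤ 7 / (n : ℝ) ^ 7 := by
  filter_upwards [ev_L (2001 * (11 * Real.exp 4002) / 0.6), ev_log 7 1 (c := 1 / 9) (by norm_num),
    ev_const 4 (c := 1 / 9) (by norm_num), ev_log 7 1 (c := 1) (by norm_num), ev_L 1, eventually_gt_atTop 0]
    with n hL h2 h3 h4 hL1 hn R t hR ht hl hu
  have hn' : (0 : ℝ) < n := by exact_mod_cast hn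
  set p : ℝ := t / R with hp
  have hp0 : 0 < p := lt_of_lt_of_le (by positivity) hl
  have hx : (0 : ℝ) < (n : ℝ) ^ (1 / 9 : ℝ) := by positivity
  have hu' : p * (n : ℝ) ^ (1 / 9 : ℝ) ≤ 2 := by
    rw [Real.rpow_neg hn'.le] at hu
    rwa [← div_eq_mul_inv, le_div_iff₀ hx] at hu
  have hpn : 2001 * (11 * Real.exp 4002) ≤ p * n := by
    rw [div_le_iff₀ hn'] at hl
    rw [div_le_iff₀ (by norm_num)] at hL
    linarith
  refine (r2a_core hR ht p hp hp0 (by nlinarith) hpn).trans ?_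
  have a1 := pow_exp_le (n := n) (k := 0) hn (x := 2000 / p) (by
    rw [le_div_iff₀ hp0]
    have : p * (7 * Real.log n ^ 1) ≤ p * (n : ℝ) ^ (1 / 9 : ℝ) := by gcongr
    rw [pow_one] at this
    push_cast; linarith)
  have a2 := pow_exp_le (n := n) (k := 0) hn (x := n) (by
    rw [Real.rpow_one, pow_one] at h4; push_cast; linarith)
  rw [pow_zero, one_mul] at a1 a2
  rw [show (7 : ℝ) / n ^ 7 = 6 * (1 / n ^ 7) + 1 / n ^ 7 by ring]
  linarith
end RacgFib

namespace RacgFib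
open Classical Finset Filter

section gen
variable {V : Type*} [Fintype V]
def S4P (G : SimpleGraph V) (κ z0 z1 : ℕ) : Prop := ∀ Z : Finset V, z0 ≤ Z.card → Z.card < 2 * z1 →
      κ * Z.card < ∑ z ∈ Z, (Finset.univ.filter (fun w => w ∉ Z ∧ G.Adj z w)).card
def CliqP (G : SimpleGraph V) (κ : ℕ) : Prop :=
  ∀ S : Finset V, (∀ a ∈ S, ∀ b ∈ S, a ≠ b → G.Adj a b) → S.card ≤ κ
lemma CliqP.mono {G G' : SimpleGraph V} {κ : ℕ} (h : G ≤ G') (hc : CliqP G' κ) : CliqP G κ :=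
  fun S hS => hc S fun a ha b hb hab => h (hS a ha b hb hab)
end gen

section s5
variable {n R t : ℕ}
def edgIn (S : Finset (Fin n)) : Finset (Sym2 (Fin n)) := S.offDiag.image (fun q => s(q.1, q.2))
lemma mem_edgIn {S : Finset (Fin n)} {e} : e ∈ edgIn S ↔ ∃ a ∈ S, ∃ b ∈ S, a ≠ b ∧ s(a, b) = e := by
  simp only [edgIn, mem_image, mem_offDiag, Prod.exists]
  constructor
  · rintro ⟨a, b, ⟨h1, h2, h3⟩, h⟩; exact ⟨a, h1, b, h2, h3, h⟩
  · rintro ⟨a, h1, b, h2, h3, h⟩; exact ⟨a, b, ⟨h1, h2, h3⟩, h⟩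
lemma card_edgIn (S : Finset (Fin n)) : (edgIn S).card = S.card.choose 2 := by
  have := Sym2.card_image_offDiag S
  convert this using 2
  ext e
  simp [edgIn, Function.uncurry]

lemma s5_core (hR : 0 < R) (ht : t ≤ R) (p : ℝ) (hp : p = t / R) :
    Pr {ω : Sym2 (Fin n) → Fin R | ¬ CliqP (gr ω t) 19} ≤ (n : ℝ) ^ 20 * p ^ 190 := by
  have hp0 : 0 ≤ p := by rw [hp]; positivity
  refine Pr_union_bound (powersetCard 20 (univ : Finset (Fin n))) (fun S => {ω | ∀ e ∈ edgIn S, (ω e : ℕ) < t})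
    ?_ (b := p ^ 190) ?_ ?_
  · intro ω hω
    simp only [CliqP, Set.mem_ofPred_eq] at hω
    push Not at hω
    obtain ⟨S, hS, hc⟩ := hω
    obtain ⟨S', hS', hc'⟩ := exists_subset_card_eq (show 20 ≤ S.card by omega)
    refine ⟨S', by simp [mem_powersetCard, hc'], fun e he => ?_⟩
    obtain ⟨a, ha, b, hb, hab, rfl⟩ := mem_edgIn.1 he
    exact (hS a (hS' ha) b (hS' hb) hab).2
  · intro S hS
    have hc := (mem_powersetCard.1 hS).2
    have := Pr_absent hR {ω : Sym2 (Fin n) → Fin R | ∀ e ∈ edgIn S, (ω e : ℕ) < t} (edgIn S) ∅ (by simp)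
      (fun l => (l : ℕ) < t) (fun _ => True) (fun ω hω => hω) (by simp)
    rw [card_edgIn, hc, pr_lt ht, ← hp, card_empty, pow_zero, mul_one] at this
    exact this
  · gcongr
    rw [card_powersetCard, card_univ, Fintype.card_fin]
    exact_mod_cast Nat.choose_le_pow n 20

lemma s5_prob (ε : ℝ) (hε : 0 < ε) : ∀ᶠ n : ℕ in atTop, ∀ R t : ℕ, 0 < R → t ≤ R →
    (t : ℝ) / R ≤ 2 * (n : ℝ) ^ (-(1 / 9) : ℝ) →
    Pr {ω : Sym2 (Fin n) → Fin R | ¬ CliqP (gr ω t) 19} ≤ ε := by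
  filter_upwards [ev_const (2 ^ 190 / ε) (c := 1) (by norm_num), eventually_ge_atTop 1] with n h1 hn R t hR ht hu
  have hn1 : (1 : ℝ) ≤ n := by exact_mod_cast hn
  have hn0 : (0 : ℝ) < n := by linarith
  refine (s5_core hR ht _ rfl).trans ?_
  have h0 : (0 : ℝ) ≤ (t : ℝ) / R := by positivity
  have h2 : ((t : ℝ) / R) ^ 190 ≤ 2 ^ 190 * (n : ℝ) ^ (-21 : ℝ) := by
    calc ((t : ℝ) / R) ^ 190 ≤ (2 * (n : ℝ) ^ (-(1 / 9) : ℝ)) ^ 190 := by gcongr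
      _ = 2 ^ 190 * (n : ℝ) ^ (-(190 / 9) : ℝ) := by
        rw [mul_pow, ← Real.rpow_natCast ((n : ℝ) ^ _), ← Real.rpow_mul hn0.le]; congr 2; norm_num
      _ ≤ _ := by
        refine mul_le_mul_of_nonneg_left (Real.rpow_le_rpow_of_exponent_le hn1 (by norm_num)) (by positivity)
  calc (n : ℝ) ^ 20 * ((t : ℝ) / R) ^ 190 ≤ (n : ℝ) ^ 20 * (2 ^ 190 * (n : ℝ) ^ (-21 : ℝ)) := by gcongr
    _ = 2 ^ 190 / (n : ℝ) := by
      rw [show (-21 : ℝ) = -((21 : ℕ) : ℝ) by norm_num, Real.rpow_neg hn0.le, Real.rpow_natCast]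
      field_simp
    _ ≤ ε := by
      rw [Real.rpow_one, div_le_iff₀ hε] at h1
      rw [div_le_iff₀ hn0]; linarith
end s5

section s4
variable {n R t : ℕ}

lemma s4_one (hR : 0 < R) (ht : t ≤ R) (p : ℝ) (hp : p = t / R) (Z : Finset (Fin n))
    (hZ : 0.97 * (n : ℝ) ≤ (n : ℝ) - Z.card) :
    Pr {ω : Sym2 (Fin n) → Fin R | ¬ 19 * Z.card < ∑ z ∈ Z, (univ.filter (fun w => w ∉ Z ∧ (gr ω t).Adj z w)).card} ≤
      Real.exp (Z.card * (19 * Real.log 100 - 0.96 * (p * n))) := by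
  have hp0 : 0 ≤ p := by rw [hp]; positivity
  have hp1 : p ≤ 1 := by
    rw [hp]; apply div_le_one_of_le₀ (by exact_mod_cast ht) (by positivity)
  have hdis : Disjoint Z (univ \ Z) := disjoint_sdiff
  have := Pr_moment hR {ω : Sym2 (Fin n) → Fin R | ¬ 19 * Z.card < ∑ z ∈ Z, (univ.filter (fun w => w ∉ Z ∧ (gr ω t).Adj z w)).card}
    ∅ (edg Z (univ \ Z)) (by simp) (fun _ => True) (fun l => (l : ℕ) < t) ((1 / 100) ^ (19 * Z.card)) (1 / 100)
    (by norm_num) (by positivity) (by simp) (by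
      intro ω hω J hJ
      have hω : ∑ z ∈ Z, (univ.filter (fun w => w ∉ Z ∧ (gr ω t).Adj z w)).card ≤ 19 * Z.card := not_lt.1 hω
      refine pow_le_pow_of_le_one (by norm_num) (by norm_num) (le_trans ?_ hω)
      have : J ⊆ Z.biUnion (fun z => (univ.filter (fun w => w ∉ Z ∧ (gr ω t).Adj z w)).image (fun w => s(z, w))) := by
        intro e he
        obtain ⟨h1, h2⟩ := (hJ e).1 he
        obtain ⟨a, ha, b, hb, rfl⟩ := mem_edg.1 h1
        have hb' : b ∉ Z := (mem_sdiff.1 hb).2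
        refine mem_biUnion.2 ⟨a, ha, mem_image.2 ⟨b, mem_filter.2 ⟨mem_univ _, hb', ?_, h2⟩, rfl⟩⟩
        rintro rfl; exact hb' ha
      exact (card_le_card this).trans (card_biUnion_le.trans (sum_le_sum fun z _ => card_image_le)))
  refine this.trans ?_
  rw [card_empty, pow_zero, one_mul, pr_lt ht, ← hp, card_edg hdis]
  have hc : ((univ \ Z).card : ℝ) = n - Z.card := by
    rw [card_sdiff_of_subset (subset_univ _), card_univ, Fintype.card_fin, Nat.cast_sub]
    simpa using card_le_univ Z
  have e1 : 1 - p + p * (1 / 100) ≤ Real.exp (-(0.99 * p)) := by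
    have := Real.add_one_le_exp (-(0.99 * p)); linarith
  have e2 : ((1 / 100 : ℝ) ^ (19 * Z.card))⁻¹ = Real.exp (Z.card * (19 * Real.log 100)) := by
    rw [one_div, inv_pow, inv_inv, ← Real.rpow_natCast, Real.rpow_def_of_pos (by norm_num)]
    congr 1; push_cast; ring
  rw [e2]
  calc _ ≤ Real.exp (Z.card * (19 * Real.log 100)) * Real.exp (-(0.99 * p)) ^ (Z.card * (univ \ Z).card) := by
        gcongr
    _ ≤ _ := by
        rw [← Real.exp_nat_mul, ← Real.exp_add]
        apply Real.exp_le_exp.2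
        push_cast
        rw [hc]
        have k1 : (Z.card : ℝ) * p * (0.97 * n) ≤ Z.card * p * (n - Z.card) := by gcongr
        have k2 : 0 ≤ (Z.card : ℝ) * p * n := by positivity
        nlinarith

lemma s4_core (hR : 0 < R) (ht : t ≤ R) (p : ℝ) (hp : p = t / R) (hn : 200 ≤ n) (z0 : ℕ) (b : ℝ) (hb0 : 0 ≤ b)
    (hb : ∀ z : ℕ, z0 ≤ z → z ≤ n → (n.choose z : ℝ) * Real.exp (z * (19 * Real.log 100 - 0.96 * (p * n))) ≤ b) :
    Pr {ω : Sym2 (Fin n) → Fin R | ¬ S4P (gr ω t) 19 z0 (n / 100 + 1)} ≤ (n + 1) * b := by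
  refine Pr_union_bound ((range (n + 1)).filter (fun z => z0 ≤ z ∧ z < 2 * (n / 100 + 1)))
    (fun z => {ω | ∃ Z : Finset (Fin n), Z.card = z ∧
      ¬ 19 * Z.card < ∑ z ∈ Z, (univ.filter (fun w => w ∉ Z ∧ (gr ω t).Adj z w)).card}) ?_ (b := b) ?_ ?_
  · intro ω hω
    simp only [S4P, Set.mem_ofPred_eq] at hω
    push Not at hω
    obtain ⟨Z, h1, h2, h3⟩ := hω
    refine ⟨Z.card, ?_, Z, rfl, ?_⟩
    · have := card_le_univ Z
      rw [Fintype.card_fin] at this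
      simp only [mem_filter, mem_range]; omega
    · rw [not_lt]; convert h3
  · intro z hz
    simp only [mem_filter, mem_range] at hz
    refine Pr_union_bound (powersetCard z (univ : Finset (Fin n))) (fun Z => {ω |
      ¬ 19 * Z.card < ∑ z ∈ Z, (univ.filter (fun w => w ∉ Z ∧ (gr ω t).Adj z w)).card}) ?_
      (b := Real.exp (z * (19 * Real.log 100 - 0.96 * (p * n)))) ?_ ?_
    · rintro ω ⟨Z, h1, h2⟩
      exact ⟨Z, by simp [mem_powersetCard, h1], h2⟩
    · intro Z hZ
      have hc := (mem_powersetCard.1 hZ).2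
      have := s4_one hR ht p hp Z (by
        have : 100 * z ≤ 3 * n := by omega
        have : 100 * (z : ℝ) ≤ 3 * n := by exact_mod_cast this
        rw [hc]; linarith)
      rw [hc] at this
      simpa only [hc] using this
    · rw [card_powersetCard, card_univ, Fintype.card_fin]
      exact hb z hz.2.1 (by omega)
  · gcongr
    have := (card_filter_le (range (n + 1)) (fun z => z0 ≤ z ∧ z < 2 * (n / 100 + 1)))
    rw [card_range] at this
    exact_mod_cast this

lemma s4_B : ∀ᶠ n : ℕ in atTop, ∀ R t : ℕ, 0 < R → t ≤ R → 12 * Real.log n / n ≤ (t : ℝ) / R →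
    Pr {ω : Sym2 (Fin n) → Fin R | ¬ S4P (gr ω t) 19 1 (n / 100 + 1)} ≤ 2 / (n : ℝ) ^ 7 := by
  filter_upwards [ev_L (19 * Real.log 100 / 0.52), ev_L 1, eventually_ge_atTop 200] with n h1 h2 hn R t hR ht hl
  have hn1 : (200 : ℝ) ≤ n := by exact_mod_cast hn
  have hn0 : (0 : ℝ) < n := by linarith
  rw [div_le_iff₀ hn0] at hl
  refine (s4_core hR ht _ rfl hn 1 (1 / n ^ 8) (by positivity) ?_).trans ?_
  · intro z hz _
    have a1 : (n.choose z : ℝ) ≤ n ^ z := by exact_mod_cast Nat.choose_le_pow n z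
    have a2 : (n : ℝ) = Real.exp (Real.log n) := (Real.exp_log hn0).symm
    have hz' : (1 : ℝ) ≤ z := by exact_mod_cast hz
    rw [div_le_iff₀ (by norm_num)] at h1
    calc _ ≤ (n : ℝ) ^ z * Real.exp (z * (19 * Real.log 100 - 0.96 * ((t : ℝ) / R * n))) := by gcongr
      _ = Real.exp (z * (Real.log n + (19 * Real.log 100 - 0.96 * ((t : ℝ) / R * n)))) := by
        rw [mul_add, Real.exp_add, Real.exp_nat_mul (Real.log n), Real.exp_log hn0]
      _ ≤ Real.exp (-(8 * Real.log n)) := by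
        apply Real.exp_le_exp.2
        have : Real.log n + (19 * Real.log 100 - 0.96 * ((t : ℝ) / R * n)) ≤ -(8 * Real.log n) := by linarith
        have k : (z : ℝ) * (Real.log n + (19 * Real.log 100 - 0.96 * ((t : ℝ) / R * n))) ≤ z * -(8 * Real.log n) := by gcongr
        nlinarith
      _ = _ := by
        rw [Real.exp_neg, mul_comm, Real.exp_mul, Real.exp_log hn0, one_div]; norm_cast
  · rw [show (2 : ℝ) / n ^ 7 = (2 * n) * (1 / n ^ 8) by field_simp]
    gcongr; linarith

lemma s4_A : ∀ᶠ n : ℕ in atTop, ∀ R t : ℕ, 0 < R → t ≤ R → 0.6 * Real.log n / n ≤ (t : ℝ) / R →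
    Pr {ω : Sym2 (Fin n) → Fin R | ¬ S4P (gr ω t) 19 ⌈(n : ℝ) ^ (0.45 : ℝ)⌉₊ (n / 100 + 1)} ≤ 2 / (n : ℝ) ^ 7 := by
  filter_upwards [ev_L ((19 * Real.log 100 + 2) / 0.026), ev_log 8 1 (c := 0.45) (by norm_num), ev_L 1,
    eventually_ge_atTop 200] with n h1 h3 h2 hn R t hR ht hl
  have hn1 : (200 : ℝ) ≤ n := by exact_mod_cast hn
  have hn0 : (0 : ℝ) < n := by linarith
  rw [div_le_iff₀ hn0] at hl
  refine (s4_core hR ht _ rfl hn _ (1 / n ^ 8) (by positivity) ?_).trans ?_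
  · intro z hz _
    have hz1 : (n : ℝ) ^ (0.45 : ℝ) ≤ z := Nat.ceil_le.1 hz
    have hz0 : (0 : ℝ) < z := lt_of_lt_of_le (by positivity) hz1
    have a1 : (n.choose z : ℝ) ≤ (Real.exp (1 + 0.55 * Real.log n)) ^ z := by
      have k1 : (n.choose z : ℝ) ≤ n ^ z / z.factorial := Nat.choose_le_pow_div z n
      have k2 : (z : ℝ) ^ z / z.factorial ≤ Real.exp z := Real.pow_div_factorial_le_exp _ hz0.le _
      have k3 : (n : ℝ) / z ≤ Real.exp (0.55 * Real.log n) := by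
        rw [div_le_iff₀ hz0]
        calc (n : ℝ) = Real.exp (0.55 * Real.log n) * (n : ℝ) ^ (0.45 : ℝ) := by
              rw [Real.rpow_def_of_pos hn0, ← Real.exp_add]
              rw [show 0.55 * Real.log n + Real.log n * 0.45 = Real.log n by ring, Real.exp_log hn0]
          _ ≤ _ := by gcongr
      calc (n.choose z : ℝ) ≤ n ^ z / z.factorial := k1
        _ = (n / z) ^ z * (z ^ z / z.factorial) := by rw [div_pow]; field_simp
        _ ≤ (Real.exp (0.55 * Real.log n)) ^ z * Real.exp z := by gcongr
        _ = _ := by rw [← Real.exp_nat_mul, ← Real.exp_nat_mul, ← Real.exp_add]; congr 1; ring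
    rw [div_le_iff₀ (by norm_num)] at h1
    calc _ ≤ (Real.exp (1 + 0.55 * Real.log n)) ^ z * Real.exp (z * (19 * Real.log 100 - 0.96 * ((t : ℝ) / R * n))) := by gcongr
      _ = Real.exp (z * (1 + 0.55 * Real.log n + (19 * Real.log 100 - 0.96 * ((t : ℝ) / R * n)))) := by
        rw [mul_add, Real.exp_add (z * (1 + _)), Real.exp_nat_mul (1 + _)]
      _ ≤ Real.exp (-(8 * Real.log n)) := by
        apply Real.exp_le_exp.2
        have : 1 + 0.55 * Real.log n + (19 * Real.log 100 - 0.96 * ((t : ℝ) / R * n)) ≤ -1 := by linarith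
        have k : (z : ℝ) * (1 + 0.55 * Real.log n + (19 * Real.log 100 - 0.96 * ((t : ℝ) / R * n))) ≤ z * -1 := by gcongr
        rw [pow_one] at h3
        linarith
      _ = _ := by
        rw [Real.exp_neg, mul_comm, Real.exp_mul, Real.exp_log hn0, one_div]; norm_cast
  · rw [show (2 : ℝ) / n ^ 7 = (2 * n) * (1 / n ^ 8) by field_simp]
    gcongr; linarith
end s4
end RacgFib

namespace RacgFib
open Classical Finset Filter

section gen
variable {V : Type*} [Fintype V]
def S6P (G : SimpleGraph V) (z0 : ℕ) : Prop :=
  ∀ X : Finset V, X.Nonempty → X.card < z0 → ∑ x ∈ X, (X.filter (G.Adj x)).card < 6 * X.card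
def Low (G : SimpleGraph V) (D : ℕ) (u : V) : Prop := (Finset.univ.filter (G.Adj u)).card ≤ D
def LowP (G1 G3 : SimpleGraph V) (D : ℕ) : Prop :=
  (∀ u v, Low G1 D u → Low G1 D v → ¬ G3.Adj u v) ∧
  (∀ u v w, u ≠ v → Low G1 D u → Low G1 D v → G3.Adj u w → ¬ G3.Adj v w) ∧
  (∀ u v w, Low G1 D u → G3.Adj u v → G3.Adj u w → ¬ G3.Adj v w)
end gen

section s6
variable {n R t : ℕ}

lemma s6_one (hR : 0 < R) (ht : t ≤ R) (p : ℝ) (hp : p = t / R) (X : Finset (Fin n)) (θ : ℝ) (hθ : 1 ≤ θ) :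
    Pr {ω : Sym2 (Fin n) → Fin R | 6 * X.card ≤ ∑ x ∈ X, (X.filter ((gr ω t).Adj x)).card} ≤
      (θ ^ (3 * X.card))⁻¹ * Real.exp (p * θ * (X.card ^ 2 / 2)) := by
  have hp0 : 0 ≤ p := by rw [hp]; positivity
  have := Pr_moment hR {ω : Sym2 (Fin n) → Fin R | 6 * X.card ≤ ∑ x ∈ X, (X.filter ((gr ω t).Adj x)).card}
    ∅ (edgIn X) (by simp) (fun _ => True) (fun l => (l : ℕ) < t) (θ ^ (3 * X.card)) θ
    (by linarith) (by positivity) (by simp) (by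
      intro ω hω J hJ
      refine pow_le_pow_right₀ hθ ?_
      have hω : 6 * X.card ≤ ∑ x ∈ X, (X.filter ((gr ω t).Adj x)).card := hω
      have h1 : ∑ x ∈ X, (X.filter ((gr ω t).Adj x)).card ≤ ∑ x ∈ X, (J.filter (fun e => x ∈ e)).card := by
        refine sum_le_sum fun x hx => ?_
        refine card_le_card_of_injOn (fun y => s(x, y)) ?_ ?_
        · intro y hy
          have hy := mem_filter.1 (mem_coe.1 hy)
          refine mem_coe.2 (mem_filter.2 ⟨(hJ _).2 ⟨mem_edgIn.2 ⟨x, hx, y, hy.1, hy.2.1, rfl⟩, hy.2.2⟩, by simp⟩)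
        · intro y _ y' _ h
          exact Sym2.congr_right.1 h
      have h2 : ∑ x ∈ X, (J.filter (fun e => x ∈ e)).card = ∑ e ∈ J, (X.filter (fun x => x ∈ e)).card :=
        sum_card_bipartiteAbove_eq_sum_card_bipartiteBelow (fun x (e : Sym2 (Fin n)) => x ∈ e)
      have h3 : ∑ e ∈ J, (X.filter (fun x => x ∈ e)).card ≤ ∑ e ∈ J, 2 := by
        refine sum_le_sum fun e _ => ?_
        induction e with
        | h a b =>
          refine (card_le_card (t := {a, b}) fun x hx => ?_).trans card_le_two
          simpa using (mem_filter.1 hx).2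
      rw [sum_const, smul_eq_mul] at h3
      omega)
  refine this.trans ?_
  rw [card_empty, pow_zero, one_mul, pr_lt ht, ← hp, card_edgIn]
  gcongr
  have hpt : 0 ≤ p * (θ - 1) := mul_nonneg hp0 (by linarith)
  have hp1 : p ≤ 1 := by
    rw [hp]; apply div_le_one_of_le₀ (by exact_mod_cast ht) (by positivity)
  calc (1 - p + p * θ) ^ (X.card.choose 2) ≤ (Real.exp (p * (θ - 1))) ^ (X.card.choose 2) := by
        gcongr
        have := Real.add_one_le_exp (p * (θ - 1)); linarith
    _ = Real.exp ((X.card.choose 2 : ℕ) * (p * (θ - 1))) := by rw [← Real.exp_nat_mul]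
    _ ≤ _ := by
        apply Real.exp_le_exp.2
        have k1 : ((X.card.choose 2 : ℕ) : ℝ) ≤ X.card ^ 2 / 2 := by
          rw [Nat.cast_choose_two]
          have : (0 : ℝ) ≤ X.card := by positivity
          nlinarith
        calc ((X.card.choose 2 : ℕ) : ℝ) * (p * (θ - 1)) ≤ (X.card ^ 2 / 2) * (p * θ) := by
              gcongr
              linarith
          _ = _ := by ring

lemma s6_prob (ε : ℝ) (hε : 0 < ε) : ∀ᶠ n : ℕ in atTop, ∀ R t : ℕ, 0 < R → t ≤ R → (t : ℝ) / R ≤ 13 * Real.log n / n →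
    Pr {ω : Sym2 (Fin n) → Fin R | ¬ S6P (gr ω t) ⌈(n : ℝ) ^ (0.45 : ℝ)⌉₊} ≤ ε := by
  filter_upwards [ev_log (Real.exp 1.5 * 13 ^ 3) 3 (c := 0.1) (by norm_num), ev_log 13 1 (c := 0.55) (by norm_num),
    ev_const (2 / ε) (c := 0.55) (by norm_num), ev_L 1, eventually_ge_atTop 2] with n h1 h2 h3 hL hn R t hR ht hu
  have hn1 : (2 : ℝ) ≤ n := by exact_mod_cast hn
  have hn0 : (0 : ℝ) < n := by linarith
  set p : ℝ := 13 * Real.log n / n with hp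
  have hp0 : 0 < p := by rw [hp]; positivity
  have hsplit : ∀ a b : ℝ, (n : ℝ) ^ (a + b) = (n : ℝ) ^ a * (n : ℝ) ^ b := fun a b => Real.rpow_add hn0 a b
  have hs1 : (n : ℝ) ^ (0.45 : ℝ) * (n : ℝ) ^ (0.55 : ℝ) = n := by
    rw [← hsplit]; norm_num
  have hc : (⌈(n : ℝ) ^ (0.45 : ℝ)⌉₊ : ℝ) ≤ 2 * (n : ℝ) ^ (0.45 : ℝ) := by
    have := Nat.ceil_lt_add_one (show (0 : ℝ) ≤ (n : ℝ) ^ (0.45 : ℝ) by positivity)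
    have : (1 : ℝ) ≤ (n : ℝ) ^ (0.45 : ℝ) := Real.one_le_rpow (by linarith) (by norm_num)
    linarith
  refine Pr_union_bound ((range ⌈(n : ℝ) ^ (0.45 : ℝ)⌉₊).filter (fun x => 1 ≤ x))
    (fun x => {ω | ∃ X : Finset (Fin n), X.card = x ∧ 6 * X.card ≤ ∑ x ∈ X, (X.filter ((gr ω t).Adj x)).card})
    ?_ (b := 1 / n) ?_ ?_
  · intro ω hω
    simp only [S6P, Set.mem_ofPred_eq] at hω
    push Not at hω
    obtain ⟨X, k1, k2, k3⟩ := hω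
    refine ⟨X.card, ?_, X, rfl, ?_⟩
    · simp only [mem_filter, mem_range]; exact ⟨k2, k1.card_pos⟩
    · convert k3
  · intro x hx
    simp only [mem_filter, mem_range] at hx
    have hx1 : (1 : ℝ) ≤ x := by exact_mod_cast hx.2
    have hx0 : (0 : ℝ) < x := by linarith
    have hx2 : (x : ℝ) ≤ (n : ℝ) ^ (0.45 : ℝ) := (Nat.lt_ceil.1 hx.1).le
    have hpx : p * x ≤ 1 := by
      rw [hp, div_mul_eq_mul_div, div_le_one hn0]
      rw [pow_one] at h2
      calc 13 * Real.log n * x ≤ (n : ℝ) ^ (0.55 : ℝ) * (n : ℝ) ^ (0.45 : ℝ) := by gcongr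
        _ = n := by rw [mul_comm, hs1]
    refine Pr_union_bound (powersetCard x (univ : Finset (Fin n))) (fun X => {ω |
      6 * X.card ≤ ∑ x ∈ X, (X.filter ((gr ω t).Adj x)).card}) ?_
      (b := (p * x) ^ (3 * x) * Real.exp (x / 2)) ?_ ?_
    · rintro ω ⟨X, k1, k2⟩
      exact ⟨X, by simp [mem_powersetCard, k1], k2⟩
    · intro X hX
      have hc := (mem_powersetCard.1 hX).2
      have := s6_one hR ht _ rfl X (1 / (p * x)) (by rw [le_div_iff₀ (by positivity)]; linarith)
      refine this.trans ?_
      rw [hc, one_div, inv_pow, inv_inv]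
      gcongr
      calc (t : ℝ) / R * (p * x)⁻¹ * ((x : ℝ) ^ 2 / 2) ≤ p * (p * x)⁻¹ * ((x : ℝ) ^ 2 / 2) := by gcongr
        _ = (x : ℝ) / 2 := by field_simp
    · rw [card_powersetCard, card_univ, Fintype.card_fin]
      have k1 : (n.choose x : ℝ) ≤ n ^ x / x.factorial := Nat.choose_le_pow_div x n
      have k2 : (x : ℝ) ^ x / x.factorial ≤ Real.exp x := Real.pow_div_factorial_le_exp _ hx0.le _
      have k4 : Real.exp 1.5 * (n / x) * (p * x) ^ 3 ≤ 1 / n := by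
        have e1 : Real.exp 1.5 * (n / x) * (p * x) ^ 3 = Real.exp 1.5 * 13 ^ 3 * Real.log n ^ 3 * x ^ 2 / n ^ 2 := by
          rw [hp]; field_simp
        rw [e1, div_le_div_iff₀ (by positivity) hn0]
        have e2 : ((n : ℝ) ^ (0.45 : ℝ)) ^ 2 = (n : ℝ) ^ (0.9 : ℝ) := by
          rw [← Real.rpow_natCast, ← Real.rpow_mul hn0.le]; norm_num
        have e3 : (n : ℝ) ^ (0.1 : ℝ) * (n : ℝ) ^ (0.9 : ℝ) = n := by rw [← hsplit]; norm_num
        have : Real.exp 1.5 * 13 ^ 3 * Real.log n ^ 3 * x ^ 2 ≤ n := by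
          calc _ ≤ (n : ℝ) ^ (0.1 : ℝ) * ((n : ℝ) ^ (0.45 : ℝ)) ^ 2 := by gcongr
            _ = n := by rw [e2, e3]
        nlinarith
      calc (n.choose x : ℝ) * ((p * x) ^ (3 * x) * Real.exp (x / 2))
          ≤ n ^ x / x.factorial * ((p * x) ^ (3 * x) * Real.exp (x / 2)) := by gcongr
        _ = (n / x) ^ x * (x ^ x / x.factorial) * ((p * x) ^ (3 * x) * Real.exp (x / 2)) := by
          rw [div_pow]; field_simp
        _ ≤ (n / x) ^ x * Real.exp x * ((p * x) ^ (3 * x) * Real.exp (x / 2)) := by gcongr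
        _ = (Real.exp 1.5 * (n / x) * (p * x) ^ 3) ^ x := by
          rw [mul_pow (Real.exp 1.5 * _), mul_pow (Real.exp 1.5), ← pow_mul, ← Real.exp_nat_mul]
          rw [show (x : ℝ) * 1.5 = x + x / 2 by ring, Real.exp_add]; ring
        _ ≤ (1 / n) ^ x := by gcongr
        _ ≤ 1 / n := by
          refine (pow_le_pow_of_le_one (by positivity) ?_ hx.2).trans (by rw [pow_one])
          rw [div_le_one hn0]; linarith
  · have := (card_filter_le (range ⌈(n : ℝ) ^ (0.45 : ℝ)⌉₊) (fun x => 1 ≤ x))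
    rw [card_range] at this
    have : ((((range ⌈(n : ℝ) ^ (0.45 : ℝ)⌉₊).filter (fun x => 1 ≤ x)).card : ℕ) : ℝ) ≤ ⌈(n : ℝ) ^ (0.45 : ℝ)⌉₊ := by
      exact_mod_cast this
    rw [div_le_iff₀ hε] at h3
    have h4 : 2 * (n : ℝ) ^ (0.45 : ℝ) ≤ ε * n := by
      calc 2 * (n : ℝ) ^ (0.45 : ℝ) ≤ (n : ℝ) ^ (0.55 : ℝ) * ε * (n : ℝ) ^ (0.45 : ℝ) := by gcongr
        _ = ε * ((n : ℝ) ^ (0.45 : ℝ) * (n : ℝ) ^ (0.55 : ℝ)) := by ring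
        _ = _ := by rw [hs1]
    rw [mul_one_div, div_le_iff₀ hn0]
    linarith
end s6
end RacgFib

namespace RacgFib
open Classical Finset Filter

section low
variable {n R t1 t3 : ℕ}

lemma lowG (hR : 0 < R) (ht1 : t1 ≤ R) (ht3 : t3 ≤ R) (hn : 300 ≤ n)
    (h1 : 0.6 * Real.log n / n ≤ (t1 : ℝ) / R) (h3 : (t3 : ℝ) / R ≤ 13 * Real.log n / n)
    (S T : Finset (Fin n)) (hST : S ⊆ T) (hT : T.card ≤ 3) (F : Finset (Sym2 (Fin n)))
    (hF : ∀ e ∈ F, ∀ v ∈ e, v ∈ T) :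
    Pr {ω : Sym2 (Fin n) → Fin R | (∀ u ∈ S, Low (gr ω t1) 25 u) ∧ ∀ e ∈ F, (ω e : ℕ) < t3} ≤
      (13 * Real.log n / n) ^ F.card * (100 ^ 25 * (n : ℝ) ^ (-0.58 : ℝ)) ^ S.card := by
  have hn' : (300 : ℝ) ≤ n := by exact_mod_cast hn
  have hn0 : (0 : ℝ) < n := by linarith
  have hL : 0 ≤ Real.log n := Real.log_natCast_nonneg n
  set p : ℝ := t1 / R with hp
  have hp0 : 0 ≤ p := by rw [hp]; positivity
  have hp1 : p ≤ 1 := by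
    rw [hp]; apply div_le_one_of_le₀ (by exact_mod_cast ht1) (by positivity)
  have hdis : Disjoint S (univ \ T) := disjoint_sdiff.mono_left hST
  have := Pr_moment hR {ω : Sym2 (Fin n) → Fin R | (∀ u ∈ S, Low (gr ω t1) 25 u) ∧ ∀ e ∈ F, (ω e : ℕ) < t3}
    F (edg S (univ \ T)) (by
      refine disjoint_left.2 fun e he he' => ?_
      obtain ⟨a, ha, b, hb, rfl⟩ := mem_edg.1 he'
      exact (mem_sdiff.1 hb).2 (hF _ he b (by simp)))
    (fun l => (l : ℕ) < t3) (fun l => (l : ℕ) < t1) ((1 / 100) ^ (25 * S.card)) (1 / 100)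
    (by norm_num) (by positivity) (fun ω hω => hω.2) (by
      rintro ω ⟨hω, -⟩ J hJ
      refine pow_le_pow_of_le_one (by norm_num) (by norm_num) ?_
      have k : J ⊆ S.biUnion (fun z => (univ.filter ((gr ω t1).Adj z)).image (fun w => s(z, w))) := by
        intro e he
        obtain ⟨k1, k2⟩ := (hJ e).1 he
        obtain ⟨a, ha, b, hb, rfl⟩ := mem_edg.1 k1
        refine mem_biUnion.2 ⟨a, ha, mem_image.2 ⟨b, mem_filter.2 ⟨mem_univ _, ?_, k2⟩, rfl⟩⟩
        rintro rfl; exact disjoint_left.1 hdis ha hb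
      calc J.card ≤ ∑ z ∈ S, ((univ.filter ((gr ω t1).Adj z)).image (fun w => s(z, w))).card :=
            (card_le_card k).trans card_biUnion_le
        _ ≤ ∑ z ∈ S, 25 := sum_le_sum fun z hz => card_image_le.trans (by
            have := hω z hz
            unfold Low at this
            convert this)
        _ = _ := by rw [sum_const, smul_eq_mul, mul_comm])
  refine this.trans ?_
  rw [pr_lt ht1, pr_lt ht3, ← hp, card_edg hdis]
  have hc : ((univ \ T).card : ℝ) = n - T.card := by
    rw [card_sdiff_of_subset (subset_univ _), card_univ, Fintype.card_fin, Nat.cast_sub]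
    simpa using card_le_univ T
  have hT' : (T.card : ℝ) ≤ 3 := by exact_mod_cast hT
  have e1 : 1 - p + p * (1 / 100) ≤ Real.exp (-(0.99 * p)) := by
    have := Real.add_one_le_exp (-(0.99 * p)); linarith
  have e2 : ((1 / 100 : ℝ) ^ (25 * S.card))⁻¹ = (100 ^ 25) ^ S.card := by
    rw [one_div, inv_pow, inv_inv, pow_mul]
  have e3 : (1 - p + p * (1 / 100)) ^ (S.card * (univ \ T).card) ≤ ((n : ℝ) ^ (-0.58 : ℝ)) ^ S.card := by
    rw [mul_comm S.card, pow_mul]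
    have k0 : 0 ≤ 1 - p + p * (1 / 100) := by nlinarith
    refine pow_le_pow_left₀ (pow_nonneg k0 _) ?_ _
    calc _ ≤ Real.exp (-(0.99 * p)) ^ (univ \ T).card := by gcongr
      _ ≤ _ := by
        rw [← Real.exp_nat_mul, Real.rpow_def_of_pos hn0, hc]
        apply Real.exp_le_exp.2
        rw [div_le_iff₀ hn0] at h1
        have k1 : 0.99 * (n : ℝ) * p ≤ (n - T.card) * p := by gcongr; linarith
        nlinarith
  rw [e2]
  calc _ ≤ (100 ^ 25 : ℝ) ^ S.card * ((13 * Real.log n / n) ^ F.card * ((n : ℝ) ^ (-0.58 : ℝ)) ^ S.card) := by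
        gcongr
    _ = _ := by rw [mul_pow]; ring

lemma low_prob (ε : ℝ) (hε : 0 < ε) : ∀ᶠ n : ℕ in atTop, ∀ R t1 t3 : ℕ, 0 < R → t1 ≤ R → t3 ≤ R →
    0.6 * Real.log n / n ≤ (t1 : ℝ) / R → (t3 : ℝ) / R ≤ 13 * Real.log n / n →
    Pr {ω : Sym2 (Fin n) → Fin R | ¬ LowP (gr ω t1) (gr ω t3) 25} ≤ ε := by
  filter_upwards [ev_log (3 * (13 ^ 3 * 100 ^ 50) / ε) 3 (c := 0.16) (by norm_num), ev_L 1,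
    eventually_ge_atTop 300] with n hb hL hn R t1 t3 hR ht1 ht3 h1 h3
  have hn' : (300 : ℝ) ≤ n := by exact_mod_cast hn
  have hn0 : (0 : ℝ) < n := by linarith
  set L := Real.log n with hLd
  set c : ℝ := 13 ^ 3 * 100 ^ 50 * L ^ 3 * (n : ℝ) ^ (-0.16 : ℝ) with hc
  have hcard : ((univ : Finset (Fin n × Fin n × Fin n)).card : ℝ) = (n : ℝ) ^ 3 := by
    rw [card_univ, Fintype.card_prod, Fintype.card_prod, Fintype.card_fin]; push_cast; ring
  have hcard2 : ((univ : Finset (Fin n × Fin n)).card : ℝ) = (n : ℝ) ^ 2 := by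
    rw [card_univ, Fintype.card_prod, Fintype.card_fin]; push_cast; ring
  have g := fun S T a b F d => lowG (n := n) hR ht1 ht3 hn h1 h3 S T a b F d
  have hy : ((n : ℝ) ^ (-0.58 : ℝ)) ^ 2 = (n : ℝ)⁻¹ * (n : ℝ) ^ (-0.16 : ℝ) := by
    rw [← Real.rpow_natCast, ← Real.rpow_mul hn0.le, ← Real.rpow_neg_one, ← Real.rpow_add hn0]; norm_num
  have hy2 : (n : ℝ) ^ (-0.58 : ℝ) ≤ (n : ℝ) ^ (-0.16 : ℝ) :=
    Real.rpow_le_rpow_of_exponent_le (by linarith) (by norm_num)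
  have hL2 : L ^ 2 ≤ L ^ 3 := pow_le_pow_right₀ hL (by norm_num)
  have hL1 : L ≤ L ^ 3 := le_self_pow₀ hL (by norm_num)
  have b1 : Pr {ω : Sym2 (Fin n) → Fin R | ∃ u v, Low (gr ω t1) 25 u ∧ Low (gr ω t1) 25 v ∧ (gr ω t3).Adj u v} ≤ c := by
    refine Pr_union_bound (univ : Finset (Fin n × Fin n)) (fun q => {ω | Low (gr ω t1) 25 q.1 ∧ Low (gr ω t1) 25 q.2 ∧
      (gr ω t3).Adj q.1 q.2}) ?_ (b := (13 * L / n) ^ 1 * (100 ^ 25 * (n : ℝ) ^ (-0.58 : ℝ)) ^ 2) ?_ ?_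
    · rintro ω ⟨u, v, h⟩; exact ⟨(u, v), mem_univ _, h⟩
    · rintro ⟨u, v⟩ -
      by_cases huv : u = v
      · refine (Pr_mono (B := ∅) ?_).trans ?_
        · rintro ω ⟨-, -, h⟩; exact absurd huv h.1
        · have : Pr (∅ : Set (Sym2 (Fin n) → Fin R)) = 0 := by simp [Pr, Ex]
          rw [this]; positivity
      have := g {u, v} {u, v} subset_rfl ((card_le_two).trans (by norm_num)) {s(u, v)} (by simp)
      rw [card_singleton, card_pair huv] at this
      refine (Pr_mono ?_).trans this
      rintro ω ⟨k1, k2, k3⟩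
      exact ⟨by simp [k1, k2], by simpa using k3.2⟩
    · rw [hcard2, mul_pow, hy, hc]
      calc (n : ℝ) ^ 2 * ((13 * L / n) ^ 1 * ((100 ^ 25) ^ 2 * ((n : ℝ)⁻¹ * (n : ℝ) ^ (-0.16 : ℝ))))
          = 13 * 100 ^ 50 * L * (n : ℝ) ^ (-0.16 : ℝ) := by field_simp
        _ ≤ _ := by gcongr; norm_num
  have b2 : Pr {ω : Sym2 (Fin n) → Fin R | ∃ u v w, u ≠ v ∧ Low (gr ω t1) 25 u ∧ Low (gr ω t1) 25 v ∧
      (gr ω t3).Adj u w ∧ (gr ω t3).Adj v w} ≤ c := by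
    refine Pr_union_bound (univ : Finset (Fin n × Fin n × Fin n)) (fun q => {ω | q.1 ≠ q.2.1 ∧ Low (gr ω t1) 25 q.1 ∧
      Low (gr ω t1) 25 q.2.1 ∧ (gr ω t3).Adj q.1 q.2.2 ∧ (gr ω t3).Adj q.2.1 q.2.2}) ?_
      (b := (13 * L / n) ^ 2 * (100 ^ 25 * (n : ℝ) ^ (-0.58 : ℝ)) ^ 2) ?_ ?_
    · rintro ω ⟨u, v, w, h⟩; exact ⟨(u, v, w), mem_univ _, h⟩
    · rintro ⟨u, v, w⟩ -
      by_cases huv : u = v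
      · refine (Pr_mono (B := ∅) ?_).trans ?_
        · rintro ω ⟨h, -⟩; exact absurd huv h
        · have : Pr (∅ : Set (Sym2 (Fin n) → Fin R)) = 0 := by simp [Pr, Ex]
          rw [this]; positivity
      have := g {u, v} {u, v, w} (by intro x; simp; tauto) card_le_three {s(u, w), s(v, w)} (by simp)
      rw [card_pair (fun h => huv (Sym2.congr_left.1 h)), card_pair huv] at this
      refine (Pr_mono ?_).trans this
      rintro ω ⟨-, k1, k2, k3, k4⟩
      exact ⟨by simp [k1, k2], by simpa using ⟨k3.2, k4.2⟩⟩
    · rw [hcard, mul_pow (100 ^ 25 : ℝ), hy, hc]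
      calc (n : ℝ) ^ 3 * ((13 * L / n) ^ 2 * ((100 ^ 25) ^ 2 * ((n : ℝ)⁻¹ * (n : ℝ) ^ (-0.16 : ℝ))))
          = 13 ^ 2 * 100 ^ 50 * L ^ 2 * (n : ℝ) ^ (-0.16 : ℝ) := by field_simp
        _ ≤ _ := by gcongr <;> norm_num
  have b3 : Pr {ω : Sym2 (Fin n) → Fin R | ∃ u v w, Low (gr ω t1) 25 u ∧ (gr ω t3).Adj u v ∧
      (gr ω t3).Adj u w ∧ (gr ω t3).Adj v w} ≤ c := by
    refine Pr_union_bound (univ : Finset (Fin n × Fin n × Fin n)) (fun q => {ω | Low (gr ω t1) 25 q.1 ∧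
      (gr ω t3).Adj q.1 q.2.1 ∧ (gr ω t3).Adj q.1 q.2.2 ∧ (gr ω t3).Adj q.2.1 q.2.2}) ?_
      (b := (13 * L / n) ^ 3 * (100 ^ 25 * (n : ℝ) ^ (-0.58 : ℝ)) ^ 1) ?_ ?_
    · rintro ω ⟨u, v, w, h⟩; exact ⟨(u, v, w), mem_univ _, h⟩
    · rintro ⟨u, v, w⟩ -
      by_cases huv : u ≠ v ∧ u ≠ w ∧ v ≠ w
      · have := g {u} {u, v, w} (by simp) card_le_three {s(u, v), s(u, w), s(v, w)} (by simp)
        rw [card_singleton, card_eq_three.2 ⟨s(u, v), s(u, w), s(v, w), by simp [huv], by simp [huv],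
          by simp [huv], rfl⟩] at this
        refine (Pr_mono ?_).trans this
        rintro ω ⟨k1, k2, k3, k4⟩
        exact ⟨by simp [k1], by simpa using ⟨k2.2, k3.2, k4.2⟩⟩
      · refine (Pr_mono (B := ∅) ?_).trans ?_
        · rintro ω ⟨-, k1, k2, k3⟩; exact absurd ⟨k1.1, k2.1, k3.1⟩ huv
        · have : Pr (∅ : Set (Sym2 (Fin n) → Fin R)) = 0 := by simp [Pr, Ex]
          rw [this]; positivity
    · rw [hcard, pow_one, hc]
      calc (n : ℝ) ^ 3 * ((13 * L / n) ^ 3 * (100 ^ 25 * (n : ℝ) ^ (-0.58 : ℝ)))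
          = 13 ^ 3 * 100 ^ 25 * L ^ 3 * (n : ℝ) ^ (-0.58 : ℝ) := by field_simp
        _ ≤ _ := by gcongr <;> norm_num
  set S1 := {ω : Sym2 (Fin n) → Fin R | ∃ u v, Low (gr ω t1) 25 u ∧ Low (gr ω t1) 25 v ∧ (gr ω t3).Adj u v} with hS1
  set S2 := {ω : Sym2 (Fin n) → Fin R | ∃ u v w, u ≠ v ∧ Low (gr ω t1) 25 u ∧ Low (gr ω t1) 25 v ∧
      (gr ω t3).Adj u w ∧ (gr ω t3).Adj v w} with hS2
  refine (Pr_union_le (A := S1 ∪ S2) ?_).trans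
    ((add_le_add ((Pr_union_le (A := S1) (B := S2) fun ω hω => hω).trans (add_le_add b1 b2)) b3).trans ?_)
  · intro ω hω
    by_contra hcon
    simp only [Set.mem_union, hS1, hS2, Set.mem_ofPred_eq] at hcon
    rw [not_or, not_or] at hcon
    obtain ⟨⟨c1, c2⟩, c3⟩ := hcon
    refine hω ⟨fun u v k1 k2 k3 => c1 ⟨u, v, k1, k2, k3⟩, fun u v w k0 k1 k2 k3 k4 => c2 ⟨u, v, w, k0, k1, k2, k3, k4⟩,
      fun u v w k1 k2 k3 k4 => c3 ⟨u, v, w, k1, k2, k3, k4⟩⟩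
  · rw [hc, show (-0.16 : ℝ) = -(0.16 : ℝ) by norm_num, Real.rpow_neg hn0.le]
    have hx : 0 < (n : ℝ) ^ (0.16 : ℝ) := by positivity
    rw [div_mul_eq_mul_div, div_le_iff₀ hε] at hb
    rw [← div_eq_mul_inv, ← add_div, ← add_div, div_le_iff₀ hx]
    linarith
end low
end RacgFib

namespace RacgFib
open Classical Finset Filter

def NonE {V : Type*} (G : SimpleGraph V) : Prop := ∃ a b, a ≠ b ∧ ¬ G.Adj a b
def BadG {V : Type*} (G : SimpleGraph V) : Prop :=
  (∀ v, ∃ a b, a ≠ b ∧ G.Adj v a ∧ G.Adj v b) ∧ NonE G ∧ ¬ VirtuallyAlgebraicallyFibers (RACG G)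

def H1P {V : Type*} (G6 : SimpleGraph V) : Prop := ∀ u v w, u ≠ v → u ≠ w → v ≠ w → G6.Adj u v ∨ G6.Adj u w
def H2P {V : Type*} (G5 G6 : SimpleGraph V) : Prop :=
  ∀ a b c d, a ≠ b → a ≠ c → a ≠ d → b ≠ c → b ≠ d → c ≠ d → ¬ G6.Adj a b → ¬ G6.Adj c d → G5.Adj a c
def H3P {V : Type*} (G6 : SimpleGraph V) : Prop := ∃ a b : Fin 6 → V, ∀ i, a i ≠ b i ∧ ¬ G6.Adj (a i) (b i) ∧
      ∀ j, i ≠ j → s(a i, b i) ≠ s(a j, b j)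
def H4P {V : Type*} (G5 G6 : SimpleGraph V) : Prop :=
  ∀ v, ∀ a b : Fin 6 → V, (∀ i, v ≠ a i ∧ v ≠ b i ∧ a i ≠ b i ∧ ¬ G6.Adj (a i) (b i) ∧
      ∀ j, i ≠ j → a i ≠ a j ∧ a i ≠ b j ∧ b i ≠ b j) → ∃ i, G5.Adj v (a i)

lemma det_main {n R t1 t2 t3 t5 t6 z0 : ℕ} (ω : Sym2 (Fin n) → Fin R)
    (e1 : ¬ MinDeg2 (gr ω t1)) (e2 : CliqP (gr ω t2) 19) (e3 : S6P (gr ω t3) z0)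
    (e4 : LowP (gr ω t1) (gr ω t3) 25) (e5 : H1P (gr ω t6)) (e6 : H2P (gr ω t5) (gr ω t6))
    (e7 : H3P (gr ω t6)) (e8 : H4P (gr ω t5) (gr ω t6))
    (e9 : ∀ t, t ≤ R → t1 ≤ t ∧ t ≤ t2 → ClosP (gr ω t) (n / 100 + 1))
    (e10 : ∀ t, t ≤ R → t1 ≤ t → S4P (gr ω t) 19 z0 (n / 100 + 1))
    (e11 : ∀ t, t ≤ R → t3 ≤ t → S4P (gr ω t) 19 1 (n / 100 + 1))
    (e12 : ∀ t, t ≤ R → t2 ≤ t ∧ t ≤ t5 → R3P (gr ω t)) (t : ℕ) (ht : t ≤ R) : ¬ BadG (gr ω t) := by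
  rintro ⟨hdeg, ⟨a, b, hab, hn⟩, hv⟩
  apply hv
  rcases le_total t t1 with h | h1
  · exfalso
    apply e1
    intro v
    obtain ⟨a, b, hab, h2, h3⟩ := hdeg v
    exact ⟨a, b, hab, gr_mono ω h h2, gr_mono ω h h3⟩
  rcases le_total t t2 with h2 | h2
  · obtain ⟨L, hF, hcl, hL⟩ := e9 t ht ⟨h1, h2⟩
    have hκ : CliqP (gr ω t) 19 := CliqP.mono (gr_mono ω h2) e2
    have : L = Set.univ := by
      rcases le_total t t3 with h3 | h3
      · have hz := closed_small hcl hκ hL (e10 t ht h1)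
        exact low_finish hcl (D := 25) (by norm_num) (gr_mono ω h1) (gr_mono ω h3) hκ hz e4.1 e4.2.1 e4.2.2 e3 hdeg
      · have hz := closed_small hcl hκ hL (e11 t ht h3)
        refine Set.eq_univ_of_forall fun v => ?_
        by_contra hv'
        rw [Nat.lt_one_iff, card_eq_zero] at hz
        have : v ∈ (Finset.univ.filter (fun z => z ∉ L)) := by simp [hv']
        rw [hz] at this
        simp at this
    rw [this] at hF
    exact vf_of_univ hF
  rcases le_total t t5 with h5 | h5
  · exact r3_det hab hn fun v k1 k2 => e12 t ht ⟨h2, h5⟩ a b v hab k1 k2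
  rcases le_total t t6 with h6 | h6
  · exact r4_det (gr_mono ω h5) (gr_mono ω h6) e5 e6 e7 e8
  · exact r6_det (gr_mono ω h6) hab hn e5

lemma Pr_ex_t {n : ℕ} (hn : 0 < n) {ε : ℝ} (h14 : 14 ≤ ε * n) (P : ℕ → Prop) (Q : SimpleGraph (Fin n) → Prop)
    (h : ∀ t, t ≤ n ^ 6 → P t → Pr {ω : Sym2 (Fin n) → Fin (n ^ 6) | ¬ Q (gr ω t)} ≤ 7 / (n : ℝ) ^ 7) :
    Pr {ω : Sym2 (Fin n) → Fin (n ^ 6) | ¬ ∀ t, t ≤ n ^ 6 → P t → Q (gr ω t)} ≤ ε := by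
  have hn1 : (1 : ℝ) ≤ n := by exact_mod_cast hn
  refine Pr_union_bound ((range (n ^ 6 + 1)).filter P) (fun t => {ω | ¬ Q (gr ω t)}) ?_ (b := 7 / (n : ℝ) ^ 7) ?_ ?_
  · intro ω hω
    simp only [Set.mem_ofPred_eq] at hω
    push Not at hω
    obtain ⟨t, h1, h2, h3⟩ := hω
    exact ⟨t, by simp only [mem_filter, mem_range]; exact ⟨by omega, h2⟩, h3⟩
  · intro t ht
    simp only [mem_filter, mem_range] at ht
    exact h t (by omega) ht.2
  · have k := card_filter_le (range (n ^ 6 + 1)) P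
    rw [card_range] at k
    have k' : ((((range (n ^ 6 + 1)).filter P).card : ℕ) : ℝ) ≤ n ^ 6 + 1 := by exact_mod_cast k
    have k2 : (1 : ℝ) ≤ n ^ 6 := one_le_pow₀ hn1
    calc _ ≤ ((2 * n ^ 6 : ℝ)) * (7 / n ^ 7) := by gcongr; linarith
      _ = 14 / n := by field_simp; norm_num
      _ ≤ ε := by rw [div_le_iff₀ (by linarith)]; exact h14

lemma Pr_list {E : Type*} [Fintype E] {R : ℕ} (l : List (Set (E → Fin R))) {B : Set (E → Fin R)} {b : ℝ} (hb0 : 0 ≤ b)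
    (hb : ∀ A ∈ l, Pr A ≤ b) (h : ∀ ω ∈ B, ∃ A ∈ l, ω ∈ A) : Pr B ≤ l.length * b := by
  refine Pr_union_bound l.toFinset (fun A => A) (by simpa using h) (b := b) (by simpa using hb) ?_
  gcongr
  exact List.toFinset_card_le l

lemma thr_ceil {R : ℕ} (hR : 0 < R) {x : ℝ} (h0 : 0 ≤ x) (h1 : x ≤ 1) :
    ∃ t : ℕ, t ≤ R ∧ x ≤ (t : ℝ) / R ∧ (t : ℝ) / R ≤ x + 1 / R := by
  have hR' : (0 : ℝ) < R := by exact_mod_cast hR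
  refine ⟨⌈x * R⌉₊, ?_, ?_, ?_⟩
  · rw [Nat.ceil_le]; nlinarith
  · rw [le_div_iff₀ hR']; exact Nat.le_ceil _
  · rw [div_le_iff₀ hR', add_mul, one_div_mul_cancel hR'.ne']
    exact (Nat.ceil_lt_add_one (by positivity)).le

lemma thr_floor {R : ℕ} (hR : 0 < R) {x : ℝ} (h0 : 0 ≤ x) (h1 : x ≤ 1) :
    ∃ t : ℕ, t ≤ R ∧ (t : ℝ) / R ≤ x ∧ x - 1 / R ≤ (t : ℝ) / R := by
  have hR' : (0 : ℝ) < R := by exact_mod_cast hR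
  have h2 := Nat.floor_le (show 0 ≤ x * R by positivity)
  refine ⟨⌊x * R⌋₊, ?_, ?_, ?_⟩
  · have : (⌊x * R⌋₊ : ℝ) ≤ R := by nlinarith
    exact_mod_cast this
  · rw [div_le_iff₀ hR']; exact h2
  · rw [le_div_iff₀ hR', sub_mul, one_div_mul_cancel hR'.ne']
    linarith [Nat.lt_floor_add_one (x * R)]

lemma bad_small (ε : ℝ) (hε : 0 < ε) : ∀ᶠ n : ℕ in atTop,
    Pr {ω : Sym2 (Fin n) → Fin (n ^ 6) | ∃ t, t ≤ n ^ 6 ∧ BadG (gr ω t)} ≤ 12 * ε := by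
  filter_upwards [r1_prob ε hε, s5_prob ε hε, s6_prob ε hε, low_prob ε hε, r2a, s4_A, s4_B, r3_prob,
    ev_const (14 / ε) (c := 1) (by norm_num), ev_const (4096 / ε) (c := 1 / 16) (by norm_num), ev_L 1,
    ev_log 100 1 (c := 1) (by norm_num), eventually_ge_atTop 4]
    with n p1 p2 p3 p4 p9 p10 p11 p12 c14 cx hL hLn hn
  have hn1 : (4 : ℝ) ≤ n := by exact_mod_cast hn
  have hn0 : (0 : ℝ) < n := lt_of_lt_of_le (by norm_num) hn1
  have hR : 0 < n ^ 6 := by positivity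
  have hRr : (1 : ℝ) / ((n ^ 6 : ℕ) : ℝ) = 1 / (n : ℝ) ^ 6 := by push_cast; rfl
  have hR2 : 1 / (n : ℝ) ^ 6 ≤ 0.01 / n := by
    rw [div_le_div_iff₀ (by positivity) hn0]
    have : (4 : ℝ) ^ 5 * n ≤ (n : ℝ) ^ 5 * n := by gcongr
    rw [← pow_succ] at this
    norm_num at this ⊢
    linarith only [this, hn0]
  rw [pow_one, Real.rpow_one] at hLn
  set L := Real.log n with hLd
  have hLn' : L / n ≤ 1 / 100 := by rw [div_le_div_iff₀ hn0 (by norm_num)]; linarith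
  have hLn0 : 0 ≤ L / n := by positivity
  have hLn2 : 1 / (n : ℝ) ≤ L / n := by gcongr
  obtain ⟨t1, a1, b1, d1⟩ := thr_ceil hR (x := 0.6 * L / n) (by positivity) (by rw [mul_div_assoc]; linarith)
  obtain ⟨t3, a3, b3, d3⟩ := thr_ceil hR (x := 12 * L / n) (by positivity) (by rw [mul_div_assoc]; linarith)
  set x : ℝ := (n : ℝ) ^ (1 / 16 : ℝ) with hx
  have hx1 : 1 ≤ x := Real.one_le_rpow (by linarith) (by norm_num)
  have hxn : (n : ℝ) = x ^ 16 := by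
    rw [hx, ← Real.rpow_natCast, ← Real.rpow_mul hn0.le]; norm_num
  have hxR : 1 / (n : ℝ) ^ 6 = 1 / x ^ 96 := by rw [hxn, ← pow_mul]
  have ho : ∀ a b : ℕ, a ≤ b → 1 / x ^ b ≤ 1 / x ^ a := fun a b h =>
    one_div_le_one_div_of_le (by positivity) (pow_le_pow_right₀ hx1 h)
  have hn9 : (n : ℝ) ^ (-(1 / 9) : ℝ) ≤ 1 := Real.rpow_le_one_of_one_le_of_nonpos (by linarith) (by norm_num)
  have hn9' : 1 / (n : ℝ) ≤ (n : ℝ) ^ (-(1 / 9) : ℝ) := by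
    rw [one_div, ← Real.rpow_neg_one]
    exact Real.rpow_le_rpow_of_exponent_le (by linarith) (by norm_num)
  have hn4 : (n : ℝ) ^ (-(1 / 4) : ℝ) = 1 / x ^ 4 := by
    rw [hx, ← Real.rpow_natCast, ← Real.rpow_mul hn0.le, Real.rpow_neg hn0.le, one_div ((n : ℝ) ^ _)]; norm_num
  have hx4 : 1 / x ^ 4 ≤ 1 := by have := ho 0 4 (by norm_num); simpa using this
  have hx31 : 1 / x ^ 31 ≤ 1 := by have := ho 0 31 (by norm_num); simpa using this
  obtain ⟨t2, a2, b2, d2⟩ := thr_ceil hR (x := (n : ℝ) ^ (-(1 / 9) : ℝ)) (by positivity) hn9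
  obtain ⟨t5, a5, b5, d5⟩ := thr_floor hR (x := 1 - 1 / x ^ 4) (by linarith) (by
    have : 0 ≤ 1 / x ^ 4 := by positivity
    linarith)
  obtain ⟨t6, a6, b6, d6⟩ := thr_floor hR (x := 1 - 1 / x ^ 31) (by linarith) (by
    have : 0 ≤ 1 / x ^ 31 := by positivity
    linarith)
  rw [hRr] at d1 d2 d3 d5 d6
  have hR3 : 0.01 / (n : ℝ) = 0.01 * (1 / n) := by ring
  have f1 : (t1 : ℝ) / ((n ^ 6 : ℕ) : ℝ) ≤ 0.61 * L / n := by
    rw [mul_div_assoc] at d1 ⊢; linarith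
  have f3 : (t3 : ℝ) / ((n ^ 6 : ℕ) : ℝ) ≤ 13 * L / n := by
    rw [mul_div_assoc] at d3 ⊢; linarith
  have hn0' : 0 < 1 / (n : ℝ) := by positivity
  have f2 : (t2 : ℝ) / ((n ^ 6 : ℕ) : ℝ) ≤ 2 * (n : ℝ) ^ (-(1 / 9) : ℝ) := by linarith
  have f5 : 1 - (t5 : ℝ) / ((n ^ 6 : ℕ) : ℝ) ≤ 2 / x ^ 4 := by
    have := ho 4 96 (by norm_num)
    rw [show 2 / x ^ 4 = 2 * (1 / x ^ 4) by ring]; linarith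
  have f6 : 1 - (t6 : ℝ) / ((n ^ 6 : ℕ) : ℝ) ≤ 2 / x ^ 31 := by
    have := ho 31 96 (by norm_num)
    rw [show 2 / x ^ 31 = 2 * (1 / x ^ 31) by ring]; linarith
  have f6' : 1 / x ^ 31 ≤ 1 - (t6 : ℝ) / ((n ^ 6 : ℕ) : ℝ) := by linarith
  have hx0 : 0 < x := by linarith
  have hmono : ∀ t t' : ℕ, t ≤ t' → (t : ℝ) / ((n ^ 6 : ℕ) : ℝ) ≤ (t' : ℝ) / ((n ^ 6 : ℕ) : ℝ) := by
    intro t t' h; gcongr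
  have h14 : 14 ≤ ε * n := by rw [div_le_iff₀ hε, Real.rpow_one] at c14; linarith
  have hxe : ∀ C : ℝ, C ≤ 4096 → C / x ≤ ε := by
    intro C hC
    rw [div_le_iff₀ hε] at cx
    rw [div_le_iff₀ hx0]; linarith
  have h7 : ∀ C : ℝ, C ≤ 7 → C / (n : ℝ) ^ 7 ≤ 7 / (n : ℝ) ^ 7 := fun C hC => by gcongr
  set z0 := ⌈(n : ℝ) ^ (0.45 : ℝ)⌉₊ with hz0
  have := Pr_list (E := Sym2 (Fin n)) (R := n ^ 6) (b := ε) (B := {ω | ∃ t, t ≤ n ^ 6 ∧ BadG (gr ω t)})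
    [{ω | MinDeg2 (gr ω t1)}, {ω | ¬ CliqP (gr ω t2) 19}, {ω | ¬ S6P (gr ω t3) z0},
     {ω | ¬ LowP (gr ω t1) (gr ω t3) 25}, {ω | ¬ H1P (gr ω t6)}, {ω | ¬ H2P (gr ω t5) (gr ω t6)},
     {ω | ¬ H3P (gr ω t6)}, {ω | ¬ H4P (gr ω t5) (gr ω t6)},
     {ω | ¬ ∀ t, t ≤ n ^ 6 → t1 ≤ t ∧ t ≤ t2 → ClosP (gr ω t) (n / 100 + 1)},
     {ω | ¬ ∀ t, t ≤ n ^ 6 → t1 ≤ t → S4P (gr ω t) 19 z0 (n / 100 + 1)},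
     {ω | ¬ ∀ t, t ≤ n ^ 6 → t3 ≤ t → S4P (gr ω t) 19 1 (n / 100 + 1)},
     {ω | ¬ ∀ t, t ≤ n ^ 6 → t2 ≤ t ∧ t ≤ t5 → R3P (gr ω t)}] hε.le ?_ ?_
  · simpa using this
  · simp only [List.forall_mem_cons]
    refine ⟨p1 _ _ hR a1 f1, p2 _ _ hR a2 f2, p3 _ _ hR a3 f3, p4 _ _ _ hR a1 a3 b1 f3,
      (r4_h1 hR a6 hx1 hxn f6).trans (hxe 4 (by norm_num)), (r4_h2 hR a5 a6 hx1 hxn f6 f5).trans (hxe 8 (by norm_num)),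
      (r4_h3 hR a6 hx1 (by omega) hxn f6').trans (hxe 256 (by norm_num)),
      (r4_h4 hR a5 a6 hx1 hxn f6 f5).trans (hxe 4096 le_rfl), ?_, ?_, ?_, ?_, ?_⟩
    · refine Pr_ex_t (by omega) h14 (fun t => t1 ≤ t ∧ t ≤ t2) (fun G => ClosP G (n / 100 + 1)) fun t ht h => ?_
      exact p9 _ t hR ht (b1.trans (hmono _ _ h.1)) ((hmono _ _ h.2).trans f2)
    · refine Pr_ex_t (by omega) h14 (fun t => t1 ≤ t) (fun G => S4P G 19 z0 (n / 100 + 1)) fun t ht h => ?_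
      exact (p10 _ t hR ht (b1.trans (hmono _ _ h))).trans (h7 2 (by norm_num))
    · refine Pr_ex_t (by omega) h14 (fun t => t3 ≤ t) (fun G => S4P G 19 1 (n / 100 + 1)) fun t ht h => ?_
      exact (p11 _ t hR ht (b3.trans (hmono _ _ h))).trans (h7 2 (by norm_num))
    · refine Pr_ex_t (by omega) h14 (fun t => t2 ≤ t ∧ t ≤ t5) (fun G => R3P G) fun t ht h => ?_
      exact (p12 _ t hR ht (b2.trans (hmono _ _ h.1)) (by rw [hn4]; exact (hmono _ _ h.2).trans b5)).trans
        (h7 1 (by norm_num))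
    · simp
  · rintro ω ⟨t, ht, hbad⟩
    by_contra hcon
    simp only [List.mem_cons, exists_eq_or_imp, Set.mem_ofPred_eq, List.not_mem_nil, false_and, exists_false,
      or_false, not_or, not_not] at hcon
    obtain ⟨e1, e2, e3, e4, e5, e6, e7, e8, e9, e10, e11, e12⟩ := hcon
    exact det_main ω e1 e2 e3 e4 e5 e6 e7 e8 e9 e10 e11 (by by_contra h; exact e12 ⟨_, rfl, h⟩) t ht hbad
end RacgFib

namespace RacgFib
open Finset Classical

lemma pg_adj {n : ℕ} (σ : Ord n) (m : ℕ) (a b : Fin n) :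
    (processGraph σ m).Adj a b ↔ ∃ i : Fin (n.choose 2), (i : ℕ) < m ∧ (σ i : Sym2 (Fin n)) = s(a, b) := by
  unfold processGraph
  rw [SimpleGraph.fromEdgeSet_adj]
  constructor
  · exact fun h => h.1
  · rintro ⟨i, h1, h2⟩
    refine ⟨⟨i, h1, h2⟩, ?_⟩
    rintro rfl
    exact (σ i).2 (by rw [h2]; simp)

lemma pg_mono {n : ℕ} (σ : Ord n) {m m' : ℕ} (h : m ≤ m') (a b : Fin n) :
    (processGraph σ m).Adj a b → (processGraph σ m').Adj a b := by
  simp only [pg_adj]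
  rintro ⟨i, h1, h2⟩
  exact ⟨i, by omega, h2⟩

lemma pg_full {n : ℕ} (σ : Ord n) (a b : Fin n) (h : a ≠ b) : (processGraph σ (n.choose 2)).Adj a b := by
  rw [pg_adj]
  refine ⟨σ.symm ⟨s(a, b), by simpa using h⟩, Fin.is_lt _, by simp⟩

lemma pg_nonE {n : ℕ} (σ : Ord n) {m : ℕ} (hm : m < n.choose 2) : NonE (processGraph σ m) := by
  obtain ⟨⟨e, hd⟩, he⟩ : ∃ e, e = σ ⟨m, hm⟩ := ⟨_, rfl⟩
  induction e using Sym2.ind with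
  | _ a b =>
    refine ⟨a, b, by simpa using hd, ?_⟩
    rw [pg_adj]
    rintro ⟨i, h1, h2⟩
    have : σ i = σ ⟨m, hm⟩ := by rw [← he]; exact Subtype.ext h2
    have := congrArg Fin.val (σ.injective this)
    simp only at this
    omega

lemma two_nb {n : ℕ} (G : SimpleGraph (Fin n)) (v : Fin n) :
    2 ≤ (G.neighborSet v).ncard ↔ ∃ a b, a ≠ b ∧ G.Adj v a ∧ G.Adj v b := by
  rw [← Nat.lt_iff_add_one_le, Set.one_lt_ncard_iff (Set.toFinite _)]
  simp only [SimpleGraph.mem_neighborSet]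
  constructor
  · rintro ⟨a, b, h1, h2, h3⟩; exact ⟨a, b, h3, h1, h2⟩
  · rintro ⟨a, b, h1, h2, h3⟩; exact ⟨a, b, h2, h3, h1⟩

lemma good_of_not_bad {n : ℕ} (hn : 4 ≤ n) (σ : Ord n)
    (h : ¬ ∃ m, m < n.choose 2 ∧ BadG (processGraph σ m)) (m : ℕ) (hm : m < n.choose 2) :
    VirtuallyAlgebraicallyFibers (RACG (processGraph σ m)) ↔ hittingTime σ ≤ m := by
  have ex : ∀ S : Finset (Fin n), S.card < 4 → ∃ u, u ∉ S := by
    intro S hS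
    by_contra hc
    push Not at hc
    have : S = univ := by ext x; simp [hc x]
    rw [this, card_univ, Fintype.card_fin] at hS
    omega
  constructor
  · intro hv
    by_contra hlt
    push Not at hlt
    have h1 := Nat.notMem_of_lt_sInf hlt
    simp only [Set.mem_ofPred_eq, two_nb] at h1
    push Not at h1
    obtain ⟨v, h1⟩ := h1
    obtain ⟨w, hvw, hN⟩ : ∃ w, v ≠ w ∧ ∀ u, (processGraph σ m).Adj v u → u = w := by
      by_cases hw : ∃ w, (processGraph σ m).Adj v w
      · obtain ⟨w, hw⟩ := hw
        refine ⟨w, hw.ne, fun u hu => ?_⟩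
        by_contra hne
        exact h1 u w hne hu hw
      · obtain ⟨w, hw'⟩ := ex {v} (by simp)
        push Not at hw
        exact ⟨w, fun e => hw' (by simp [e]), fun u hu => absurd hu (hw u)⟩
    obtain ⟨u1, hu1⟩ := ex {v, w} (lt_of_le_of_lt (card_le_two) (by norm_num))
    obtain ⟨u2, hu2⟩ := ex {v, w, u1} (lt_of_le_of_lt (card_le_three) (by norm_num))
    simp only [mem_insert, mem_singleton, not_or] at hu1 hu2
    exact not_fib hN hvw hu1.1 hu1.2 hu2.1 hu2.2.1 (Ne.symm hu2.2.2) hv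
  · intro hT
    by_contra hv
    apply h
    refine ⟨m, hm, ?_, pg_nonE σ hm, hv⟩
    have hmem : hittingTime σ ∈ {m : ℕ | ∀ v : Fin n, 2 ≤ ((processGraph σ m).neighborSet v).ncard} := by
      apply Nat.sInf_mem
      refine ⟨n.choose 2, ?_⟩
      simp only [Set.mem_ofPred_eq, two_nb]
      intro v
      obtain ⟨a, ha⟩ := ex {v} (by simp)
      obtain ⟨b, hb⟩ := ex {v, a} (lt_of_le_of_lt (card_le_two) (by norm_num))
      simp only [mem_insert, mem_singleton, not_or] at ha hb
      exact ⟨a, b, Ne.symm hb.2, pg_full σ _ _ (Ne.symm ha), pg_full σ _ _ (Ne.symm hb.1)⟩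
    simp only [Set.mem_ofPred_eq, two_nb] at hmem
    intro v
    obtain ⟨a, b, h1, h2, h3⟩ := hmem v
    exact ⟨a, b, h1, pg_mono σ hT _ _ h2, pg_mono σ hT _ _ h3⟩

lemma ord_nonempty (n : ℕ) : Nonempty (Ord n) := by
  have : Fintype.card (Fin (n.choose 2)) = Fintype.card (NDg n) := by
    rw [Sym2.card_subtype_not_diag, Fintype.card_fin, Fintype.card_fin]
  exact ⟨Fintype.equivOfCardEq this⟩

lemma final_ev (ε : ℝ) (hε : 0 < ε) : ∀ᶠ n : ℕ in atTop,
    1 - 24 * ε ≤ ((Nat.card {σ : Ord n // ∀ m : ℕ, m < n.choose 2 →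
              (VirtuallyAlgebraicallyFibers (RACG (processGraph σ m)) ↔
                hittingTime σ ≤ m)} : ℝ) / (Nat.card (Ord n) : ℝ)) := by
  filter_upwards [bad_small ε hε, eventually_ge_atTop 4] with n hb hn
  have hle : 2 * (n.choose 2) ^ 2 ≤ n ^ 6 := by
    have h1 : n.choose 2 ≤ n ^ 2 := Nat.choose_le_pow n 2
    calc 2 * (n.choose 2) ^ 2 ≤ n ^ 2 * (n ^ 2) ^ 2 := by gcongr; nlinarith
      _ = n ^ 6 := by ring
  have ht := transfer hle (by positivity) BadG
  haveI := ord_nonempty n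
  have hpos : (0 : ℝ) < Nat.card (Ord n) := by exact_mod_cast Nat.card_pos
  have key : Nat.card (Ord n) ≤ Nat.card {σ : Ord n // ∀ m : ℕ, m < n.choose 2 →
              (VirtuallyAlgebraicallyFibers (RACG (processGraph σ m)) ↔ hittingTime σ ≤ m)} +
      Nat.card {σ : Ord n // ∃ m, m < n.choose 2 ∧ BadG (processGraph σ m)} := by
    have h3 : Nat.card (Ord n) = Nat.card {σ : Ord n // ∃ m, m < n.choose 2 ∧ BadG (processGraph σ m)} +
        Nat.card {σ : Ord n // ¬ ∃ m, m < n.choose 2 ∧ BadG (processGraph σ m)} := by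
      rw [← Nat.card_sum]
      exact (Nat.card_congr (Equiv.sumCompl _)).symm
    rw [h3, add_comm]
    gcongr
    exact Nat.card_le_card_of_injective (fun σ => ⟨σ.1, good_of_not_bad hn σ.1 σ.2⟩)
      (fun a b hab => Subtype.ext (congrArg (fun z => z.1) hab))
  have key' : (Nat.card (Ord n) : ℝ) ≤ (Nat.card {σ : Ord n // ∀ m : ℕ, m < n.choose 2 →
              (VirtuallyAlgebraicallyFibers (RACG (processGraph σ m)) ↔ hittingTime σ ≤ m)} : ℝ) +
      (Nat.card {σ : Ord n // ∃ m, m < n.choose 2 ∧ BadG (processGraph σ m)} : ℝ) := by exact_mod_cast key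
  have h5 := div_le_div_of_nonneg_right key' hpos.le
  rw [div_self hpos.ne', add_div] at h5
  linarith only [h5, ht, hb]

end RacgFib

theorem aas_hitting_time_racg_fibers :
    Tendsto (fun n : ℕ =>
        ((Nat.card {σ : Fin (n.choose 2) ≃ {e : Sym2 (Fin n) // ¬ e.IsDiag} //
            ∀ m : ℕ, m < n.choose 2 →
              (VirtuallyAlgebraicallyFibers (RACG (processGraph σ m)) ↔
                hittingTime σ ≤ m)} : ℝ) /
          (Nat.card (Fin (n.choose 2) ≃ {e : Sym2 (Fin n) // ¬ e.IsDiag}) : ℝ)))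
      atTop (nhds 1) := by
  rw [tendsto_order]
  constructor
  · intro a ha
    filter_upwards [RacgFib.final_ev ((1 - a) / 25) (by linarith)] with n hn
    refine lt_of_lt_of_le ?_ hn
    linarith
  · intro a ha
    refine Eventually.of_forall fun n => lt_of_le_of_lt ?_ ha
    refine div_le_one_of_le₀ ?_ (by positivity)
    exact_mod_cast Nat.card_le_card_of_injective _ Subtype.val_injective
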